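/- arXiv:math/0609374 — 2 statements merged into one kernel-verified Lean document; each statement's English description precedes it below -/
import Mathlib

section
/- Let Ω ⊂ ℝ³ be a nonempty bounded open set and let k > 0 with k ≠ 1. Suppose that for every a ∈ ℝ³ there exists a solution of the conductivity inclusion problem with background field a that is linear in Ω. Then the induced map Λ from background fields to interior gradients is a linear bijection of ℝ³; concretely: (injectivity) if u and u' are solutions with background fields a and a' respectively and there is b ∈ ℝ³ with u(x) = ⟨b,x⟩ + c and u'(x) = ⟨b,x⟩ + c' for all x ∈ Ω, then a = a'; (surjectivity) for every b ∈ ℝ³ there exist a ∈ ℝ³ and a solution u with background field a and a constant c with u(x) = ⟨b,x⟩ + c for all x ∈ Ω. -/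
open MeasureTheory
open scoped RealInnerProductSpace

noncomputable section

abbrev Euc (d : ℕ) := EuclideanSpace ℝ (Fin d)

/-- `u` is a solution of the conductivity inclusion problem with inclusion `Ω`,
contrast `k`, and background field `a`. -/
def IsCondSol (d : ℕ) (Ω : Set (Euc d)) (k : ℝ) (a : Euc d) (u : Euc d → ℝ) : Prop :=
  Continuous u ∧ ContDiffOn ℝ (⊤ : ℕ∞) u Ω ∧ ContDiffOn ℝ (⊤ : ℕ∞) u (closure Ω)ᶜ ∧
  (∀ φ : Euc d → ℝ, ContDiff ℝ (⊤ : ℕ∞) φ → HasCompactSupport φ →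
    ∫ x, (1 + (k - 1) * Set.indicator Ω (fun _ => (1 : ℝ)) x) *
      ⟪gradient u x, gradient φ x⟫ = 0) ∧
  ∃ C R : ℝ, 0 < C ∧ 0 < R ∧ ∀ x : Euc d, R ≤ ‖x‖ → |u x - ⟪a, x⟫| ≤ C * ‖x‖ ^ (1 - (d : ℤ))

/-- `u` is linear in `Ω`. -/
def IsLinIn (d : ℕ) (Ω : Set (Euc d)) (u : Euc d → ℝ) : Prop :=
  ∃ (b : Euc d) (c : ℝ), ∀ x ∈ Ω, u x = ⟪b, x⟫ + c

/-- `M` is a polarization tensor of `Ω` with contrast `k`:  for every background field `a`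
there is a solution `u_a` with `u_a(x) = ⟨a,x⟩ + (1/ω_d)⟨a, Mx⟩/|x|^d + O(|x|^{-d})`. -/
def IsPolTensor (d : ℕ) (Ω : Set (Euc d)) (k : ℝ) (M : Matrix (Fin d) (Fin d) ℝ) : Prop :=
  ∀ a : Euc d, ∃ u, IsCondSol d Ω k a u ∧
    ∃ C R : ℝ, 0 < C ∧ 0 < R ∧ ∀ x : Euc d, R ≤ ‖x‖ →
      |u x - (⟪a, x⟫ + (1 / (if d = 2 then 2 * Real.pi else 4 * Real.pi)) *
        (∑ i, a i * ∑ j, M i j * x j) / ‖x‖ ^ d)| ≤ C * ‖x‖ ^ (-(d : ℤ))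

/-- `Ω` is an ellipse (d = 2) or an ellipsoid (d = 3): the image of the open unit ball
under an invertible affine map. -/
def IsEllipsoid (d : ℕ) (Ω : Set (Euc d)) : Prop :=
  ∃ (T : Euc d ≃ₗ[ℝ] Euc d) (x₀ : Euc d), Ω = (fun x => x₀ + T x) '' Metric.ball 0 1

section

local notation "E3" => EuclideanSpace ℝ (Fin 3)

open Metric Filter Topology

/-! ### Radial kernels -/

/-- A smooth radial bump supported in the unit ball. -/
def radialBump (z : E3) : ℝ := expNegInvGlue (1 - ‖z‖ ^ 2)

/-- The radial weight with `∇ radialBump z = -radialWeight z • z`. -/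
def radialWeight (z : E3) : ℝ :=
  2 * ((1 - ‖z‖ ^ 2)⁻¹ ^ 2 * expNegInvGlue (1 - ‖z‖ ^ 2))

theorem hasDerivAt_expNegInvGlue (t : ℝ) :
    HasDerivAt expNegInvGlue (t⁻¹ ^ 2 * expNegInvGlue t) t := by
  simpa using expNegInvGlue.hasDerivAt_polynomial_eval_inv_mul 1 t

theorem contDiff_radialBump : ContDiff ℝ (⊤ : ℕ∞) radialBump :=
  expNegInvGlue.contDiff.comp (contDiff_const.sub (contDiff_norm_sq ℝ))

theorem radialBump_nonneg (z : E3) : 0 ≤ radialBump z := expNegInvGlue.nonneg _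

theorem radialBump_eq_zero {z : E3} (hz : 1 ≤ ‖z‖) : radialBump z = 0 :=
  expNegInvGlue.zero_of_nonpos (by nlinarith)

theorem le_radialBump {z : E3} (hz : ‖z‖ ≤ 1 / 2) : expNegInvGlue (3 / 4) ≤ radialBump z :=
  expNegInvGlue.monotone (by nlinarith [norm_nonneg z])

theorem continuous_radialWeight : Continuous radialWeight := by
  have h := expNegInvGlue.continuous_polynomial_eval_inv_mul (Polynomial.X ^ 2)
  have h2 : Continuous fun z : E3 => 1 - ‖z‖ ^ 2 := by fun_prop
  have h3 := (h.comp h2).const_mul 2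
  simp only [Polynomial.eval_pow, Polynomial.eval_X] at h3
  exact h3

theorem radialWeight_nonneg (z : E3) : 0 ≤ radialWeight z := by
  have := expNegInvGlue.nonneg (1 - ‖z‖ ^ 2)
  unfold radialWeight
  positivity

theorem radialWeight_pos {z : E3} (hz : ‖z‖ < 1) : 0 < radialWeight z := by
  have h : 0 < 1 - ‖z‖ ^ 2 := by nlinarith [norm_nonneg z]
  have := expNegInvGlue.pos_of_pos h
  unfold radialWeight
  positivity

theorem radialWeight_eq_zero {z : E3} (hz : 1 ≤ ‖z‖) : radialWeight z = 0 := by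
  simp [radialWeight, expNegInvGlue.zero_of_nonpos (show 1 - ‖z‖ ^ 2 ≤ 0 by nlinarith)]

theorem radialWeight_neg (z : E3) : radialWeight (-z) = radialWeight z := by
  simp [radialWeight]

theorem hasGradientAt_radialBump (z : E3) :
    HasGradientAt radialBump (-(radialWeight z • z)) z := by
  rw [hasGradientAt_iff_hasFDerivAt]
  have h1 : HasFDerivAt (fun z : E3 => 1 - ‖z‖ ^ 2) (-(2 • innerSL ℝ z)) z :=
    (hasStrictFDerivAt_norm_sq z).hasFDerivAt.const_sub 1
  refine HasFDerivAt.congr_fderiv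
    ((hasDerivAt_expNegInvGlue (1 - ‖z‖ ^ 2)).comp_hasFDerivAt z h1) ?_
  ext1 v
  simp [radialWeight]
  ring

theorem exists_radialWeight_le : ∃ B, 0 < B ∧ ∀ z, radialWeight z ≤ B := by
  obtain ⟨B, hB⟩ := (isCompact_closedBall (0 : E3) 1).exists_bound_of_continuousOn
    continuous_radialWeight.continuousOn
  refine ⟨max B 1, by positivity, fun z => ?_⟩
  by_cases hz : ‖z‖ ≤ 1
  · exact ((le_abs_self _).trans (hB z (by simpa using hz))).trans (le_max_left _ _)
  · rw [radialWeight_eq_zero (not_le.1 hz).le]; positivity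

/-- The bump rescaled to the ball of radius `r` about `x`. -/
def scaledBump (x : E3) (r : ℝ) (y : E3) : ℝ := radialBump (r⁻¹ • (y - x))

theorem contDiff_scaledBump (x : E3) (r : ℝ) : ContDiff ℝ (⊤ : ℕ∞) (scaledBump x r) :=
  contDiff_radialBump.comp ((contDiff_id.sub contDiff_const).const_smul r⁻¹)

theorem scaledBump_nonneg (x : E3) (r : ℝ) (y : E3) : 0 ≤ scaledBump x r y :=
  radialBump_nonneg _

theorem one_le_norm_inv_smul {x y : E3} {r : ℝ} (hr : 0 < r) (hy : y ∉ closedBall x r) :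
    1 ≤ ‖r⁻¹ • (y - x)‖ := by
  rw [mem_closedBall, not_le, dist_eq_norm] at hy
  rw [norm_smul, norm_inv, Real.norm_of_nonneg hr.le, ← div_eq_inv_mul, one_le_div hr]
  exact hy.le

theorem scaledBump_eq_zero {x y : E3} {r : ℝ} (hr : 0 < r) (hy : y ∉ closedBall x r) :
    scaledBump x r y = 0 :=
  radialBump_eq_zero (one_le_norm_inv_smul hr hy)

theorem hasCompactSupport_scaledBump (x : E3) {r : ℝ} (hr : 0 < r) :
    HasCompactSupport (scaledBump x r) :=
  HasCompactSupport.intro (isCompact_closedBall x r) fun _ hy => scaledBump_eq_zero hr hy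

theorem gradient_scaledBump (x : E3) (r : ℝ) (y : E3) :
    gradient (scaledBump x r) y =
      -((r⁻¹ * radialWeight (r⁻¹ • (y - x))) • (r⁻¹ • (y - x))) := by
  apply HasGradientAt.gradient
  rw [hasGradientAt_iff_hasFDerivAt]
  have h1 : HasFDerivAt (fun y : E3 => r⁻¹ • (y - x)) (r⁻¹ • ContinuousLinearMap.id ℝ E3) y :=
    ((hasFDerivAt_id y).sub_const x).const_smul r⁻¹
  refine HasFDerivAt.congr_fderiv
    ((hasGradientAt_radialBump (r⁻¹ • (y - x))).hasFDerivAt.comp y h1) ?_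
  ext1 v
  simp
  ring

theorem norm_gradient_scaledBump_le {B : ℝ} (hB : ∀ z, radialWeight z ≤ B) (x : E3) {r : ℝ}
    (hr : 0 < r) (y : E3) : ‖gradient (scaledBump x r) y‖ ≤ r⁻¹ * B := by
  rw [gradient_scaledBump, norm_neg, norm_smul, norm_mul, norm_inv, Real.norm_of_nonneg hr.le,
    Real.norm_of_nonneg (radialWeight_nonneg _), mul_assoc]
  gcongr
  set z := r⁻¹ • (y - x)
  rcases le_total 1 ‖z‖ with h | h
  · rw [radialWeight_eq_zero h, zero_mul]
    exact (radialWeight_nonneg 0).trans (hB 0)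
  · exact (mul_le_of_le_one_right (radialWeight_nonneg _) h).trans (hB z)

theorem gradient_scaledBump_eq_zero {x y : E3} {r : ℝ} (hr : 0 < r) (hy : y ∉ closedBall x r) :
    gradient (scaledBump x r) y = 0 := by
  rw [gradient_scaledBump, radialWeight_eq_zero (one_le_norm_inv_smul hr hy)]
  simp

/-! ### Radial means -/

/-- The (unnormalised) radial mean of `g` at scale `r` about `x`. -/
def radialMean (g : E3 → ℝ) (x : E3) (r : ℝ) : ℝ :=
  ∫ z in closedBall (0 : E3) 1, radialWeight z * g (x + r • z)

/-- The total mass of the radial weight. -/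
def radialMass : ℝ := ∫ z in closedBall (0 : E3) 1, radialWeight z

theorem radialMass_pos : 0 < radialMass := by
  have hi : IntegrableOn radialWeight (closedBall (0 : E3) 1) :=
    continuous_radialWeight.continuousOn.integrableOn_compact (isCompact_closedBall _ _)
  refine (setIntegral_pos_iff_support_of_nonneg_ae
    (Eventually.of_forall fun z => radialWeight_nonneg z) hi).2 ?_
  refine (measure_ball_pos volume (0 : E3) one_pos).trans_le (measure_mono fun z hz => ?_)
  exact ⟨(radialWeight_pos (by simpa using hz)).ne', ball_subset_closedBall hz⟩

theorem radialMean_zero (g : E3 → ℝ) (x : E3) : radialMean g x 0 = radialMass * g x := by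
  simp [radialMean, radialMass, integral_mul_const]

theorem continuous_radialMean {g : E3 → ℝ} (hg : Continuous g) (x : E3) :
    Continuous (radialMean g x) := by
  refine continuous_parametric_integral_of_continuous
    (f := fun r z => radialWeight z * g (x + r • z)) ?_ (isCompact_closedBall (0 : E3) 1)
  have := continuous_radialWeight
  simp only [Function.uncurry_def]
  fun_prop

theorem continuous_gradient {g : E3 → ℝ} (hg : ContDiff ℝ (⊤ : ℕ∞) g) :
    Continuous (gradient g) :=
  (InnerProductSpace.toDual ℝ E3).symm.continuous.comp (hg.continuous_fderiv (by simp))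

theorem hasDerivAt_radialMean_aux {g : E3 → ℝ} (hg : ContDiff ℝ (⊤ : ℕ∞) g) (x : E3) (r : ℝ) :
    HasDerivAt (radialMean g x)
      (∫ z in closedBall (0 : E3) 1, radialWeight z * ⟪gradient g (x + r • z), z⟫) r := by
  obtain ⟨B, hB0, hB⟩ := exists_radialWeight_le
  obtain ⟨M, hM⟩ := (isCompact_closedBall x (|r| + 1)).exists_bound_of_continuousOn
    (continuous_gradient hg).continuousOn
  have hgc := hg.continuous
  have hw := continuous_radialWeight
  have hgg := continuous_gradient hg
  refine (hasDerivAt_integral_of_dominated_loc_of_deriv_le (μ := volume.restrict (closedBall 0 1))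
    (F := fun r z => radialWeight z * g (x + r • z))
    (F' := fun r z => radialWeight z * ⟪gradient g (x + r • z), z⟫)
    (bound := fun _ => B * M) (s := ball r 1) (ball_mem_nhds r one_pos) ?_ ?_ ?_ ?_ ?_ ?_).2
  · exact Eventually.of_forall fun r => (by fun_prop : Continuous _).aestronglyMeasurable
  · exact (by fun_prop : Continuous fun z =>
      radialWeight z * g (x + r • z)).continuousOn.integrableOn_compact (isCompact_closedBall _ _)
  · exact (by fun_prop : Continuous _).aestronglyMeasurable
  · refine (ae_restrict_iff' measurableSet_closedBall).2 (Eventually.of_forall fun z hz s hs => ?_)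
    have hz1 : ‖z‖ ≤ 1 := by simpa using hz
    have hs1 : |s| ≤ |r| + 1 := by
      have h1 : |s - r| < 1 := by simpa [Real.dist_eq] using hs
      have h2 := abs_add_le (s - r) r
      rw [sub_add_cancel] at h2
      linarith
    have hm : x + s • z ∈ closedBall x (|r| + 1) := by
      simp only [mem_closedBall, dist_eq_norm, add_sub_cancel_left, norm_smul, Real.norm_eq_abs]
      nlinarith [abs_nonneg s, norm_nonneg z]
    rw [norm_mul, Real.norm_of_nonneg (radialWeight_nonneg z)]
    have h3 : ‖⟪gradient g (x + s • z), z⟫‖ ≤ M :=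
      (norm_inner_le_norm _ _).trans ((mul_le_of_le_one_right (norm_nonneg _) hz1).trans (hM _ hm))
    gcongr
    exact hB z
  · exact continuous_const.continuousOn.integrableOn_compact (isCompact_closedBall _ _)
  · refine Eventually.of_forall fun z s _ => HasDerivAt.const_mul _ ?_
    have h1 : HasDerivAt (fun s : ℝ => x + s • z) z s := by
      simpa using ((hasDerivAt_id s).smul_const z).const_add x
    have h2 := ((hg.differentiable (by simp) (x + s • z)).hasGradientAt).hasFDerivAt
    have h3 := h2.comp_hasDerivAt s h1
    rw [InnerProductSpace.toDual_apply_apply] at h3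
    exact h3

theorem hasDerivAt_radialMean {g : E3 → ℝ} (hg : ContDiff ℝ (⊤ : ℕ∞) g) (x : E3) {r : ℝ}
    (hr : 0 < r) :
    HasDerivAt (radialMean g x)
      (-((r ^ 2)⁻¹ * ∫ y, ⟪gradient g y, gradient (scaledBump x r) y⟫)) r := by
  convert hasDerivAt_radialMean_aux hg x r using 1
  set F : E3 → ℝ := fun y => ⟪gradient g y, gradient (scaledBump x r) y⟫ with hF
  rw [setIntegral_eq_integral_of_forall_compl_eq_zero]
  swap
  · intro z hz
    rw [radialWeight_eq_zero (by simpa using (not_le.1 (by simpa using hz)).le), zero_mul]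
  have h1 : ∀ z, radialWeight z * ⟪gradient g (x + r • z), z⟫ = -(r * F (x + r • z)) := by
    intro z
    simp only [hF, gradient_scaledBump, add_sub_cancel_left, smul_smul, inv_mul_cancel₀ hr.ne',
      one_smul, inner_neg_right, inner_smul_right]
    field_simp
  simp_rw [h1]
  have h2 := Measure.integral_comp_smul_of_nonneg (μ := (volume : Measure E3))
    (fun w => F (x + w)) r (hR := hr.le)
  rw [integral_neg, integral_const_mul, h2, integral_add_left_eq_self]
  simp only [finrank_euclideanSpace, Fintype.card_fin, smul_eq_mul]
  field_simp

/-! ### Smooth truncations of the identity and of the sign -/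

/-- The primitive of `f` vanishing at the origin. -/
def prim (f : ℝ → ℝ) (t : ℝ) : ℝ := ∫ s in (0 : ℝ)..t, f s

/-- A smooth cutoff that vanishes on `[-ε, ε]` and equals `1` outside `(-2ε, 2ε)`. -/
def cut (ε t : ℝ) : ℝ := Real.smoothTransition (t / ε - 1) + Real.smoothTransition (-t / ε - 1)

/-- A smooth nondecreasing version of the sign that vanishes on `[-ε, ε]`. -/
def smoothSign (ε t : ℝ) : ℝ :=
  Real.smoothTransition (t / ε - 1) - Real.smoothTransition (-t / ε - 1)

theorem hasDerivAt_prim {f : ℝ → ℝ} (hf : Continuous f) (t : ℝ) : HasDerivAt (prim f) (f t) t :=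
  intervalIntegral.integral_hasDerivAt_right (hf.intervalIntegrable _ _)
    (hf.stronglyMeasurableAtFilter _ _) hf.continuousAt

theorem deriv_prim {f : ℝ → ℝ} (hf : Continuous f) : deriv (prim f) = f :=
  funext fun t => (hasDerivAt_prim hf t).deriv

theorem contDiff_prim {f : ℝ → ℝ} (hf : ContDiff ℝ (⊤ : ℕ∞) f) : ContDiff ℝ (⊤ : ℕ∞) (prim f) := by
  rw [contDiff_infty_iff_deriv, deriv_prim hf.continuous]
  exact ⟨fun t => (hasDerivAt_prim hf.continuous t).differentiableAt, hf⟩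

theorem prim_eq_zero {f : ℝ → ℝ} {ε : ℝ} (hf : ∀ t, |t| ≤ ε → f t = 0) {t : ℝ} (ht : |t| ≤ ε) :
    prim f t = 0 := by
  have h : prim f t = ∫ _s in (0 : ℝ)..t, (0 : ℝ) := by
    refine intervalIntegral.integral_congr fun s hs => hf s (le_trans ?_ ht)
    have := Set.abs_sub_left_of_mem_uIcc hs
    simpa using this
  simpa using h

theorem abs_prim_le {f : ℝ → ℝ} {M t : ℝ} (hf : ∀ s, |s| ≤ |t| → |f s| ≤ M) :
    |prim f t| ≤ M * |t| := by
  have h := intervalIntegral.norm_integral_le_of_norm_le_const (a := 0) (b := t) (f := f) (C := M)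
    fun s hs => hf s (by simpa using Set.abs_sub_left_of_mem_uIcc (Set.uIoc_subset_uIcc hs))
  simpa [prim] using h

theorem abs_prim_le_of_eq_zero {f : ℝ → ℝ} (hc : Continuous f) {a : ℝ} (ha : 0 ≤ a)
    (hf : ∀ s, |f s| ≤ 1) (h0 : ∀ s, a ≤ |s| → f s = 0) (t : ℝ) : |prim f t| ≤ a := by
  have key : ∀ s, |s| ≤ a → |prim f s| ≤ a := fun s hs =>
    (abs_prim_le fun r _ => hf r).trans (by simpa using hs)
  have split : ∀ s, prim f t = prim f s + ∫ r in s..t, f r := fun s =>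
    (intervalIntegral.integral_add_adjacent_intervals (hc.intervalIntegrable _ _)
      (hc.intervalIntegrable _ _)).symm
  rcases le_total |t| a with h | h
  · exact key t h
  rcases le_abs'.1 h with h | h
  · have h2 : ∫ r in (-a)..t, f r = ∫ _r in (-a)..t, (0 : ℝ) :=
      intervalIntegral.integral_congr fun r hr => by
        rw [Set.uIcc_of_ge h] at hr
        exact h0 r (le_abs'.2 (Or.inl hr.2))
    rw [split (-a), h2]
    simpa using key (-a) (by simp [abs_of_nonneg ha])
  · have h2 : ∫ r in a..t, f r = ∫ _r in a..t, (0 : ℝ) :=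
      intervalIntegral.integral_congr fun r hr => by
        rw [Set.uIcc_of_le h] at hr
        exact h0 r (le_abs'.2 (Or.inr hr.1))
    rw [split a, h2]
    simpa using key a (by simp [abs_of_nonneg ha])

theorem contDiff_cut (ε : ℝ) : ContDiff ℝ (⊤ : ℕ∞) (cut ε) :=
  (Real.smoothTransition.contDiff.comp (by fun_prop)).add
    (Real.smoothTransition.contDiff.comp (by fun_prop))

theorem contDiff_smoothSign (ε : ℝ) : ContDiff ℝ (⊤ : ℕ∞) (smoothSign ε) :=
  (Real.smoothTransition.contDiff.comp (by fun_prop)).sub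
    (Real.smoothTransition.contDiff.comp (by fun_prop))

theorem smoothTransition_div_eq_zero {ε t : ℝ} (hε : 0 < ε) (ht : t ≤ ε) :
    Real.smoothTransition (t / ε - 1) = 0 :=
  Real.smoothTransition.zero_of_nonpos (by rw [sub_nonpos, div_le_one hε]; exact ht)

theorem cut_eq_smoothTransition {ε t : ℝ} (hε : 0 < ε) (ht : 0 ≤ t) :
    cut ε t = Real.smoothTransition (t / ε - 1) := by
  rw [cut, smoothTransition_div_eq_zero hε (by linarith : -t ≤ ε), add_zero]

theorem cut_neg (ε t : ℝ) : cut ε (-t) = cut ε t := by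
  simp [cut, add_comm]

theorem smoothSign_neg (ε t : ℝ) : smoothSign ε (-t) = -smoothSign ε t := by
  simp [smoothSign]

theorem cut_abs (ε t : ℝ) : cut ε |t| = cut ε t := by
  rcases abs_choice t with h | h <;> rw [h]
  exact cut_neg ε t

theorem smoothSign_eq_cut {ε t : ℝ} (hε : 0 < ε) (ht : 0 ≤ t) : smoothSign ε t = cut ε t := by
  rw [smoothSign, cut, smoothTransition_div_eq_zero hε (by linarith : -t ≤ ε), add_zero, sub_zero]

theorem cut_nonneg (ε t : ℝ) : 0 ≤ cut ε t :=
  add_nonneg (Real.smoothTransition.nonneg _) (Real.smoothTransition.nonneg _)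

theorem cut_le_one {ε : ℝ} (hε : 0 < ε) (t : ℝ) : cut ε t ≤ 1 := by
  rw [← cut_abs, cut_eq_smoothTransition hε (abs_nonneg t)]
  exact Real.smoothTransition.le_one _

theorem cut_eq_zero {ε t : ℝ} (hε : 0 < ε) (ht : |t| ≤ ε) : cut ε t = 0 := by
  rw [← cut_abs, cut_eq_smoothTransition hε (abs_nonneg t), smoothTransition_div_eq_zero hε ht]

theorem cut_eq_one {ε t : ℝ} (hε : 0 < ε) (ht : 2 * ε ≤ |t|) : cut ε t = 1 := by
  rw [← cut_abs, cut_eq_smoothTransition hε (abs_nonneg t)]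
  refine Real.smoothTransition.one_of_one_le ?_
  rw [le_sub_iff_add_le, le_div_iff₀ hε]
  linarith

theorem smoothSign_eq_zero {ε t : ℝ} (hε : 0 < ε) (ht : |t| ≤ ε) : smoothSign ε t = 0 := by
  rw [smoothSign, smoothTransition_div_eq_zero hε (abs_le.1 ht).2,
    smoothTransition_div_eq_zero hε (by linarith [(abs_le.1 ht).1]), sub_zero]

theorem abs_smoothSign_le_one (ε t : ℝ) : |smoothSign ε t| ≤ 1 := by
  have h1 := Real.smoothTransition.nonneg (t / ε - 1)
  have h2 := Real.smoothTransition.nonneg (-t / ε - 1)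
  have h3 := Real.smoothTransition.le_one (t / ε - 1)
  have h4 := Real.smoothTransition.le_one (-t / ε - 1)
  rw [smoothSign, abs_le]
  constructor <;> linarith

theorem deriv_smoothSign_nonneg {ε : ℝ} (hε : 0 < ε) (t : ℝ) : 0 ≤ deriv (smoothSign ε) t := by
  refine Monotone.deriv_nonneg fun s t hst => ?_
  refine sub_le_sub (Real.smoothTransition.monotone ?_) (Real.smoothTransition.monotone ?_) <;>
    gcongr

theorem abs_prim_cut_sub_le {ε : ℝ} (hε : 0 < ε) (t : ℝ) : |prim (cut ε) t - t| ≤ 2 * ε := by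
  have hc := (contDiff_cut ε).continuous
  have h : prim (cut ε) t - t = prim (fun s => cut ε s - 1) t := by
    simp only [prim]
    rw [intervalIntegral.integral_sub (hc.intervalIntegrable _ _) (by simp)]
    simp
  rw [h]
  refine abs_prim_le_of_eq_zero (by fun_prop) (by positivity) (fun s => ?_) (fun s hs => ?_) t
  · rw [abs_le]
    constructor <;> linarith [cut_nonneg ε s, cut_le_one hε s]
  · rw [cut_eq_one hε hs, sub_self]

theorem abs_prim_cut_le {ε : ℝ} (hε : 0 < ε) (t : ℝ) : |prim (cut ε) t| ≤ |t| := by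
  simpa using abs_prim_le (f := cut ε) (t := t) (M := 1) fun s _ => by
    rw [abs_of_nonneg (cut_nonneg ε s)]; exact cut_le_one hε s

theorem prim_smoothSign_abs (ε t : ℝ) : prim (smoothSign ε) |t| = prim (smoothSign ε) t := by
  rcases abs_choice t with h | h <;> rw [h]
  have h2 := intervalIntegral.integral_comp_neg (smoothSign ε) (a := 0) (b := t)
  simp only [smoothSign_neg, intervalIntegral.integral_neg, neg_zero] at h2
  rw [prim, prim, intervalIntegral.integral_symm, ← h2, neg_neg]

theorem prim_smoothSign {ε : ℝ} (hε : 0 < ε) (t : ℝ) :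
    prim (smoothSign ε) t = prim (cut ε) |t| := by
  rw [← prim_smoothSign_abs]
  refine intervalIntegral.integral_congr fun s hs => smoothSign_eq_cut hε ?_
  rw [Set.uIcc_of_le (abs_nonneg t)] at hs
  exact hs.1

theorem prim_smoothSign_nonneg {ε : ℝ} (hε : 0 < ε) (t : ℝ) : 0 ≤ prim (smoothSign ε) t := by
  rw [prim_smoothSign hε]
  exact intervalIntegral.integral_nonneg (abs_nonneg t) fun s _ => cut_nonneg ε s

theorem abs_le_prim_smoothSign_add {ε : ℝ} (hε : 0 < ε) (t : ℝ) :
    |t| ≤ prim (smoothSign ε) t + 2 * ε := by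
  rw [prim_smoothSign hε]
  linarith [(abs_le.1 (abs_prim_cut_sub_le hε |t|)).1]

/-! ### Functions that are harmonic where they do not vanish -/

/-- `p` is continuous, and smooth and weakly harmonic on the open set where it is nonzero. -/
structure HarmonicOffZeros (p : E3 → ℝ) : Prop where
  continuous : Continuous p
  contDiffAt : ∀ x, p x ≠ 0 → ContDiffAt ℝ (⊤ : ℕ∞) p x
  integral_inner_eq_zero : ∀ φ : E3 → ℝ, ContDiff ℝ (⊤ : ℕ∞) φ → HasCompactSupport φ →
    tsupport φ ⊆ {x | p x ≠ 0} → ∫ x, ⟪gradient p x, gradient φ x⟫ = 0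

namespace HarmonicOffZeros

variable {p : E3 → ℝ}

theorem eventually_abs_le (hp : HarmonicOffZeros p) {ε : ℝ} (hε : 0 < ε) {x : E3}
    (hx : p x = 0) : ∀ᶠ y in 𝓝 x, |p y| ≤ ε := by
  have h : ∀ᶠ y in 𝓝 x, |p y| < ε :=
    (hp.continuous.abs.tendsto x).eventually_lt_const (by simpa [hx] using hε)
  exact h.mono fun _ => le_of_lt

theorem continuousAt_gradient (hp : HarmonicOffZeros p) {x : E3} (hx : p x ≠ 0) :
    ContinuousAt (gradient p) x :=
  (InnerProductSpace.toDual ℝ E3).symm.continuous.continuousAt.comp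
    ((hp.contDiffAt x hx).continuousAt_fderiv (by simp))

theorem continuous_comp_mul (hp : HarmonicOffZeros p) {S : ℝ → ℝ} (hS : Continuous S) {ε : ℝ}
    (hε : 0 < ε) (h0 : ∀ t, |t| ≤ ε → S t = 0) {F : E3 → ℝ}
    (hF : ∀ x, p x ≠ 0 → ContinuousAt F x) : Continuous fun x => S (p x) * F x := by
  refine continuous_iff_continuousAt.2 fun x => ?_
  by_cases hx : p x = 0
  · refine (continuousAt_const (y := (0 : ℝ))).congr ?_
    filter_upwards [hp.eventually_abs_le hε hx] with y hy
    simp [h0 _ hy]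
  · exact (hS.comp hp.continuous).continuousAt.mul (hF x hx)

theorem contDiff_comp (hp : HarmonicOffZeros p) {J : ℝ → ℝ} (hJ : ContDiff ℝ (⊤ : ℕ∞) J) {ε : ℝ}
    (hε : 0 < ε) (h0 : ∀ t, |t| ≤ ε → J t = 0) : ContDiff ℝ (⊤ : ℕ∞) fun x => J (p x) := by
  refine contDiff_iff_contDiffAt.2 fun x => ?_
  by_cases hx : p x = 0
  · refine (contDiffAt_const (c := (0 : ℝ))).congr_of_eventuallyEq ?_
    filter_upwards [hp.eventually_abs_le hε hx] with y hy
    exact h0 _ hy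
  · exact hJ.contDiffAt.comp x (hp.contDiffAt x hx)

theorem gradient_comp (hp : HarmonicOffZeros p) {J : ℝ → ℝ} (hJ : ContDiff ℝ (⊤ : ℕ∞) J) {ε : ℝ}
    (hε : 0 < ε) (h0 : ∀ t, |t| ≤ ε → J t = 0) (x : E3) :
    gradient (fun x => J (p x)) x = deriv J (p x) • gradient p x := by
  by_cases hx : p x = 0
  · have h1 : (fun x => J (p x)) =ᶠ[𝓝 x] fun _ => 0 := by
      filter_upwards [hp.eventually_abs_le hε hx] with y hy
      exact h0 _ hy
    have h2 : J =ᶠ[𝓝 0] fun _ => 0 := by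
      have h : ∀ᶠ t : ℝ in 𝓝 0, |t| < ε :=
        (continuous_abs.tendsto (0 : ℝ)).eventually_lt_const (by simpa using hε)
      filter_upwards [h] with t ht
      exact h0 t ht.le
    rw [h1.gradient_eq, hx, h2.deriv_eq]
    simp
  · have hd : DifferentiableAt ℝ p x := (hp.contDiffAt x hx).differentiableAt (by simp)
    have h1 : HasDerivAt J (deriv J (p x)) (p x) :=
      (hJ.differentiable (by simp) (p x)).hasDerivAt
    have h2 := h1.comp_hasFDerivAt x hd.hasGradientAt.hasFDerivAt
    apply HasGradientAt.gradient
    rw [hasGradientAt_iff_hasFDerivAt]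
    refine HasFDerivAt.congr_fderiv h2 ?_
    simp

/-- Testing weak harmonicity of `p` against `T (p) η`. -/
theorem energy_identity (hp : HarmonicOffZeros p) {T : ℝ → ℝ} (hT : ContDiff ℝ (⊤ : ℕ∞) T) {ε : ℝ}
    (hε : 0 < ε) (h0 : ∀ t, |t| ≤ ε → T t = 0) {η : E3 → ℝ} (hη : ContDiff ℝ (⊤ : ℕ∞) η)
    (hηc : HasCompactSupport η) :
    -∫ x, ⟪gradient (fun x => prim T (p x)) x, gradient η x⟫ =
      ∫ x, deriv T (p x) * (‖gradient p x‖ ^ 2 * η x) := by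
  have hTp := hp.contDiff_comp hT hε h0
  have hd0 : ∀ t, |t| ≤ ε / 2 → deriv T t = 0 := fun t ht => by
    have h2 : T =ᶠ[𝓝 t] fun _ => 0 := by
      have h : ∀ᶠ s : ℝ in 𝓝 t, |s| < ε :=
        (continuous_abs.tendsto t).eventually_lt_const (by linarith)
      filter_upwards [h] with s hs
      exact h0 s hs.le
    rw [h2.deriv_eq]
    simp
  have hw := hp.integral_inner_eq_zero (fun x => T (p x) * η x) (hTp.mul hη) hηc.mul_left
    (by
      have hcl : IsClosed {x | ε ≤ |p x|} := isClosed_le continuous_const hp.continuous.abs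
      refine Set.Subset.trans (b := {x | ε ≤ |p x|}) (closure_minimal (fun x hx => ?_) hcl)
        fun x hx h => ?_
      · by_contra h
        exact hx (by simp [h0 _ (not_le.1 h).le])
      · have hx' : ε ≤ |p x| := hx
        rw [h, abs_zero] at hx'
        linarith)
  have hg : ∀ x, ⟪gradient p x, gradient (fun x => T (p x) * η x) x⟫ =
      deriv T (p x) * (‖gradient p x‖ ^ 2 * η x) +
        ⟪gradient (fun x => prim T (p x)) x, gradient η x⟫ := fun x => by
    rw [hp.gradient_comp (contDiff_prim hT) hε (fun t ht => prim_eq_zero h0 ht),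
      deriv_prim hT.continuous]
    have h1 := (hTp.differentiable (by simp) x).hasGradientAt.hasFDerivAt
    have h2 := (hη.differentiable (by simp) x).hasGradientAt.hasFDerivAt
    have h3 : HasFDerivAt (fun x => T (p x) * η x) _ x := h1.mul h2
    rw [inner_gradient_right, h3.fderiv, hp.gradient_comp hT hε h0]
    have h4 : fderiv ℝ p x (gradient p x) = ‖gradient p x‖ ^ 2 := by
      rw [← inner_gradient_left, real_inner_self_eq_norm_sq]
    simp [h4]
    ring
  have hi1 : Integrable fun x => deriv T (p x) * (‖gradient p x‖ ^ 2 * η x) := by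
    refine Continuous.integrable_of_hasCompactSupport ?_ ?_
    · refine hp.continuous_comp_mul (hT.continuous_deriv (by simp)) (half_pos hε) hd0 fun x hx => ?_
      exact ((hp.continuousAt_gradient hx).norm.pow 2).mul hη.continuous.continuousAt
    · exact hηc.mul_left.mul_left
  have hi2 : Integrable fun x => ⟪gradient (fun x => prim T (p x)) x, gradient η x⟫ := by
    refine Continuous.integrable_of_hasCompactSupport ?_ ?_
    · exact (continuous_gradient (hp.contDiff_comp (contDiff_prim hT) hε
        fun t ht => prim_eq_zero h0 ht)).inner (continuous_gradient hη)
    · refine hηc.mono' fun x hx => ?_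
      by_contra h
      apply hx
      have h1 : η =ᶠ[𝓝 x] fun _ => 0 := notMem_tsupport_iff_eventuallyEq.1 h
      simp [h1.gradient_eq]
  simp_rw [hg] at hw
  rw [integral_add hi1 hi2] at hw
  linarith

theorem hasDerivAt_radialMean_prim (hp : HarmonicOffZeros p) {T : ℝ → ℝ}
    (hT : ContDiff ℝ (⊤ : ℕ∞) T) {ε : ℝ} (hε : 0 < ε) (h0 : ∀ t, |t| ≤ ε → T t = 0) (x : E3) {r : ℝ}
    (hr : 0 < r) :
    HasDerivAt (radialMean (fun y => prim T (p y)) x)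
      ((r ^ 2)⁻¹ * ∫ y, deriv T (p y) * (‖gradient p y‖ ^ 2 * scaledBump x r y)) r := by
  rw [← hp.energy_identity hT hε h0 (contDiff_scaledBump x r) (hasCompactSupport_scaledBump x hr),
    mul_neg]
  exact hasDerivAt_radialMean
    (hp.contDiff_comp (contDiff_prim hT) hε fun t ht => prim_eq_zero h0 ht) x hr

end HarmonicOffZeros

theorem setIntegral_radialWeight_mul (F : E3 → ℝ) :
    ∫ z in closedBall (0 : E3) 1, radialWeight z * F z = ∫ z, radialWeight z * F z := by
  refine setIntegral_eq_integral_of_forall_compl_eq_zero fun z hz => ?_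
  rw [radialWeight_eq_zero (by simpa using (not_le.1 (by simpa using hz)).le), zero_mul]

theorem integrable_radialWeight_mul {F : E3 → ℝ} (hF : Continuous F) :
    Integrable fun z => radialWeight z * F z := by
  refine (continuous_radialWeight.mul hF).integrable_of_hasCompactSupport ?_
  refine HasCompactSupport.intro (isCompact_closedBall (0 : E3) 1) fun z hz => ?_
  rw [Pi.mul_apply,
    radialWeight_eq_zero (by simpa using (not_le.1 (by simpa using hz)).le), zero_mul]

theorem abs_radialMean_le {g : E3 → ℝ} {x : E3} {r N : ℝ} (hr : 0 ≤ r)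
    (hN : ∀ y ∈ closedBall x r, |g y| ≤ N) : |radialMean g x r| ≤ radialMass * N := by
  rw [radialMass, ← integral_mul_const, ← Real.norm_eq_abs, radialMean]
  refine norm_integral_le_of_norm_le ?_ ?_
  · exact (continuous_radialWeight.mul continuous_const).continuousOn.integrableOn_compact
      (isCompact_closedBall _ _)
  · refine (ae_restrict_iff' measurableSet_closedBall).2 (Eventually.of_forall fun z hz => ?_)
    rw [norm_mul, Real.norm_of_nonneg (radialWeight_nonneg z)]
    refine mul_le_mul_of_nonneg_left (hN _ ?_) (radialWeight_nonneg z)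
    have hz1 : ‖z‖ ≤ 1 := by simpa using hz
    simp only [mem_closedBall, dist_eq_norm, add_sub_cancel_left, norm_smul, Real.norm_eq_abs,
      abs_of_nonneg hr]
    exact mul_le_of_le_one_right hr hz1

theorem exists_radialWeight_add_le :
    ∃ C, 0 < C ∧ ∀ e z : E3, ‖e‖ ≤ 1 → radialWeight (e + (4 : ℝ) • z) ≤ C * radialWeight z := by
  obtain ⟨B, hB0, hB⟩ := exists_radialWeight_le
  obtain ⟨z₀, hz₀, hmin⟩ := (isCompact_closedBall (0 : E3) (1 / 2)).exists_isMinOn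
    ⟨0, by simp⟩ continuous_radialWeight.continuousOn
  have hw : 0 < radialWeight z₀ :=
    radialWeight_pos ((by simpa using hz₀ : ‖z₀‖ ≤ 2⁻¹).trans_lt (by norm_num))
  refine ⟨B / radialWeight z₀, by positivity, fun e z he => ?_⟩
  rcases le_total ‖z‖ (1 / 2) with h | h
  · have h1 : radialWeight z₀ ≤ radialWeight z := hmin (by simpa using h)
    refine (hB _).trans ?_
    rw [div_mul_eq_mul_div, le_div_iff₀ hw]
    gcongr
  · rw [radialWeight_eq_zero]
    · exact mul_nonneg (by positivity) (radialWeight_nonneg z)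
    · have h1 := norm_sub_norm_le ((4 : ℝ) • z) (-e)
      rw [norm_neg, norm_smul, sub_neg_eq_add, add_comm ((4 : ℝ) • z)] at h1
      norm_num at h1
      linarith

/-- Radial means of a nonnegative function about nearby centres are comparable. -/
theorem exists_radialMean_le : ∃ K, 0 < K ∧ ∀ (g : E3 → ℝ), Continuous g → (∀ y, 0 ≤ g y) →
    ∀ (x y : E3) (r : ℝ), 0 < r → ‖y - x‖ ≤ r →
      radialMean g y r ≤ K * radialMean g x (4 * r) := by
  obtain ⟨C, hC0, hC⟩ := exists_radialWeight_add_le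
  refine ⟨64 * C, by positivity, fun g hg hg0 x y r hr hxy => ?_⟩
  set e : E3 := r⁻¹ • (x - y) with he
  have he1 : ‖e‖ ≤ 1 := by
    rw [he, norm_smul, norm_inv, Real.norm_of_nonneg hr.le, norm_sub_rev, ← div_eq_inv_mul,
      div_le_one hr]
    exact hxy
  have hpt : ∀ z : E3, y + r • (e + (4 : ℝ) • z) = x + (4 * r) • z := fun z => by
    rw [he, smul_add, smul_smul, smul_smul, mul_inv_cancel₀ hr.ne', one_smul, mul_comm r]
    abel
  rw [radialMean, radialMean, setIntegral_radialWeight_mul, setIntegral_radialWeight_mul]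
  have h2 := Measure.integral_comp_smul_of_nonneg (μ := (volume : Measure E3))
    (fun w => radialWeight (e + w) * g (y + r • (e + w))) 4 (hR := by norm_num)
  rw [integral_add_left_eq_self (fun w => radialWeight w * g (y + r • w))] at h2
  simp only [hpt, finrank_euclideanSpace, Fintype.card_fin, smul_eq_mul] at h2
  have h3 : ∫ z, radialWeight z * g (y + r • z) =
      64 * ∫ z, radialWeight (e + (4 : ℝ) • z) * g (x + (4 * r) • z) := by
    rw [h2]; ring
  rw [h3, mul_assoc, ← integral_const_mul C]
  refine mul_le_mul_of_nonneg_left (integral_mono_of_nonneg ?_ ?_ ?_) (by norm_num)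
  · exact Eventually.of_forall fun z => mul_nonneg (radialWeight_nonneg _) (hg0 _)
  · exact (integrable_radialWeight_mul (by fun_prop)).const_mul C
  · refine Eventually.of_forall fun z => ?_
    change radialWeight (e + (4 : ℝ) • z) * g (x + (4 * r) • z) ≤
      C * (radialWeight z * g (x + (4 * r) • z))
    rw [← mul_assoc]
    exact mul_le_mul_of_nonneg_right (hC e z he1) (hg0 _)

/-- The norm of the gradient of `p`, set to zero on the zero set of `p`. -/
def slopeOffZeros (p : E3 → ℝ) (x : E3) : ℝ := {x | p x ≠ 0}.indicator (fun x => ‖gradient p x‖) x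

theorem measurable_gradient (p : E3 → ℝ) : Measurable (gradient p) :=
  (InnerProductSpace.toDual ℝ E3).symm.continuous.measurable.comp (measurable_fderiv ℝ p)

theorem slopeOffZeros_nonneg (p : E3 → ℝ) (x : E3) : 0 ≤ slopeOffZeros p x :=
  Set.indicator_nonneg (fun _ _ => norm_nonneg _) x

theorem slopeOffZeros_of_ne {p : E3 → ℝ} {x : E3} (hx : p x ≠ 0) :
    slopeOffZeros p x = ‖gradient p x‖ := Set.indicator_of_mem (by exact hx) _

theorem slopeOffZeros_of_eq {p : E3 → ℝ} {x : E3} (hx : p x = 0) : slopeOffZeros p x = 0 :=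
  Set.indicator_of_notMem (by simpa using hx) _

namespace HarmonicOffZeros

variable {p : E3 → ℝ}

theorem measurable_slopeOffZeros (hp : HarmonicOffZeros p) : Measurable (slopeOffZeros p) :=
  (measurable_gradient p).norm.indicator
    (isOpen_ne_fun hp.continuous continuous_const).measurableSet

theorem continuous_cut_mul (hp : HarmonicOffZeros p) {ε : ℝ} (hε : 0 < ε) :
    Continuous fun y => cut ε (p y) * ‖gradient p y‖ ^ 2 :=
  hp.continuous_comp_mul (contDiff_cut ε).continuous hε (fun _ ht => cut_eq_zero hε ht)
    fun _ hx => (hp.continuousAt_gradient hx).norm.pow 2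

/-- A Caccioppoli-type bound, uniform in the truncation parameter. -/
theorem exists_energy_le (hp : HarmonicOffZeros p) {L : ℝ} (hL : 0 < L) :
    ∃ C, ∀ ε, 0 < ε → ∫ y in closedBall (0 : E3) L, cut ε (p y) * ‖gradient p y‖ ^ 2 ≤ C := by
  obtain ⟨M, hM⟩ := (isCompact_closedBall (0 : E3) (4 * L)).exists_bound_of_continuousOn
    hp.continuous.continuousOn
  set G := expNegInvGlue (3 / 4) with hG
  have hG0 : 0 < G := expNegInvGlue.pos_of_pos (by norm_num)
  refine ⟨(16 * L * (radialMass * M ^ 2)) / G, fun ε hε => ?_⟩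
  set T := prim (cut ε) with hT
  have hTs : ContDiff ℝ (⊤ : ℕ∞) T := contDiff_prim (contDiff_cut ε)
  have hT0 : ∀ t, |t| ≤ ε → T t = 0 := fun t ht => prim_eq_zero (fun s => cut_eq_zero hε) ht
  have hdT : deriv T = cut ε := deriv_prim (contDiff_cut ε).continuous
  set m := radialMean (fun y => prim T (p y)) 0 with hm
  have hbound : ∀ s, 0 ≤ s → s ≤ 4 * L → |m s| ≤ radialMass * M ^ 2 := fun s hs hsL => by
    refine abs_radialMean_le hs fun y hy => ?_
    have h1 : |p y| ≤ M := hM y (closedBall_subset_closedBall hsL hy)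
    calc |prim T (p y)| ≤ |p y| * |p y| :=
          abs_prim_le fun s hs => (abs_prim_cut_le hε s).trans hs
      _ ≤ M ^ 2 := by
        have hM0 : 0 ≤ M := (abs_nonneg _).trans h1
        rw [sq]
        gcongr
  obtain ⟨r, hr, hslope⟩ := exists_hasDerivAt_eq_slope m _ (by linarith : 2 * L < 4 * L)
    (continuous_radialMean (hp.contDiff_comp (contDiff_prim hTs) hε
      fun t ht => prim_eq_zero hT0 ht).continuous 0).continuousOn
    fun r hr => hp.hasDerivAt_radialMean_prim hTs hε hT0 0 (by linarith [hr.1])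
  have hr0 : 0 < r := by linarith [hr.1]
  have hc := hp.continuous_cut_mul hε
  have hi : Integrable fun y => cut ε (p y) * (‖gradient p y‖ ^ 2 * scaledBump 0 r y) := by
    simp_rw [← mul_assoc]
    exact (hc.mul (contDiff_scaledBump 0 r).continuous).integrable_of_hasCompactSupport
      (hasCompactSupport_scaledBump 0 hr0).mul_left
  have h0 : ∀ y, 0 ≤ cut ε (p y) * ‖gradient p y‖ ^ 2 := fun y =>
    mul_nonneg (cut_nonneg _ _) (by positivity)
  have h1 : G * ∫ y in closedBall (0 : E3) L, cut ε (p y) * ‖gradient p y‖ ^ 2 ≤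
      ∫ y, cut ε (p y) * (‖gradient p y‖ ^ 2 * scaledBump 0 r y) := by
    rw [← integral_const_mul]
    refine le_trans (setIntegral_mono_on (g := fun y => cut ε (p y) *
      (‖gradient p y‖ ^ 2 * scaledBump 0 r y)) ?_ hi.integrableOn measurableSet_closedBall ?_)
      (setIntegral_le_integral hi (Eventually.of_forall fun y => ?_))
    · exact (hc.const_mul G |>.continuousOn).integrableOn_compact (isCompact_closedBall _ _)
    · intro y hy
      have hy' : ‖r⁻¹ • (y - 0)‖ ≤ 1 / 2 := by
        rw [sub_zero, norm_smul, norm_inv, Real.norm_of_nonneg hr0.le, ← div_eq_inv_mul,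
          div_le_iff₀ hr0]
        have : ‖y‖ ≤ L := by simpa using hy
        linarith [hr.1]
      have h := mul_le_mul_of_nonneg_left (le_radialBump hy') (h0 y)
      rw [mul_comm, mul_assoc] at h
      simp only [scaledBump]
      linarith
    · simp only [Pi.zero_apply, ← mul_assoc]
      exact mul_nonneg (h0 y) (scaledBump_nonneg _ _ _)
  have h2 : ∫ y, cut ε (p y) * (‖gradient p y‖ ^ 2 * scaledBump 0 r y) ≤
      16 * L * (radialMass * M ^ 2) := by
    rw [hdT] at hslope
    have h3 : ∫ y, cut ε (p y) * (‖gradient p y‖ ^ 2 * scaledBump 0 r y) =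
        r ^ 2 * ((m (4 * L) - m (2 * L)) / (4 * L - 2 * L)) := by
      rw [← hslope, ← mul_assoc, mul_inv_cancel₀ (by positivity), one_mul]
    have h4 : m (4 * L) - m (2 * L) ≤ 2 * (radialMass * M ^ 2) := by
      have h5 := (abs_le.1 (hbound (4 * L) (by positivity) le_rfl)).2
      have h6 := (abs_le.1 (hbound (2 * L) (by positivity) (by linarith))).1
      linarith
    have h7 : 0 ≤ radialMass * M ^ 2 := mul_nonneg radialMass_pos.le (by positivity)
    have h8 : r ^ 2 ≤ 16 * L ^ 2 := by nlinarith [hr.2]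
    rw [h3]
    calc r ^ 2 * ((m (4 * L) - m (2 * L)) / (4 * L - 2 * L))
        ≤ r ^ 2 * ((2 * (radialMass * M ^ 2)) / (4 * L - 2 * L)) := by
          have : 0 < 4 * L - 2 * L := by linarith
          gcongr
      _ ≤ (16 * L ^ 2) * ((2 * (radialMass * M ^ 2)) / (4 * L - 2 * L)) := by
          have : 0 < 4 * L - 2 * L := by linarith
          gcongr
      _ = 16 * L * (radialMass * M ^ 2) := by
          have : 4 * L - 2 * L = 2 * L := by ring
          rw [this]
          field_simp
  rw [le_div_iff₀ hG0, mul_comm]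
  exact h1.trans h2

theorem locallyIntegrable_slopeOffZeros (hp : HarmonicOffZeros p) :
    LocallyIntegrable (slopeOffZeros p) := by
  have hmeas := hp.measurable_slopeOffZeros
  have hball : ∀ L : ℝ, 0 < L → IntegrableOn (slopeOffZeros p) (closedBall 0 L) := fun L hL => by
    obtain ⟨C, hC⟩ := hp.exists_energy_le hL
    have hε : ∀ n : ℕ, (0 : ℝ) < 1 / (n + 1) := fun n => Nat.one_div_pos_of_nat
    have hsq : IntegrableOn (fun y => slopeOffZeros p y ^ 2) (closedBall 0 L) := by
      refine ⟨(hmeas.pow_const 2).aestronglyMeasurable, ?_⟩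
      rw [hasFiniteIntegral_iff_ofReal (Eventually.of_forall fun y => by positivity)]
      have hlim : ∀ y, ENNReal.ofReal (slopeOffZeros p y ^ 2) = liminf (fun n : ℕ =>
          ENNReal.ofReal (cut (1 / (n + 1)) (p y) * ‖gradient p y‖ ^ 2)) atTop := fun y => by
        refine (Tendsto.liminf_eq (tendsto_const_nhds.congr' ?_)).symm
        by_cases hy : p y = 0
        · refine Eventually.of_forall fun n => ?_
          simp only
          rw [slopeOffZeros_of_eq hy, hy, cut_eq_zero (hε n) (by rw [abs_zero]; exact (hε n).le)]
          simp
        · have h1 : Tendsto (fun n : ℕ => 2 * (1 / ((n : ℝ) + 1))) atTop (𝓝 (2 * 0)) :=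
            tendsto_one_div_add_atTop_nhds_zero_nat.const_mul 2
          filter_upwards [h1.eventually_lt_const (by simpa using hy : 2 * 0 < |p y|)] with n hn
          rw [slopeOffZeros_of_ne hy, cut_eq_one (hε n) hn.le, one_mul]
      simp_rw [hlim]
      refine (lintegral_liminf_le' fun n => ?_).trans_lt ?_
      · exact (hp.continuous_cut_mul (hε n)).measurable.ennreal_ofReal.aemeasurable
      · refine lt_of_le_of_lt ?_ (ENNReal.ofReal_lt_top (r := C))
        refine liminf_le_of_frequently_le' (Frequently.of_forall fun n => ?_)
        rw [← ofReal_integral_eq_lintegral_ofReal]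
        · exact ENNReal.ofReal_le_ofReal (hC _ (hε n))
        · exact (hp.continuous_cut_mul (hε n)).continuousOn.integrableOn_compact
            (isCompact_closedBall _ _)
        · exact Eventually.of_forall fun y => mul_nonneg (cut_nonneg _ _) (by positivity)
    have h1 : IntegrableOn (fun _ : E3 => (1 : ℝ)) (closedBall 0 L) :=
      continuousOn_const.integrableOn_compact (isCompact_closedBall _ _)
    refine Integrable.mono' (h1.add hsq) hmeas.aestronglyMeasurable
      (Eventually.of_forall fun y => ?_)
    rw [Real.norm_of_nonneg (slopeOffZeros_nonneg p y), Pi.add_apply]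
    nlinarith [sq_nonneg (slopeOffZeros p y - 1), slopeOffZeros_nonneg p y]
  refine locallyIntegrable_iff.2 fun k hk => ?_
  obtain ⟨L, hL⟩ := hk.isBounded.subset_closedBall 0
  exact (hball (max L 1) (by positivity)).mono_set
    (hL.trans (closedBall_subset_closedBall (le_max_left _ _)))

theorem norm_gradient_comp_le (hp : HarmonicOffZeros p) {J : ℝ → ℝ} (hJ : ContDiff ℝ (⊤ : ℕ∞) J)
    {ε : ℝ} (hε : 0 < ε) (h0 : ∀ t, |t| ≤ ε → J t = 0) (h1 : ∀ t, |deriv J t| ≤ 1)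
    (h2 : deriv J 0 = 0) (x : E3) :
    ‖gradient (fun x => J (p x)) x‖ ≤ slopeOffZeros p x := by
  rw [hp.gradient_comp hJ hε h0, norm_smul]
  by_cases hx : p x = 0
  · simp [hx, h2, slopeOffZeros_of_eq]
  · rw [slopeOffZeros_of_ne hx]
    exact mul_le_of_le_one_left (norm_nonneg _) (h1 _)

/-- If the slope of `p` is small on average on all small balls about a zero `x`, then `p` is small
near `x`. -/
theorem exists_abs_le_of_setIntegral_le : ∃ K, 0 < K ∧ ∀ p : E3 → ℝ, HarmonicOffZeros p →
    ∀ (x y : E3) (r δ : ℝ), p x = 0 → 0 < r → ‖y - x‖ ≤ r →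
      (∀ t, 0 < t → t < 4 * r → ∫ z in closedBall x t, slopeOffZeros p z ≤ δ * t ^ 3) →
        |p y| ≤ K * δ * r := by
  obtain ⟨B, hB0, hB⟩ := exists_radialWeight_le
  obtain ⟨K, hK0, hK⟩ := exists_radialMean_le
  have hmass := radialMass_pos
  refine ⟨4 * K * B / radialMass, by positivity, fun p hp x y r δ hx hr hxy hδ => ?_⟩
  suffices h : ∀ ε, 0 < ε → |p y| ≤ 4 * K * B / radialMass * δ * r + 2 * ε by
    refine le_of_forall_pos_le_add fun ε hε => ?_
    simpa using (h (ε / 2) (half_pos hε)).trans_eq (by ring)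
  intro ε hε
  set T := smoothSign ε with hT
  have hTs : ContDiff ℝ (⊤ : ℕ∞) T := contDiff_smoothSign ε
  have hT0 : ∀ t, |t| ≤ ε → T t = 0 := fun t ht => smoothSign_eq_zero hε ht
  have hJ0 : ∀ t, |t| ≤ ε → prim T t = 0 := fun t ht => prim_eq_zero hT0 ht
  set g : E3 → ℝ := fun y => prim T (p y) with hg
  have hgs : ContDiff ℝ (⊤ : ℕ∞) g := hp.contDiff_comp (contDiff_prim hTs) hε hJ0
  have h1 : radialMass * g y ≤ radialMean g y r := by
    obtain ⟨t, ht, hs⟩ := exists_hasDerivAt_eq_slope (radialMean g y) _ hr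
      (continuous_radialMean hgs.continuous y).continuousOn
      fun t ht => hp.hasDerivAt_radialMean_prim hTs hε hT0 y ht.1
    have h2 : 0 ≤ (radialMean g y r - radialMean g y 0) / (r - 0) := by
      rw [← hs]
      refine mul_nonneg (by positivity) (integral_nonneg fun z => ?_)
      exact mul_nonneg (deriv_smoothSign_nonneg hε _)
        (mul_nonneg (by positivity) (scaledBump_nonneg _ _ _))
    rw [sub_zero, le_div_iff₀ hr, zero_mul, radialMean_zero] at h2
    linarith
  have h2 : radialMean g x (4 * r) ≤ B * δ * (4 * r) := by
    obtain ⟨t, ht, hs⟩ := exists_hasDerivAt_eq_slope (radialMean g x) _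
      (by positivity : 0 < 4 * r) (continuous_radialMean hgs.continuous x).continuousOn
      fun t ht => hasDerivAt_radialMean hgs x ht.1
    have ht0 := ht.1
    have h3 : |∫ z, ⟪gradient g z, gradient (scaledBump x t) z⟫| ≤
        t⁻¹ * B * (δ * t ^ 3) := by
      have h4 : ∫ z, ⟪gradient g z, gradient (scaledBump x t) z⟫ =
          ∫ z in closedBall x t, ⟪gradient g z, gradient (scaledBump x t) z⟫ :=
        (setIntegral_eq_integral_of_forall_compl_eq_zero fun z hz => by
          rw [gradient_scaledBump_eq_zero ht0 hz, inner_zero_right]).symm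
      have hi : IntegrableOn (slopeOffZeros p) (closedBall x t) :=
        hp.locallyIntegrable_slopeOffZeros.integrableOn_isCompact (isCompact_closedBall _ _)
      rw [h4, ← Real.norm_eq_abs]
      refine (norm_integral_le_of_norm_le (hi.const_mul (t⁻¹ * B))
        (Eventually.of_forall fun z => ?_)).trans ?_
      · refine (norm_inner_le_norm _ _).trans ?_
        rw [mul_comm]
        refine mul_le_mul (norm_gradient_scaledBump_le hB x ht0 z) ?_ (norm_nonneg _)
          (by positivity)
        refine hp.norm_gradient_comp_le (contDiff_prim hTs) hε hJ0 (fun s => ?_) ?_ z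
        · rw [deriv_prim hTs.continuous]
          exact abs_smoothSign_le_one ε s
        · rw [deriv_prim hTs.continuous]
          exact hT0 0 (by simpa using hε.le)
      · rw [integral_const_mul]
        exact mul_le_mul_of_nonneg_left (hδ t ht0 ht.2) (by positivity)
    have h5 : (radialMean g x (4 * r) - radialMean g x 0) / (4 * r - 0) ≤ B * δ := by
      rw [← hs, ← mul_neg]
      calc (t ^ 2)⁻¹ * -∫ z, ⟪gradient g z, gradient (scaledBump x t) z⟫
          ≤ (t ^ 2)⁻¹ * (t⁻¹ * B * (δ * t ^ 3)) :=
            mul_le_mul_of_nonneg_left ((neg_le_abs _).trans h3) (by positivity)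
        _ = B * δ := by field_simp
    have h6 : radialMean g x 0 = 0 := by
      rw [radialMean_zero, hg]
      simp [hx, hJ0 0 (by simpa using hε.le)]
    rw [h6, sub_zero, sub_zero, div_le_iff₀ (by positivity)] at h5
    exact h5
  have h3 := hK g hgs.continuous (fun z => prim_smoothSign_nonneg hε _) x y r hr hxy
  have h4 : g y ≤ 4 * K * B / radialMass * δ * r := by
    have h5 : radialMass * g y ≤ K * (B * δ * (4 * r)) :=
      h1.trans (h3.trans (mul_le_mul_of_nonneg_left h2 hK0.le))
    have h6 : 4 * K * B / radialMass * δ * r = (K * (B * δ * (4 * r))) / radialMass := by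
      field_simp
    rw [h6, le_div_iff₀ hmass]
    linarith
  linarith [abs_le_prim_smoothSign_add hε (p y)]

theorem ae_hasGradientAt_zero (hp : HarmonicOffZeros p) :
    ∀ᵐ x, p x = 0 → HasGradientAt p 0 x := by
  obtain ⟨K, hK0, hK⟩ := exists_abs_le_of_setIntegral_le
  filter_upwards [IsUnifLocDoublingMeasure.ae_tendsto_average volume
    hp.locallyIntegrable_slopeOffZeros 1] with x hx hpx
  have hlim := hx (l := 𝓝[>] (0 : ℝ)) (fun _ => x) id tendsto_id (by
    filter_upwards [self_mem_nhdsWithin] with t ht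
    simpa using (le_of_lt ht : (0 : ℝ) ≤ t))
  rw [slopeOffZeros_of_eq hpx] at hlim
  set v := (volume : Measure E3).real (ball 0 1) with hv
  have hv0 : 0 < v :=
    ENNReal.toReal_pos (measure_ball_pos volume _ one_pos).ne' measure_ball_lt_top.ne
  rw [hasGradientAt_iff_isLittleO, Asymptotics.isLittleO_iff]
  intro c hc
  have hev := hlim.eventually_lt_const (show 0 < c / (K * v) by positivity)
  obtain ⟨t₀, ht₀, hsub⟩ := (mem_nhdsGT_iff_exists_Ioo_subset).1 hev
  have ht₀' : (0 : ℝ) < t₀ := ht₀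
  filter_upwards [ball_mem_nhds x (by positivity : 0 < t₀ / 4)] with y hy
  rw [hpx, inner_zero_left, sub_zero, sub_zero, Real.norm_eq_abs]
  rcases eq_or_ne y x with rfl | hyx
  · simp [hpx]
  have hr : 0 < ‖y - x‖ := norm_pos_iff.2 (sub_ne_zero.2 hyx)
  rw [mem_ball, dist_eq_norm] at hy
  refine (hK p hp x y ‖y - x‖ (c / K) hpx hr le_rfl fun t ht htr => ?_).trans_eq ?_
  · have h1 : ⨍ z in closedBall x t, slopeOffZeros p z < c / (K * v) :=
      hsub ⟨ht, by linarith⟩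
    have h2 : (volume : Measure E3).real (closedBall x t) = t ^ 3 * v := by
      rw [Measure.real, Measure.addHaar_closedBall _ _ ht.le, ENNReal.toReal_mul,
        ENNReal.toReal_ofReal (by positivity), finrank_euclideanSpace, Fintype.card_fin]
      rfl
    rw [setAverage_eq, h2, smul_eq_mul, inv_mul_lt_iff₀ (by positivity)] at h1
    refine h1.le.trans_eq ?_
    field_simp
  · field_simp

theorem ae_differentiableAt (hp : HarmonicOffZeros p) : ∀ᵐ x, DifferentiableAt ℝ p x := by
  filter_upwards [hp.ae_hasGradientAt_zero] with x hx
  by_cases h : p x = 0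
  · exact (hx h).differentiableAt
  · exact (hp.contDiffAt x h).differentiableAt (by simp)

theorem ae_norm_gradient_eq (hp : HarmonicOffZeros p) :
    ∀ᵐ x, ‖gradient p x‖ = slopeOffZeros p x := by
  filter_upwards [hp.ae_hasGradientAt_zero] with x hx
  by_cases h : p x = 0
  · rw [(hx h).gradient, slopeOffZeros_of_eq h, norm_zero]
  · rw [slopeOffZeros_of_ne h]

theorem locallyIntegrable_gradient (hp : HarmonicOffZeros p) :
    LocallyIntegrable (gradient p) := by
  refine hp.locallyIntegrable_slopeOffZeros.mono (measurable_gradient p).aestronglyMeasurable ?_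
  filter_upwards [hp.ae_norm_gradient_eq] with x hx
  rw [hx, Real.norm_of_nonneg (slopeOffZeros_nonneg p x)]

theorem tendsto_setIntegral_one_sub_cut_mul (hp : HarmonicOffZeros p) {K : Set E3}
    (hK : IsCompact K) :
    Tendsto (fun n : ℕ => ∫ y in K, (1 - cut (1 / (n + 1)) (p y)) * slopeOffZeros p y) atTop
      (𝓝 0) := by
  have hε : ∀ n : ℕ, (0 : ℝ) < 1 / (n + 1) := fun n => Nat.one_div_pos_of_nat
  have hc : ∀ n : ℕ, Continuous fun y => 1 - cut (1 / (n + 1)) (p y) := fun n =>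
    continuous_const.sub ((contDiff_cut _).continuous.comp hp.continuous)
  have h := tendsto_integral_of_dominated_convergence (μ := volume.restrict K)
    (F := fun (n : ℕ) y => (1 - cut (1 / (n + 1)) (p y)) * slopeOffZeros p y) (f := fun _ => 0)
    (slopeOffZeros p)
    (fun n => ((hc n).measurable.mul hp.measurable_slopeOffZeros).aestronglyMeasurable)
    (hp.locallyIntegrable_slopeOffZeros.integrableOn_isCompact hK)
    (fun n => Eventually.of_forall fun y => by
      have h1 := cut_nonneg (1 / (n + 1)) (p y)
      have h2 := cut_le_one (hε n) (p y)
      have h3 := slopeOffZeros_nonneg p y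
      rw [norm_mul, Real.norm_of_nonneg h3, Real.norm_of_nonneg (by linarith)]
      exact mul_le_of_le_one_left h3 (by linarith))
    (Eventually.of_forall fun y => by
      refine tendsto_const_nhds.congr' ?_
      by_cases hy : p y = 0
      · exact Eventually.of_forall fun n => by simp [slopeOffZeros_of_eq hy]
      · have h1 : Tendsto (fun n : ℕ => 2 * (1 / ((n : ℝ) + 1))) atTop (𝓝 (2 * 0)) :=
          tendsto_one_div_add_atTop_nhds_zero_nat.const_mul 2
        filter_upwards [h1.eventually_lt_const (by simpa using hy : 2 * 0 < |p y|)] with n hn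
        rw [cut_eq_one (hε n) hn.le, sub_self, zero_mul])
  simpa using h

theorem one_sub_cut_mul_nonneg {ε : ℝ} (hε : 0 < ε) (y : E3) :
    0 ≤ (1 - cut ε (p y)) * slopeOffZeros p y :=
  mul_nonneg (by linarith [cut_le_one hε (p y)]) (slopeOffZeros_nonneg p y)

theorem integrableOn_one_sub_cut_mul (hp : HarmonicOffZeros p) {ε : ℝ} (hε : 0 < ε) {K : Set E3}
    (hK : IsCompact K) : IntegrableOn (fun y => (1 - cut ε (p y)) * slopeOffZeros p y) K := by
  refine (hp.locallyIntegrable_slopeOffZeros.integrableOn_isCompact hK).mono' ?_ ?_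
  · exact ((continuous_const.sub ((contDiff_cut _).continuous.comp hp.continuous)).measurable.mul
      hp.measurable_slopeOffZeros).aestronglyMeasurable
  · refine Eventually.of_forall fun y => ?_
    rw [Real.norm_of_nonneg (one_sub_cut_mul_nonneg hε y)]
    exact mul_le_of_le_one_left (slopeOffZeros_nonneg p y) (by linarith [cut_nonneg ε (p y)])

theorem norm_gradient_prim_cut_sub_le (hp : HarmonicOffZeros p) {ε : ℝ} (hε : 0 < ε) :
    ∀ᵐ y, ‖gradient (fun y => prim (cut ε) (p y)) y - gradient p y‖ ≤
      (1 - cut ε (p y)) * slopeOffZeros p y := by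
  filter_upwards [hp.ae_norm_gradient_eq] with y hy
  have h : gradient (fun y => prim (cut ε) (p y)) y = cut ε (p y) • gradient p y := by
    rw [hp.gradient_comp (contDiff_prim (contDiff_cut ε)) hε
      fun t ht => prim_eq_zero (fun s hs => cut_eq_zero hε hs) ht,
      deriv_prim (contDiff_cut ε).continuous]
  rw [h, ← hy]
  have h2 : cut ε (p y) • gradient p y - gradient p y = -((1 - cut ε (p y)) • gradient p y) := by
    rw [sub_smul, one_smul, neg_sub]
  rw [h2, norm_neg, norm_smul, Real.norm_of_nonneg (by linarith [cut_le_one hε (p y)])]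

theorem abs_integral_inner_gradient_prim_cut_le (hp : HarmonicOffZeros p)
    (hw : ∀ x r, 0 < r → ∫ y, ⟪gradient p y, gradient (scaledBump x r) y⟫ = 0) {B : ℝ}
    (hB : ∀ z, radialWeight z ≤ B) {ε : ℝ} (hε : 0 < ε) (x : E3) {t : ℝ} (ht : 0 < t) :
    |∫ y, ⟪gradient (fun y => prim (cut ε) (p y)) y, gradient (scaledBump x t) y⟫| ≤
      t⁻¹ * B * ∫ y in closedBall x t, (1 - cut ε (p y)) * slopeOffZeros p y := by
  have hB0 : 0 ≤ B := (radialWeight_nonneg 0).trans (hB 0)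
  have hJ := hp.contDiff_comp (contDiff_prim (contDiff_cut ε)) hε
    fun t ht => prim_eq_zero (fun s hs => cut_eq_zero hε hs) ht
  have hb := contDiff_scaledBump x t
  have hset : ∀ G : E3 → E3, ∫ y, ⟪G y, gradient (scaledBump x t) y⟫ =
      ∫ y in closedBall x t, ⟪G y, gradient (scaledBump x t) y⟫ := fun G =>
    (setIntegral_eq_integral_of_forall_compl_eq_zero fun z hz => by
      rw [gradient_scaledBump_eq_zero ht hz, inner_zero_right]).symm
  have hK := isCompact_closedBall x t
  have hi1 : IntegrableOn (fun y => ⟪gradient (fun y => prim (cut ε) (p y)) y,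
      gradient (scaledBump x t) y⟫) (closedBall x t) :=
    ((continuous_gradient hJ).inner (continuous_gradient hb)).continuousOn.integrableOn_compact hK
  have hi2 : IntegrableOn (fun y => ⟪gradient p y, gradient (scaledBump x t) y⟫)
      (closedBall x t) := by
    refine Integrable.mono' (g := fun y => t⁻¹ * B * slopeOffZeros p y)
      ((hp.locallyIntegrable_slopeOffZeros.integrableOn_isCompact hK).const_mul _) ?_ ?_
    · exact ((measurable_gradient p).inner
        (continuous_gradient hb).measurable).aestronglyMeasurable
    · filter_upwards [ae_restrict_of_ae hp.ae_norm_gradient_eq] with y hy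
      refine (norm_inner_le_norm _ _).trans ?_
      rw [hy, mul_comm]
      exact mul_le_mul_of_nonneg_right (norm_gradient_scaledBump_le hB x ht y)
        (slopeOffZeros_nonneg p y)
  have hdiff : ∫ y, ⟪gradient (fun y => prim (cut ε) (p y)) y, gradient (scaledBump x t) y⟫ =
      ∫ y in closedBall x t, ⟪gradient (fun y => prim (cut ε) (p y)) y - gradient p y,
        gradient (scaledBump x t) y⟫ := by
    simp_rw [inner_sub_left]
    rw [integral_sub hi1 hi2, ← hset, ← hset, hw x t ht, sub_zero]
  rw [hdiff, ← integral_const_mul, ← Real.norm_eq_abs]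
  refine norm_integral_le_of_norm_le ?_ ?_
  · exact (hp.integrableOn_one_sub_cut_mul hε hK).const_mul _
  · filter_upwards [ae_restrict_of_ae (hp.norm_gradient_prim_cut_sub_le hε)] with y hy
    refine (norm_inner_le_norm _ _).trans ?_
    rw [mul_comm]
    exact mul_le_mul (norm_gradient_scaledBump_le hB x ht y) hy (norm_nonneg _) (by positivity)

end HarmonicOffZeros

theorem radialMean_sub {f g : E3 → ℝ} (hf : Continuous f) (hg : Continuous g) (x : E3) (r : ℝ) :
    radialMean (fun y => f y - g y) x r = radialMean f x r - radialMean g x r := by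
  have h : ∀ {f : E3 → ℝ}, Continuous f →
      IntegrableOn (fun z => radialWeight z * f (x + r • z)) (closedBall 0 1) := fun hf =>
    (integrable_radialWeight_mul (by fun_prop)).integrableOn
  rw [radialMean, radialMean, radialMean, ← integral_sub (h hf) (h hg)]
  simp_rw [mul_sub]

theorem radialMean_inner_add (a : E3) (c : ℝ) (x : E3) (r : ℝ) :
    radialMean (fun y => ⟪a, y⟫ + c) x r = radialMass * (⟪a, x⟫ + c) := by
  have h1 : ∫ z : E3, radialWeight z * ⟪a, z⟫ = 0 := by
    have h := integral_neg_eq_self (fun z : E3 => radialWeight z * ⟪a, z⟫) volume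
    simp only [radialWeight_neg, inner_neg_right, mul_neg, integral_neg] at h
    linarith
  have h2 : radialMass = ∫ z : E3, radialWeight z := by
    simpa [radialMass] using setIntegral_radialWeight_mul fun _ => 1
  have h3 : ∀ z : E3, radialWeight z * (⟪a, x + r • z⟫ + c) =
      radialWeight z * (⟪a, x⟫ + c) + r * (radialWeight z * ⟪a, z⟫) := fun z => by
    rw [inner_add_right, inner_smul_right]
    ring
  rw [radialMean, setIntegral_radialWeight_mul]
  simp_rw [h3]
  rw [integral_add (integrable_radialWeight_mul continuous_const)
    ((integrable_radialWeight_mul (by fun_prop)).const_mul r), integral_const_mul, h1,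
    integral_mul_const, ← h2, mul_zero, add_zero]

/-- A function with the radial mean value property that tends to zero at infinity vanishes. -/
theorem eq_zero_of_radialMean_eq {q : E3 → ℝ} (hq : Continuous q)
    (hlim : Tendsto q (cocompact E3) (𝓝 0))
    (hmean : ∀ x r, 0 < r → radialMean q x r = radialMass * q x) (x : E3) : q x = 0 := by
  obtain ⟨N, hN⟩ : ∃ N, ∀ y, |q y| ≤ N := by
    obtain ⟨K, hK, hKs⟩ := mem_cocompact.1 (hlim (Metric.closedBall_mem_nhds 0 one_pos))
    obtain ⟨M, hM⟩ := hK.exists_bound_of_continuousOn hq.continuousOn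
    refine ⟨max M 1, fun y => ?_⟩
    by_cases hy : y ∈ K
    · exact (hM y hy).trans (le_max_left _ _)
    · have h : q y ∈ closedBall (0 : ℝ) 1 := hKs hy
      exact (by simpa using h : |q y| ≤ 1).trans (le_max_right _ _)
  have h : Tendsto (fun r : ℝ => radialMean q x r) atTop (𝓝 0) := by
    have h1 := tendsto_integral_filter_of_dominated_convergence (l := (atTop : Filter ℝ))
      (μ := (volume : Measure E3).restrict (closedBall 0 1))
      (F := fun r z => radialWeight z * q (x + r • z)) (f := fun _ => 0)
      (fun z => radialWeight z * N)
      (Eventually.of_forall fun r => (continuous_radialWeight.mul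
        (by fun_prop : Continuous fun z => q (x + r • z))).aestronglyMeasurable)
      (Eventually.of_forall fun r => Eventually.of_forall fun z => by
        rw [norm_mul, Real.norm_of_nonneg (radialWeight_nonneg z)]
        exact mul_le_mul_of_nonneg_left (hN _) (radialWeight_nonneg z))
      (integrable_radialWeight_mul continuous_const).integrableOn
      (by
        have hne : ∀ᵐ z : E3, z ≠ 0 := by simp [ae_iff]
        filter_upwards [ae_restrict_of_ae hne] with z hz
        have h2 : Tendsto (fun r : ℝ => x + r • z) atTop (cocompact E3) := by
          refine tendsto_cocompact_of_tendsto_dist_comp_atTop x ?_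
          simp only [dist_self_add_left, norm_smul]
          exact (tendsto_norm_atTop_atTop).atTop_mul_const (norm_pos_iff.2 hz)
        simpa using (hlim.comp h2).const_mul (radialWeight z))
    simpa [radialMean] using h1
  have h2 : Tendsto (fun _ : ℝ => radialMass * q x) atTop (𝓝 0) := by
    refine h.congr' ?_
    filter_upwards [eventually_gt_atTop 0] with r hr
    exact hmean x r hr
  have h3 := tendsto_nhds_unique h2 tendsto_const_nhds
  exact (mul_eq_zero.1 h3.symm).resolve_left radialMass_pos.ne'

namespace HarmonicOffZeros

variable {p : E3 → ℝ}

theorem radialMean_eq (hp : HarmonicOffZeros p)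
    (hw : ∀ x r, 0 < r → ∫ y, ⟪gradient p y, gradient (scaledBump x r) y⟫ = 0) (x : E3) {r : ℝ}
    (hr : 0 < r) : radialMean p x r = radialMass * p x := by
  obtain ⟨B, hB0, hB⟩ := exists_radialWeight_le
  have hε : ∀ n : ℕ, (0 : ℝ) < 1 / (n + 1) := fun n => Nat.one_div_pos_of_nat
  have hconst : ∀ s, 0 < s → s < r → radialMean p x r = radialMean p x s := fun s hs hsr => by
    set I : ℕ → ℝ := fun n =>
      ∫ y in closedBall x r, (1 - cut (1 / (n + 1)) (p y)) * slopeOffZeros p y with hI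
    have hbound : ∀ n : ℕ, |radialMean p x r - radialMean p x s| ≤
        (s ^ 2)⁻¹ * (s⁻¹ * B * I n) * (r - s) + 4 * radialMass * (1 / (n + 1)) := fun n => by
      set ε : ℝ := 1 / (n + 1) with hεn
      set g : E3 → ℝ := fun y => prim (cut ε) (p y) with hg
      have hgs : ContDiff ℝ (⊤ : ℕ∞) g := hp.contDiff_comp (contDiff_prim (contDiff_cut ε)) (hε n)
        fun t ht => prim_eq_zero (fun s hs => cut_eq_zero (hε n) hs) ht
      have hclose : ∀ t, 0 ≤ t → |radialMean g x t - radialMean p x t| ≤ radialMass * (2 * ε) :=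
        fun t ht => by
          rw [← radialMean_sub hgs.continuous hp.continuous]
          exact abs_radialMean_le ht fun y _ => abs_prim_cut_sub_le (hε n) _
      obtain ⟨t, ht, hslope⟩ := exists_hasDerivAt_eq_slope (radialMean g x) _ hsr
        (continuous_radialMean hgs.continuous x).continuousOn
        fun t ht => hasDerivAt_radialMean hgs x (hs.trans ht.1)
      have ht0 : 0 < t := hs.trans ht.1
      have hnn : ∀ y, 0 ≤ (1 - cut ε (p y)) * slopeOffZeros p y :=
        one_sub_cut_mul_nonneg (hε n)
      have hmono : ∫ y in closedBall x t, (1 - cut ε (p y)) * slopeOffZeros p y ≤ I n :=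
        setIntegral_mono_set (hp.integrableOn_one_sub_cut_mul (hε n) (isCompact_closedBall x r))
          (Eventually.of_forall hnn)
          (closedBall_subset_closedBall ht.2.le).eventuallyLE
      have hI0 : 0 ≤ I n := setIntegral_nonneg measurableSet_closedBall fun y _ => hnn y
      have hder : |(radialMean g x r - radialMean g x s) / (r - s)| ≤
          (s ^ 2)⁻¹ * (s⁻¹ * B * I n) := by
        rw [← hslope, abs_neg, abs_mul, abs_of_nonneg (by positivity : 0 ≤ (t ^ 2)⁻¹)]
        have hts : t⁻¹ ≤ s⁻¹ := inv_anti₀ hs ht.1.le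
        have hts2 : (t ^ 2)⁻¹ ≤ (s ^ 2)⁻¹ := inv_anti₀ (by positivity) (by nlinarith [ht.1])
        refine mul_le_mul hts2 ?_ (abs_nonneg _) (by positivity)
        refine (hp.abs_integral_inner_gradient_prim_cut_le hw hB (hε n) x ht0).trans ?_
        have := setIntegral_nonneg (μ := volume) (measurableSet_closedBall (x := x) (ε := t))
          fun y _ => hnn y
        gcongr
      have hrs : 0 < r - s := sub_pos.2 hsr
      rw [abs_div, abs_of_pos hrs, div_le_iff₀ hrs] at hder
      have e1 := abs_le.1 (hclose r hr.le)
      have e2 := abs_le.1 (hclose s hs.le)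
      have e3 := abs_le.1 hder
      rw [abs_le]
      constructor <;> linarith [e1.1, e1.2, e2.1, e2.2, e3.1, e3.2]
    have hlim : Tendsto (fun n : ℕ => (s ^ 2)⁻¹ * (s⁻¹ * B * I n) * (r - s) +
        4 * radialMass * (1 / ((n : ℝ) + 1))) atTop
        (𝓝 ((s ^ 2)⁻¹ * (s⁻¹ * B * 0) * (r - s) + 4 * radialMass * 0)) :=
      ((((hp.tendsto_setIntegral_one_sub_cut_mul (isCompact_closedBall x r)).const_mul
        _).const_mul _).mul_const _).add (tendsto_one_div_add_atTop_nhds_zero_nat.const_mul _)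
    have h0 := ge_of_tendsto' hlim hbound
    simp only [mul_zero, zero_mul, add_zero] at h0
    exact sub_eq_zero.1 (abs_nonpos_iff.1 h0)
  have h1 : Tendsto (radialMean p x) (𝓝[>] 0) (𝓝 (radialMean p x 0)) :=
    ((continuous_radialMean hp.continuous x).tendsto 0).mono_left nhdsWithin_le_nhds
  have h2 : Tendsto (radialMean p x) (𝓝[>] 0) (𝓝 (radialMean p x r)) := by
    refine tendsto_const_nhds.congr' ?_
    filter_upwards [Ioo_mem_nhdsGT hr] with s hs
    exact hconst s hs.1 hs.2
  rw [tendsto_nhds_unique h2 h1, radialMean_zero]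

/-- A Liouville theorem: a weakly harmonic function asymptotic to an affine one is affine. -/
theorem eq_affine_of_tendsto (hp : HarmonicOffZeros p)
    (hw : ∀ x r, 0 < r → ∫ y, ⟪gradient p y, gradient (scaledBump x r) y⟫ = 0) {a : E3} {c : ℝ}
    (hlim : Tendsto (fun y => p y - (⟪a, y⟫ + c)) (cocompact E3) (𝓝 0)) (x : E3) :
    p x = ⟪a, x⟫ + c := by
  have hpc := hp.continuous
  have hac : Continuous fun y : E3 => ⟪a, y⟫ + c := by fun_prop
  refine sub_eq_zero.1 (eq_zero_of_radialMean_eq (q := fun y => p y - (⟪a, y⟫ + c))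
    (hpc.sub hac) hlim (fun x r hr => ?_) x)
  rw [radialMean_sub hpc hac, hp.radialMean_eq hw x hr, radialMean_inner_add, mul_sub]

end HarmonicOffZeros

/-! ### Solutions that are linear in the inclusion -/

theorem hasGradientAt_inner_add (b : E3) (c : ℝ) (x : E3) :
    HasGradientAt (fun y => ⟪b, y⟫ + c) b x := by
  rw [hasGradientAt_iff_hasFDerivAt]
  exact ((InnerProductSpace.toDual ℝ E3 b).hasFDerivAt).add_const c

theorem gradient_sub_inner_add {u : E3 → ℝ} {x : E3} (hu : DifferentiableAt ℝ u x) (b : E3)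
    (c : ℝ) : gradient (fun y => u y - (⟪b, y⟫ + c)) x = gradient u x - b := by
  apply HasGradientAt.gradient
  rw [hasGradientAt_iff_hasFDerivAt, map_sub]
  exact hu.hasGradientAt.hasFDerivAt.sub (hasGradientAt_inner_add b c x).hasFDerivAt

theorem gradient_eq_zero_of_notMem_tsupport {φ : E3 → ℝ} {x : E3} (hx : x ∉ tsupport φ) :
    gradient φ x = 0 := by
  rw [(notMem_tsupport_iff_eventuallyEq.1 hx).gradient_eq]
  exact gradient_fun_const x 0

theorem integrable_mul_inner_gradient {w : E3 → ℝ} (hw : Measurable w) {W : ℝ}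
    (hW : ∀ x, |w x| ≤ W) {G : E3 → E3} (hG : LocallyIntegrable G) {φ : E3 → ℝ}
    (hφ : ContDiff ℝ (⊤ : ℕ∞) φ) (hφc : HasCompactSupport φ) :
    Integrable fun x => w x * ⟪G x, gradient φ x⟫ := by
  have hK : IsCompact (tsupport φ) := hφc
  obtain ⟨N, hN⟩ := hK.exists_bound_of_continuousOn (continuous_gradient hφ).continuousOn
  have hi := hG.integrableOn_isCompact hK
  refine IntegrableOn.integrable_of_forall_notMem_eq_zero (s := tsupport φ) ?_ fun x hx => by
    rw [gradient_eq_zero_of_notMem_tsupport hx, inner_zero_right, mul_zero]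
  refine (hi.norm.mul_const (W * N)).mono' (hw.aestronglyMeasurable.mul
    (hi.aestronglyMeasurable.inner (continuous_gradient hφ).aestronglyMeasurable)) ?_
  refine (ae_restrict_iff' (isClosed_tsupport φ).measurableSet).2 (Eventually.of_forall
    fun x hx => ?_)
  have h1 := norm_inner_le_norm (𝕜 := ℝ) (G x) (gradient φ x)
  have h2 := hN x hx
  have hW0 := (abs_nonneg _).trans (hW x)
  calc ‖w x * ⟪G x, gradient φ x⟫‖ = |w x| * ‖⟪G x, gradient φ x⟫‖ := norm_mul _ _
    _ ≤ W * (‖G x‖ * N) :=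
      mul_le_mul (hW x) (h1.trans (mul_le_mul_of_nonneg_left h2 (norm_nonneg _)))
        (norm_nonneg _) hW0
    _ = ‖G x‖ * (W * N) := by ring

theorem integral_inner_gradient_eq_zero {φ : E3 → ℝ} (hφ : ContDiff ℝ (⊤ : ℕ∞) φ)
    (hφc : HasCompactSupport φ) (b : E3) : ∫ x, ⟪b, gradient φ x⟫ = 0 := by
  have hi := integrable_mul_inner_gradient (w := fun _ => 1) measurable_const (fun _ => le_rfl)
    (locallyIntegrable_const b) hφ hφc
  simp only [one_mul, inner_gradient_right, conj_trivial] at hi ⊢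
  have h := integral_mul_fderiv_eq_neg_fderiv_mul_of_integrable (μ := (volume : Measure E3))
    (f := fun _ => (1 : ℝ)) (g := φ) (v := b) (by simp) (by simpa using hi)
    (by simpa using hφ.continuous.integrable_of_hasCompactSupport hφc)
    (fun x _ => differentiableAt_const _) (fun x _ => hφ.differentiable (by simp) x)
  simpa using h

/-- The conductivity, equal to `k` in `Ω` and to `1` outside. -/
def conductivity (Ω : Set E3) (k : ℝ) (x : E3) : ℝ :=
  1 + (k - 1) * Set.indicator Ω (fun _ => (1 : ℝ)) x

theorem measurable_conductivity {Ω : Set E3} (hop : IsOpen Ω) (k : ℝ) :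
    Measurable (conductivity Ω k) :=
  ((measurable_const.indicator hop.measurableSet).const_mul _).const_add _

theorem abs_conductivity_le (Ω : Set E3) (k : ℝ) (x : E3) :
    |conductivity Ω k x| ≤ 1 + |k - 1| := by
  refine (abs_add_le _ _).trans ?_
  rw [abs_one, abs_mul]
  gcongr
  refine mul_le_of_le_one_right (abs_nonneg _) ?_
  by_cases hx : x ∈ Ω <;> simp [hx]

theorem conductivity_of_notMem {Ω : Set E3} (k : ℝ) {x : E3} (hx : x ∉ Ω) :
    conductivity Ω k x = 1 := by
  simp [conductivity, hx]

namespace IsCondSol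

variable {Ω : Set E3} {k : ℝ} {a b : E3} {u : E3 → ℝ} {c : ℝ}

theorem integral_conductivity_mul (hu : IsCondSol 3 Ω k a u) {φ : E3 → ℝ}
    (hφ : ContDiff ℝ (⊤ : ℕ∞) φ) (hφc : HasCompactSupport φ) :
    ∫ x, conductivity Ω k x * ⟪gradient u x, gradient φ x⟫ = 0 :=
  hu.2.2.2.1 φ hφ hφc

/-- Subtracting the interior affine part of a solution leaves a function that is harmonic where it
does not vanish. -/
theorem harmonicOffZeros (hu : IsCondSol 3 Ω k a u) (hb : ∀ x ∈ Ω, u x = ⟪b, x⟫ + c) :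
    HarmonicOffZeros fun x => u x - (⟪b, x⟫ + c) := by
  have haff : Continuous fun x : E3 => ⟪b, x⟫ + c := by fun_prop
  have hcl : closure Ω ⊆ {x | u x = ⟪b, x⟫ + c} :=
    closure_minimal hb (isClosed_eq hu.1 haff)
  have hout : ∀ x, u x - (⟪b, x⟫ + c) ≠ 0 → x ∈ (closure Ω)ᶜ := fun x hx h =>
    hx (sub_eq_zero.2 (hcl h))
  have hsmooth : ∀ x, u x - (⟪b, x⟫ + c) ≠ 0 → ContDiffAt ℝ (⊤ : ℕ∞) u x := fun x hx =>
    hu.2.2.1.contDiffAt (isClosed_closure.isOpen_compl.mem_nhds (hout x hx))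
  refine ⟨hu.1.sub haff, fun x hx => (hsmooth x hx).sub
    ((contDiffAt_const.inner ℝ contDiffAt_id).add contDiffAt_const), fun φ hφ hφc hφs => ?_⟩
  have hpt : ∀ x, conductivity Ω k x * ⟪gradient u x, gradient φ x⟫ = ⟪b, gradient φ x⟫ +
      ⟪gradient (fun x => u x - (⟪b, x⟫ + c)) x, gradient φ x⟫ := fun x => by
    by_cases hx : x ∈ tsupport φ
    · have hp := hφs hx
      rw [gradient_sub_inner_add ((hsmooth x hp).differentiableAt (by simp)),
        conductivity_of_notMem k fun h => hout x hp (subset_closure h), one_mul, inner_sub_left]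
      ring
    · rw [gradient_eq_zero_of_notMem_tsupport hx]
      simp
  have h0 := hu.integral_conductivity_mul hφ hφc
  have hi : Integrable fun x => ⟪b, gradient φ x⟫ := by
    simpa using integrable_mul_inner_gradient (w := fun _ => 1) measurable_const (fun _ => le_rfl)
      (locallyIntegrable_const b) hφ hφc
  by_cases hint : Integrable fun x =>
      ⟪gradient (fun x => u x - (⟪b, x⟫ + c)) x, gradient φ x⟫
  · simp_rw [hpt] at h0
    rwa [integral_add hi hint, integral_inner_gradient_eq_zero hφ hφc, zero_add] at h0
  · exact integral_undef hint

theorem ae_differentiableAt (hu : IsCondSol 3 Ω k a u) (hb : ∀ x ∈ Ω, u x = ⟪b, x⟫ + c) :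
    ∀ᵐ x, DifferentiableAt ℝ u x := by
  filter_upwards [(hu.harmonicOffZeros hb).ae_differentiableAt] with x hx
  exact (hx.fun_add (hasGradientAt_inner_add b c x).differentiableAt).congr_of_eventuallyEq
    (Eventually.of_forall fun y => (sub_add_cancel _ _).symm)

theorem ae_gradient_eq (hu : IsCondSol 3 Ω k a u) (hb : ∀ x ∈ Ω, u x = ⟪b, x⟫ + c) :
    ∀ᵐ x, gradient (fun x => u x - (⟪b, x⟫ + c)) x = gradient u x - b := by
  filter_upwards [hu.ae_differentiableAt hb] with x hx
  exact gradient_sub_inner_add hx b c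

theorem locallyIntegrable_gradient (hu : IsCondSol 3 Ω k a u)
    (hb : ∀ x ∈ Ω, u x = ⟪b, x⟫ + c) : LocallyIntegrable (gradient u) := by
  refine ((hu.harmonicOffZeros hb).locallyIntegrable_gradient.add
    (locallyIntegrable_const b)).congr ?_
  filter_upwards [hu.ae_gradient_eq hb] with x hx
  rw [Pi.add_apply, hx, sub_add_cancel]

theorem integrable_conductivity_mul (hop : IsOpen Ω) (hu : IsCondSol 3 Ω k a u)
    (hb : ∀ x ∈ Ω, u x = ⟪b, x⟫ + c) {φ : E3 → ℝ} (hφ : ContDiff ℝ (⊤ : ℕ∞) φ)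
    (hφc : HasCompactSupport φ) :
    Integrable fun x => conductivity Ω k x * ⟪gradient u x, gradient φ x⟫ :=
  integrable_mul_inner_gradient (measurable_conductivity hop k) (abs_conductivity_le Ω k)
    (hu.locallyIntegrable_gradient hb) hφ hφc

theorem add_of_linear (hop : IsOpen Ω) {a' b' : E3} {u' : E3 → ℝ} {c' : ℝ}
    (hu : IsCondSol 3 Ω k a u) (hb : ∀ x ∈ Ω, u x = ⟪b, x⟫ + c) (hu' : IsCondSol 3 Ω k a' u')
    (hb' : ∀ x ∈ Ω, u' x = ⟪b', x⟫ + c') :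
    IsCondSol 3 Ω k (a + a') fun x => u x + u' x := by
  refine ⟨hu.1.add hu'.1, hu.2.1.add hu'.2.1, hu.2.2.1.add hu'.2.2.1, fun φ hφ hφc => ?_, ?_⟩
  · have h : ∀ᵐ x, conductivity Ω k x * ⟪gradient (fun x => u x + u' x) x, gradient φ x⟫ =
        conductivity Ω k x * ⟪gradient u x, gradient φ x⟫ +
          conductivity Ω k x * ⟪gradient u' x, gradient φ x⟫ := by
      filter_upwards [hu.ae_differentiableAt hb, hu'.ae_differentiableAt hb'] with x hx hx'
      rw [← mul_add, ← inner_add_left]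
      congr 2
      apply HasGradientAt.gradient
      rw [hasGradientAt_iff_hasFDerivAt, map_add]
      exact hx.hasGradientAt.hasFDerivAt.add hx'.hasGradientAt.hasFDerivAt
    refine (integral_congr_ae h).trans ?_
    rw [integral_add (hu.integrable_conductivity_mul hop hb hφ hφc)
      (hu'.integrable_conductivity_mul hop hb' hφ hφc), hu.integral_conductivity_mul hφ hφc,
      hu'.integral_conductivity_mul hφ hφc, add_zero]
  · obtain ⟨C, R, hC, hR, h⟩ := hu.2.2.2.2
    obtain ⟨C', R', hC', hR', h'⟩ := hu'.2.2.2.2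
    refine ⟨C + C', max R R', by positivity, by positivity, fun x hx => ?_⟩
    have h1 := h x ((le_max_left _ _).trans hx)
    have h2 := h' x ((le_max_right _ _).trans hx)
    have h3 : u x + u' x - ⟪a + a', x⟫ = (u x - ⟪a, x⟫) + (u' x - ⟪a', x⟫) := by
      rw [inner_add_left]
      ring
    rw [h3, add_mul]
    exact (abs_add_le _ _).trans (add_le_add h1 h2)

theorem const_mul_of_linear (hu : IsCondSol 3 Ω k a u) (hb : ∀ x ∈ Ω, u x = ⟪b, x⟫ + c) (t : ℝ) :
    IsCondSol 3 Ω k (t • a) fun x => t * u x := by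
  refine ⟨hu.1.const_mul t, contDiffOn_const.mul hu.2.1, contDiffOn_const.mul hu.2.2.1,
    fun φ hφ hφc => ?_, ?_⟩
  · have h : ∀ᵐ x, conductivity Ω k x * ⟪gradient (fun x => t * u x) x, gradient φ x⟫ =
        t * (conductivity Ω k x * ⟪gradient u x, gradient φ x⟫) := by
      filter_upwards [hu.ae_differentiableAt hb] with x hx
      rw [mul_left_comm, ← real_inner_smul_left (gradient u x)]
      congr 2
      apply HasGradientAt.gradient
      rw [hasGradientAt_iff_hasFDerivAt]
      refine (hx.hasGradientAt.hasFDerivAt.const_mul t).congr_fderiv ?_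
      simp
    refine (integral_congr_ae h).trans ?_
    rw [integral_const_mul, hu.integral_conductivity_mul hφ hφc, mul_zero]
  · obtain ⟨C, R, hC, hR, h⟩ := hu.2.2.2.2
    refine ⟨(|t| + 1) * C, R, by positivity, hR, fun x hx => ?_⟩
    rw [real_inner_smul_left, ← mul_sub, abs_mul, mul_assoc]
    exact mul_le_mul (by linarith) (h x hx) (abs_nonneg _) (by positivity)

theorem zero (Ω : Set E3) (k : ℝ) : IsCondSol 3 Ω k 0 fun _ => 0 :=
  ⟨continuous_const, contDiffOn_const, contDiffOn_const, fun φ _ _ => by simp,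
    1, 1, one_pos, one_pos, fun x _ => by simp⟩

/-- A solution that is constant in a nonempty inclusion has zero background field. -/
theorem background_eq_zero (hne : Ω.Nonempty) (hop : IsOpen Ω) (hu : IsCondSol 3 Ω k a u)
    (hc : ∀ x ∈ Ω, u x = c) : a = 0 := by
  have hb : ∀ x ∈ Ω, u x = ⟪(0 : E3), x⟫ + c := fun x hx => by
    rw [hc x hx, inner_zero_left, zero_add]
  have hp := hu.harmonicOffZeros hb
  have hw : ∀ x r, 0 < r →
      ∫ y, ⟪gradient (fun x => u x - (⟪(0 : E3), x⟫ + c)) y, gradient (scaledBump x r) y⟫ = 0 :=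
    fun x r hr => by
      rw [← hu.integral_conductivity_mul (contDiff_scaledBump x r)
        (hasCompactSupport_scaledBump x hr)]
      refine integral_congr_ae ?_
      filter_upwards [hu.ae_gradient_eq hb] with y hy
      rw [hy, sub_zero]
      by_cases hyΩ : y ∈ Ω
      · have h : u =ᶠ[𝓝 y] fun _ => c := Filter.mem_of_superset (hop.mem_nhds hyΩ) hc
        rw [h.gradient_eq, gradient_fun_const, inner_zero_left, mul_zero]
      · rw [conductivity_of_notMem k hyΩ, one_mul]
  have hlim : Tendsto (fun y => u y - (⟪(0 : E3), y⟫ + c) - (⟪a, y⟫ + -c)) (cocompact E3)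
      (𝓝 0) := by
    obtain ⟨C, R, hC, hR, h⟩ := hu.2.2.2.2
    have hn : Tendsto (fun y : E3 => ‖y‖) (cocompact E3) atTop := tendsto_norm_cocompact_atTop
    refine squeeze_zero_norm' (a := fun y => C * ‖y‖ ^ (1 - (3 : ℤ))) ?_ ?_
    · filter_upwards [hn.eventually_ge_atTop R] with y hy
      refine le_of_eq_of_le ?_ (h y hy)
      rw [Real.norm_eq_abs, inner_zero_left]
      congr 1
      ring
    · simpa using ((tendsto_zpow_atTop_zero (by norm_num : (1 - (3 : ℤ)) < 0)).comp hn).const_mul C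
  have haff := hp.eq_affine_of_tendsto hw hlim
  obtain ⟨x₀, hx₀⟩ := hne
  have h1 : (fun y : E3 => ⟪a, y⟫ + -c) =ᶠ[𝓝 x₀] fun _ => 0 := by
    filter_upwards [hop.mem_nhds hx₀] with y hy
    rw [← haff y, hb y hy, sub_self]
  rw [← (hasGradientAt_inner_add a (-c) x₀).gradient, h1.gradient_eq, gradient_fun_const]

end IsCondSol

/-- The pairs of a background field and an interior gradient realised by a solution that is linear
in `Ω`. -/
def linearSolutionPairs (Ω : Set E3) (hop : IsOpen Ω) (k : ℝ) : Submodule ℝ (E3 × E3) where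
  carrier := {q | ∃ (u : E3 → ℝ) (c : ℝ), IsCondSol 3 Ω k q.1 u ∧ ∀ x ∈ Ω, u x = ⟪q.2, x⟫ + c}
  add_mem' := by
    rintro _ _ ⟨u, c, hu, hb⟩ ⟨u', c', hu', hb'⟩
    refine ⟨fun x => u x + u' x, c + c', hu.add_of_linear hop hb hu' hb', fun x hx => ?_⟩
    simp only [hb x hx, hb' x hx, Prod.snd_add, inner_add_left]
    ring
  zero_mem' := ⟨fun _ => 0, 0, IsCondSol.zero Ω k, fun x _ => by simp⟩
  smul_mem' := by
    rintro t _ ⟨u, c, hu, hb⟩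
    refine ⟨fun x => t * u x, t * c, hu.const_mul_of_linear hb t, fun x hx => ?_⟩
    simp only [hb x hx, Prod.smul_snd, real_inner_smul_left]
    ring

theorem mem_linearSolutionPairs {Ω : Set E3} {hop : IsOpen Ω} {k : ℝ} {a b : E3} :
    (a, b) ∈ linearSolutionPairs Ω hop k ↔
      ∃ (u : E3 → ℝ) (c : ℝ), IsCondSol 3 Ω k a u ∧ ∀ x ∈ Ω, u x = ⟪b, x⟫ + c := Iff.rfl

theorem fst_eq_zero_of_mem_linearSolutionPairs {Ω : Set E3} (hne : Ω.Nonempty) {hop : IsOpen Ω}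
    {k : ℝ} {a : E3} (h : (a, 0) ∈ linearSolutionPairs Ω hop k) : a = 0 := by
  obtain ⟨u, c, hu, hb⟩ := mem_linearSolutionPairs.1 h
  exact hu.background_eq_zero hne hop (c := c) fun x hx => by
    rw [hb x hx, inner_zero_left, zero_add]

/-- A total linear relation on a finite-dimensional space with trivial kernel is surjective. -/
theorem exists_mem_of_total_of_injective {V : Type*} [AddCommGroup V] [Module ℝ V]
    [FiniteDimensional ℝ V] (S : Submodule ℝ (V × V)) (htot : ∀ a, ∃ b, (a, b) ∈ S)
    (hinj : ∀ a, (a, 0) ∈ S → a = 0) (b : V) : ∃ a, (a, b) ∈ S := by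
  set f : S →ₗ[ℝ] V := LinearMap.fst ℝ V V ∘ₗ S.subtype
  set g : S →ₗ[ℝ] V := LinearMap.snd ℝ V V ∘ₗ S.subtype
  have hf : Function.Surjective f := fun a => by
    obtain ⟨b, hab⟩ := htot a
    exact ⟨⟨(a, b), hab⟩, rfl⟩
  have hg : Function.Injective g := by
    refine (injective_iff_map_eq_zero g).2 ?_
    rintro ⟨⟨a, b⟩, hab⟩ (rfl : b = 0)
    obtain rfl := hinj a hab
    rfl
  have hrank := le_antisymm (LinearMap.finrank_le_finrank_of_injective hg)
    (LinearMap.finrank_le_finrank_of_surjective hf)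
  obtain ⟨⟨⟨a, b'⟩, hab⟩, rfl : b' = b⟩ :=
    (LinearMap.injective_iff_surjective_of_finrank_eq_finrank hrank).1 hg b
  exact ⟨a, hab⟩

end

/-- If the solution is linear in `Ω` for every background field, then the map `Λ` from
background fields to interior gradients is a linear bijection of `ℝ³`: it is injective
(the interior gradient determines the background field) and surjective (every interior
gradient `b` is attained by some background field). -/
theorem background_to_gradient_bijective (Ω : Set (Euc 3))
    (hne : Ω.Nonempty) (hbd : Bornology.IsBounded Ω) (hop : IsOpen Ω)
    (k : ℝ) (hk : 0 < k) (hk1 : k ≠ 1)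
    (hall : ∀ a : Euc 3, ∃ u : Euc 3 → ℝ, IsCondSol 3 Ω k a u ∧ IsLinIn 3 Ω u) :
    (∀ (a a' : Euc 3) (u u' : Euc 3 → ℝ) (b : Euc 3) (c c' : ℝ),
        IsCondSol 3 Ω k a u → IsCondSol 3 Ω k a' u' →
        (∀ x ∈ Ω, u x = ⟪b, x⟫ + c) → (∀ x ∈ Ω, u' x = ⟪b, x⟫ + c') → a = a') ∧
    (∀ b : Euc 3, ∃ (a : Euc 3) (u : Euc 3 → ℝ) (c : ℝ),
        IsCondSol 3 Ω k a u ∧ ∀ x ∈ Ω, u x = ⟪b, x⟫ + c) := by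
  refine ⟨fun a a' u u' b c c' hu hu' hb hb' => ?_, fun b => ?_⟩
  · have h : (a, b) ∈ linearSolutionPairs Ω hop k := ⟨u, c, hu, hb⟩
    have h' : (a', b) ∈ linearSolutionPairs Ω hop k := ⟨u', c', hu', hb'⟩
    have hsub := sub_mem h h'
    rw [Prod.mk_sub_mk, sub_self] at hsub
    exact sub_eq_zero.1 (fst_eq_zero_of_mem_linearSolutionPairs hne hsub)
  · refine exists_mem_of_total_of_injective (linearSolutionPairs Ω hop k) (fun a => ?_)
      (fun a => fst_eq_zero_of_mem_linearSolutionPairs hne) b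
    obtain ⟨u, hu, b, c, hb⟩ := hall a
    exact ⟨b, u, c, hu, hb⟩
end
end

section
/- Let Ω ⊂ ℝ³ be a nonempty bounded open set and let k₀ > 0 with k₀ ≠ 1. If for each j = 1,2,3 there exists a solution of the conductivity inclusion problem with contrast k₀ and background field e_j (the j-th standard basis vector) that is linear in Ω, then for every k > 0 with k ≠ 1 and every a ∈ ℝ³ there exists a solution of the conductivity inclusion problem with contrast k and background field a that is linear in Ω. -/
open MeasureTheory
open scoped RealInnerProductSpace

noncomputable section

open Filter Topology Set Metric
open scoped ContDiff Gradient

/-- A smooth odd function vanishing near `0` and equal to the identity away from `0`. -/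
def cutoffId (s : ℝ) : ℝ := s * Real.smoothTransition (s ^ 2 - 1)

theorem contDiff_cutoffId : ContDiff ℝ ∞ cutoffId :=
  contDiff_id.mul (Real.smoothTransition.contDiff.comp (by fun_prop))

theorem cutoffId_eq_zero {s : ℝ} (hs : |s| ≤ 1) : cutoffId s = 0 := by
  have : s ^ 2 ≤ 1 := (sq_le_one_iff_abs_le_one s).2 hs
  simp [cutoffId, Real.smoothTransition.zero_of_nonpos (by linarith : s ^ 2 - 1 ≤ 0)]

theorem cutoffId_eq_self {s : ℝ} (hs : 2 ≤ |s|) : cutoffId s = s := by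
  have : 2 ≤ s ^ 2 := by nlinarith [sq_abs s]
  simp [cutoffId, Real.smoothTransition.one_of_one_le (by linarith : 1 ≤ s ^ 2 - 1)]

theorem smoothTransition_deriv_nonneg (s : ℝ) : 0 ≤ deriv Real.smoothTransition s :=
  Real.smoothTransition.monotone.deriv_nonneg

theorem deriv_cutoffId (s : ℝ) : deriv cutoffId s =
    Real.smoothTransition (s ^ 2 - 1) + 2 * s ^ 2 * deriv Real.smoothTransition (s ^ 2 - 1) := by
  have h1 : HasDerivAt Real.smoothTransition (deriv Real.smoothTransition (s ^ 2 - 1))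
      (s ^ 2 - 1) :=
    ((Real.smoothTransition.contDiff (n := 1)).differentiable (by simp) _).hasDerivAt
  have h2 : HasDerivAt (fun s : ℝ => s ^ 2 - 1) (2 * s) s := by
    simpa using (hasDerivAt_pow 2 s).sub_const 1
  have h3 := (hasDerivAt_id s).mul (h1.comp s h2)
  have h4 : deriv cutoffId s = _ := h3.deriv
  rw [h4]
  simp
  ring

theorem smoothTransition_le_deriv_cutoffId (s : ℝ) :
    Real.smoothTransition (s ^ 2 - 1) ≤ deriv cutoffId s := by
  rw [deriv_cutoffId]
  have := smoothTransition_deriv_nonneg (s ^ 2 - 1)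
  nlinarith [mul_nonneg (sq_nonneg s) this]

theorem deriv_cutoffId_nonneg (s : ℝ) : 0 ≤ deriv cutoffId s :=
  (Real.smoothTransition.nonneg _).trans (smoothTransition_le_deriv_cutoffId s)

theorem cutoffId_sq_le (s : ℝ) : cutoffId s ^ 2 ≤ s ^ 2 * deriv cutoffId s := by
  have h0 := Real.smoothTransition.nonneg (s ^ 2 - 1)
  have h1 := Real.smoothTransition.le_one (s ^ 2 - 1)
  have h2 := smoothTransition_le_deriv_cutoffId s
  rw [cutoffId, mul_pow]
  refine mul_le_mul_of_nonneg_left ?_ (sq_nonneg s)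
  nlinarith

theorem abs_cutoffId_le (s : ℝ) : |cutoffId s| ≤ |s| := by
  rw [cutoffId, abs_mul, abs_of_nonneg (Real.smoothTransition.nonneg _)]
  exact mul_le_of_le_one_right (abs_nonneg s) (Real.smoothTransition.le_one _)

theorem deriv_cutoffId_eq_one {s : ℝ} (hs : 2 < |s|) : deriv cutoffId s = 1 := by
  have : cutoffId =ᶠ[𝓝 s] id := by
    filter_upwards [continuous_abs.continuousAt.eventually_const_lt hs] with t ht
    exact cutoffId_eq_self ht.le
  rw [this.deriv_eq, deriv_id]

theorem exists_deriv_cutoffId_le : ∃ C, ∀ s, deriv cutoffId s ≤ C := by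
  have hc : Continuous (deriv cutoffId) := contDiff_cutoffId.continuous_deriv (by simp)
  obtain ⟨C, hC⟩ := (isCompact_Icc (a := (-2 : ℝ)) (b := 2)).exists_bound_of_continuousOn
    hc.continuousOn
  refine ⟨max C 1, fun s => ?_⟩
  by_cases hs : |s| ≤ 2
  · exact (le_abs_self _).trans ((hC s (abs_le.1 hs)).trans (le_max_left _ _))
  · rw [deriv_cutoffId_eq_one (not_le.1 hs)]
    exact le_max_right _ _

/-- Smooth functions vanishing near `0` which approximate the identity as `n → ∞`. -/
def truncate (n : ℕ) (s : ℝ) : ℝ := ((n : ℝ) + 1)⁻¹ * cutoffId (((n : ℝ) + 1) * s)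

theorem contDiff_truncate (n : ℕ) : ContDiff ℝ ∞ (truncate n) :=
  contDiff_const.mul (contDiff_cutoffId.comp (contDiff_const.mul contDiff_id))

theorem truncate_eq_zero {n : ℕ} {s : ℝ} (hs : |s| ≤ ((n : ℝ) + 1)⁻¹) : truncate n s = 0 := by
  have hn : (0 : ℝ) < n + 1 := by positivity
  rw [truncate, cutoffId_eq_zero, mul_zero]
  rw [abs_mul, abs_of_pos hn]
  calc (n + 1 : ℝ) * |s| ≤ (n + 1) * ((n : ℝ) + 1)⁻¹ := by gcongr
    _ = 1 := by field_simp

theorem truncate_eventually_zero (n : ℕ) : ∀ᶠ s in 𝓝 (0 : ℝ), truncate n s = 0 := by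
  have hn : (0 : ℝ) < ((n : ℝ) + 1)⁻¹ := by positivity
  filter_upwards [Metric.closedBall_mem_nhds (0 : ℝ) hn] with s hs
  exact truncate_eq_zero (by simpa using hs)

theorem deriv_truncate (n : ℕ) (s : ℝ) :
    deriv (truncate n) s = deriv cutoffId (((n : ℝ) + 1) * s) := by
  have hn : (n : ℝ) + 1 ≠ 0 := by positivity
  have h1 : HasDerivAt cutoffId _ (((n : ℝ) + 1) * s) :=
    (contDiff_cutoffId.differentiable (by simp) _).hasDerivAt
  have h2 : HasDerivAt (fun s : ℝ => ((n : ℝ) + 1) * s) ((n : ℝ) + 1) s := by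
    simpa using (hasDerivAt_id s).const_mul ((n : ℝ) + 1)
  have h3 := (h1.comp s h2).const_mul ((n : ℝ) + 1)⁻¹
  have h4 : deriv (truncate n) s = _ := h3.deriv
  rw [h4]
  field_simp

theorem deriv_truncate_eventually_zero (n : ℕ) :
    ∀ᶠ s in 𝓝 (0 : ℝ), deriv (truncate n) s = 0 := by
  have := (truncate_eventually_zero n).eventually_nhds
  filter_upwards [this] with s hs
  have : truncate n =ᶠ[𝓝 s] fun _ => 0 := hs
  rw [this.deriv_eq]; simp

theorem deriv_truncate_nonneg (n : ℕ) (s : ℝ) : 0 ≤ deriv (truncate n) s := by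
  rw [deriv_truncate]; exact deriv_cutoffId_nonneg _

theorem exists_deriv_truncate_le : ∃ C, 0 < C ∧ ∀ n s, deriv (truncate n) s ≤ C := by
  obtain ⟨C, hC⟩ := exists_deriv_cutoffId_le
  refine ⟨max C 1, by positivity, fun n s => ?_⟩
  rw [deriv_truncate]
  exact (hC _).trans (le_max_left _ _)

theorem truncate_sq_le (n : ℕ) (s : ℝ) : truncate n s ^ 2 ≤ s ^ 2 * deriv (truncate n) s := by
  have hn : (0 : ℝ) < n + 1 := by positivity
  rw [deriv_truncate, truncate, mul_pow, inv_pow, inv_mul_le_iff₀ (by positivity)]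
  calc _ ≤ _ := cutoffId_sq_le _
    _ = _ := by ring

theorem abs_truncate_le (n : ℕ) (s : ℝ) : |truncate n s| ≤ |s| := by
  have hn : (0 : ℝ) < n + 1 := by positivity
  rw [truncate, abs_mul, abs_of_pos (inv_pos.2 hn), inv_mul_le_iff₀ hn]
  calc _ ≤ _ := abs_cutoffId_le _
    _ = _ := by rw [abs_mul, abs_of_pos hn]

theorem eventually_two_lt_mul_abs {s : ℝ} (hs : s ≠ 0) :
    ∀ᶠ n : ℕ in atTop, 2 < |((n : ℝ) + 1) * s| := by
  have h1 : Tendsto (fun n : ℕ => ((n : ℝ) + 1) * |s|) atTop atTop :=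
    (tendsto_natCast_atTop_atTop.atTop_add tendsto_const_nhds).atTop_mul_const (abs_pos.2 hs)
  filter_upwards [h1.eventually_gt_atTop 2] with n hn
  rwa [abs_mul, abs_of_pos (by positivity : (0 : ℝ) < n + 1)]

theorem eventually_truncate_eq_self (s : ℝ) : ∀ᶠ n : ℕ in atTop, truncate n s = s := by
  rcases eq_or_ne s 0 with rfl | hs
  · exact Eventually.of_forall fun n => truncate_eq_zero (by simp; positivity)
  · filter_upwards [eventually_two_lt_mul_abs hs] with n hn
    have hn' : (n : ℝ) + 1 ≠ 0 := by positivity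
    rw [truncate, cutoffId_eq_self hn.le]
    field_simp

theorem eventually_deriv_truncate_eq_one {s : ℝ} (hs : s ≠ 0) :
    ∀ᶠ n : ℕ in atTop, deriv (truncate n) s = 1 := by
  filter_upwards [eventually_two_lt_mul_abs hs] with n hn
  rw [deriv_truncate, deriv_cutoffId_eq_one hn]

/-- A primitive of `truncate n`, approximating `s ^ 2 / 2`. -/
def truncatePrimitive (n : ℕ) (s : ℝ) : ℝ := ∫ t in (0 : ℝ)..s, truncate n t

theorem hasDerivAt_truncatePrimitive (n : ℕ) (s : ℝ) :
    HasDerivAt (truncatePrimitive n) (truncate n s) s :=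
  intervalIntegral.integral_hasDerivAt_right
    ((contDiff_truncate n).continuous.intervalIntegrable _ _)
    (contDiff_truncate n).continuous.stronglyMeasurable.stronglyMeasurableAtFilter
    (contDiff_truncate n).continuous.continuousAt

theorem deriv_truncatePrimitive (n : ℕ) : deriv (truncatePrimitive n) = truncate n :=
  funext fun s => (hasDerivAt_truncatePrimitive n s).deriv

theorem contDiff_truncatePrimitive (n : ℕ) : ContDiff ℝ ∞ (truncatePrimitive n) := by
  rw [contDiff_infty_iff_deriv, deriv_truncatePrimitive]
  exact ⟨fun s => (hasDerivAt_truncatePrimitive n s).differentiableAt, contDiff_truncate n⟩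

theorem truncatePrimitive_eventually_zero (n : ℕ) :
    ∀ᶠ s in 𝓝 (0 : ℝ), truncatePrimitive n s = 0 := by
  have hn : (0 : ℝ) < ((n : ℝ) + 1)⁻¹ := by positivity
  filter_upwards [Metric.closedBall_mem_nhds (0 : ℝ) hn] with s hs
  rw [truncatePrimitive]
  refine intervalIntegral.integral_zero_ae (Eventually.of_forall fun t ht => ?_)
  refine truncate_eq_zero ?_
  have hs' : |s| ≤ ((n : ℝ) + 1)⁻¹ := by simpa using hs
  have := abs_sub_left_of_mem_uIcc (uIoc_subset_uIcc ht)
  simp only [sub_zero] at this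
  exact this.trans hs'

theorem abs_truncatePrimitive_sub_le (n : ℕ) (s : ℝ) :
    |truncatePrimitive n s - s ^ 2 / 2| ≤ 2 * ((n : ℝ) + 1)⁻¹ * |s| := by
  have hn : (0 : ℝ) < n + 1 := by positivity
  have h1 : s ^ 2 / 2 = ∫ t in (0 : ℝ)..s, t := by simp
  rw [truncatePrimitive, h1, ← intervalIntegral.integral_sub
    ((contDiff_truncate n).continuous.intervalIntegrable _ _)
    (continuous_id'.intervalIntegrable _ _), ← Real.norm_eq_abs]
  refine (intervalIntegral.norm_integral_le_of_norm_le_const (C := 2 * ((n : ℝ) + 1)⁻¹)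
    fun t _ => ?_).trans_eq (by simp)
  have h0 := Real.smoothTransition.nonneg ((((n : ℝ) + 1) * t) ^ 2 - 1)
  have h1 := Real.smoothTransition.le_one ((((n : ℝ) + 1) * t) ^ 2 - 1)
  by_cases ht : 2 ≤ |((n : ℝ) + 1) * t|
  · rw [truncate, cutoffId_eq_self ht, inv_mul_cancel_left₀ hn.ne', sub_self, norm_zero]
    positivity
  · have h2 : |t| ≤ 2 * ((n : ℝ) + 1)⁻¹ := by
      rw [not_le, abs_mul, abs_of_pos hn] at ht
      rw [← div_eq_mul_inv, le_div_iff₀ hn]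
      linarith
    have h3 : truncate n t - t =
        t * (Real.smoothTransition ((((n : ℝ) + 1) * t) ^ 2 - 1) - 1) := by
      rw [truncate, cutoffId]; field_simp
    rw [h3, Real.norm_eq_abs, abs_mul]
    refine (mul_le_of_le_one_right (abs_nonneg t) ?_).trans h2
    rw [abs_le]; constructor <;> linarith

section Gradient

variable {d : ℕ}

theorem HasGradientAt.add_grad {f g : Euc d → ℝ} {f' g' x : Euc d} (hf : HasGradientAt f f' x)
    (hg : HasGradientAt g g' x) : HasGradientAt (fun y => f y + g y) (f' + g') x := by
  rw [hasGradientAt_iff_hasFDerivAt, map_add]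
  exact hf.hasFDerivAt.add hg.hasFDerivAt

theorem HasGradientAt.const_mul_grad {f : Euc d → ℝ} {f' x : Euc d} (hf : HasGradientAt f f' x)
    (c : ℝ) : HasGradientAt (fun y => c * f y) (c • f') x := by
  rw [hasGradientAt_iff_hasFDerivAt, map_smul]
  exact hf.hasFDerivAt.const_mul c

theorem HasGradientAt.mul_grad {f g : Euc d → ℝ} {f' g' x : Euc d} (hf : HasGradientAt f f' x)
    (hg : HasGradientAt g g' x) :
    HasGradientAt (fun y => f y * g y) (f x • g' + g x • f') x := by
  rw [hasGradientAt_iff_hasFDerivAt, map_add, map_smul, map_smul]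
  exact hf.hasFDerivAt.mul hg.hasFDerivAt

theorem HasDerivAt.comp_hasGradientAt {g : ℝ → ℝ} {g' : ℝ} {f : Euc d → ℝ} {f' x : Euc d}
    (hg : HasDerivAt g g' (f x)) (hf : HasGradientAt f f' x) :
    HasGradientAt (fun y => g (f y)) (g' • f') x := by
  rw [hasGradientAt_iff_hasFDerivAt, map_smul]
  exact hg.comp_hasFDerivAt x hf.hasFDerivAt

theorem hasGradientAt_inner_add_const (p : Euc d) (c : ℝ) (x : Euc d) :
    HasGradientAt (fun y => ⟪p, y⟫ + c) p x := by
  rw [hasGradientAt_iff_hasFDerivAt]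
  exact ((InnerProductSpace.toDual ℝ (Euc d) p).hasFDerivAt (x := x)).add_const c

theorem ContDiffAt.hasGradientAt_grad {f : Euc d → ℝ} {x : Euc d} (hf : ContDiffAt ℝ ∞ f x) :
    HasGradientAt f (∇ f x) x :=
  (hf.differentiableAt (by simp)).hasGradientAt

theorem ContDiffAt.continuousAt_gradient {f : Euc d → ℝ} {x : Euc d}
    (hf : ContDiffAt ℝ ∞ f x) : ContinuousAt (∇ f) x := by
  have h : ContinuousAt (fderiv ℝ f) x := (hf.fderiv_right (m := 0) (by simp)).continuousAt
  exact (LinearIsometryEquiv.continuous _).continuousAt.comp h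

theorem ContDiff.continuous_gradient {f : Euc d → ℝ} (hf : ContDiff ℝ ∞ f) :
    Continuous (∇ f) :=
  continuous_iff_continuousAt.2 fun _ => hf.contDiffAt.continuousAt_gradient

theorem measurable_gradient_s9 (f : Euc d → ℝ) : Measurable (∇ f) :=
  (LinearIsometryEquiv.continuous _).measurable.comp (measurable_fderiv ℝ f)

theorem gradient_eq_zero_of_notMem_tsupport_s9 {f : Euc d → ℝ} {x : Euc d} (hx : x ∉ tsupport f) :
    ∇ f x = 0 := by
  rw [notMem_tsupport_iff_eventuallyEq] at hx
  rw [hx.gradient_eq]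
  exact gradient_const x 0

theorem HasCompactSupport.gradient {f : Euc d → ℝ} (hf : HasCompactSupport f) :
    HasCompactSupport (∇ f) :=
  hf.mono' fun x hx => by
    by_contra h
    exact hx (gradient_eq_zero_of_notMem_tsupport_s9 h)

theorem integral_inner_gradient_eq_zero_s9 {φ : Euc d → ℝ} (hφ : ContDiff ℝ ∞ φ)
    (hc : HasCompactSupport φ) (p : Euc d) : ∫ x, ⟪p, ∇ φ x⟫ = 0 := by
  have h1 : ∀ x, ⟪p, ∇ φ x⟫ = fderiv ℝ φ x p := fun x => by
    rw [real_inner_comm]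
    exact InnerProductSpace.toDual_symm_apply
  have hi : Integrable fun x => ⟪p, ∇ φ x⟫ :=
    (continuous_const.inner hφ.continuous_gradient).integrable_of_hasCompactSupport
      (hc.gradient.mono fun x hx => by
        rw [Function.mem_support] at hx ⊢
        contrapose! hx; simp [hx])
  simp_rw [h1] at hi ⊢
  have := integral_mul_fderiv_eq_neg_fderiv_mul_of_integrable (μ := (volume : Measure (Euc d)))
    (f := fun _ => (1 : ℝ)) (g := φ) (v := p) (by simp) (by simpa using hi)
    (by simpa using hφ.continuous.integrable_of_hasCompactSupport hc)
    (fun x _ => by fun_prop) (fun x _ => hφ.differentiable (by simp) x)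
  simpa using this

end Gradient

section WeaklyHarmonic

variable {d : ℕ}

/-- A continuous function vanishing on `Z` which is smooth and weakly harmonic off `Z`. -/
structure IsWeaklyHarmonicOff (Z : Set (Euc d)) (w : Euc d → ℝ) : Prop where
  continuous : Continuous w
  eq_zero : ∀ x ∈ Z, w x = 0
  contDiffAt : ∀ x ∉ Z, ContDiffAt ℝ ∞ w x
  weak : ∀ φ : Euc d → ℝ, ContDiff ℝ ∞ φ → HasCompactSupport φ → tsupport φ ⊆ Zᶜ →
    ∫ x, ⟪∇ w x, ∇ φ x⟫ = 0

namespace IsWeaklyHarmonicOff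

variable {Z : Set (Euc d)} {w : Euc d → ℝ} (hw : IsWeaklyHarmonicOff Z w)
include hw

theorem notMem {x : Euc d} (hx : w x ≠ 0) : x ∉ Z := fun h => hx (hw.eq_zero x h)

theorem eventually_comp {g : ℝ → ℝ} (h0 : ∀ᶠ s in 𝓝 (0 : ℝ), g s = 0) {x : Euc d}
    (hx : w x = 0) : (fun y => g (w y)) =ᶠ[𝓝 x] 0 := by
  have : Tendsto w (𝓝 x) (𝓝 0) := hx ▸ hw.continuous.continuousAt
  exact this.eventually h0

theorem contDiff_comp {g : ℝ → ℝ} (hg : ContDiff ℝ ∞ g) (h0 : ∀ᶠ s in 𝓝 (0 : ℝ), g s = 0) :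
    ContDiff ℝ ∞ fun x => g (w x) := by
  rw [contDiff_iff_contDiffAt]
  intro x
  by_cases hx : w x = 0
  · exact contDiffAt_const.congr_of_eventuallyEq (hw.eventually_comp h0 hx)
  · exact hg.contDiffAt.comp x (hw.contDiffAt x (hw.notMem hx))

theorem gradient_comp {g : ℝ → ℝ} (hg : ContDiff ℝ ∞ g) (h0 : ∀ᶠ s in 𝓝 (0 : ℝ), g s = 0)
    (x : Euc d) : ∇ (fun y => g (w y)) x = deriv g (w x) • ∇ w x := by
  by_cases hx : w x = 0
  · have h1 : deriv g 0 = 0 := by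
      have : g =ᶠ[𝓝 0] fun _ => 0 := h0
      rw [this.deriv_eq]; simp
    rw [(hw.eventually_comp h0 hx).gradient_eq, hx, h1, zero_smul]
    exact gradient_const x 0
  · exact ((hg.differentiable (by simp) _).hasDerivAt.comp_hasGradientAt
      (hw.contDiffAt x (hw.notMem hx)).hasGradientAt_grad).gradient

theorem continuous_comp_smul {F : Type*} [NormedAddCommGroup F] [NormedSpace ℝ F] {g : ℝ → ℝ}
    (hg : Continuous g) (h0 : ∀ᶠ s in 𝓝 (0 : ℝ), g s = 0) {ψ : Euc d → F}
    (hψ : ∀ x, w x ≠ 0 → ContinuousAt ψ x) : Continuous fun x => g (w x) • ψ x := by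
  rw [continuous_iff_continuousAt]
  intro x
  by_cases hx : w x = 0
  · have : (fun y => g (w y) • ψ y) =ᶠ[𝓝 x] fun _ => 0 := by
      filter_upwards [hw.eventually_comp h0 hx] with y hy
      simp only [Pi.zero_apply] at hy
      simp [hy]
    exact continuousAt_const.congr this.symm
  · exact (hg.comp hw.continuous).continuousAt.smul (hψ x hx)

theorem continuousAt_gradient {x : Euc d} (hx : w x ≠ 0) : ContinuousAt (∇ w) x :=
  (hw.contDiffAt x (hw.notMem hx)).continuousAt_gradient

theorem tsupport_mul_comp_subset {g : ℝ → ℝ} (h0 : ∀ᶠ s in 𝓝 (0 : ℝ), g s = 0)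
    (ζ : Euc d → ℝ) : tsupport (fun x => ζ x * g (w x)) ⊆ Zᶜ := by
  intro x hx hxZ
  rw [← not_not (a := x ∈ tsupport _), notMem_tsupport_iff_eventuallyEq] at hx
  refine hx ?_
  filter_upwards [hw.eventually_comp h0 (hw.eq_zero x hxZ)] with y hy
  simp only [Pi.zero_apply] at hy
  simp [hy]

end IsWeaklyHarmonicOff

end WeaklyHarmonic

section Energy

variable {d : ℕ}

namespace IsWeaklyHarmonicOff

variable {Z : Set (Euc d)} {w : Euc d → ℝ} (hw : IsWeaklyHarmonicOff Z w)
include hw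

theorem integrable_mul_deriv_truncate (n : ℕ) {ζ : Euc d → ℝ} (hζ : Continuous ζ)
    (hc : HasCompactSupport ζ) :
    Integrable fun x => ζ x * (deriv (truncate n) (w x) * ‖∇ w x‖ ^ 2) := by
  have h1 : Continuous fun x => deriv (truncate n) (w x) • ‖∇ w x‖ ^ 2 :=
    hw.continuous_comp_smul ((contDiff_truncate n).continuous_deriv (by simp))
      (deriv_truncate_eventually_zero n) fun x hx => ((hw.continuousAt_gradient hx).norm).pow 2
  exact (hζ.mul h1).integrable_of_hasCompactSupport hc.mul_right

theorem integrable_truncate_mul_inner (n : ℕ) {V : Euc d → Euc d} (hV : Continuous V)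
    (hc : HasCompactSupport V) :
    Integrable fun x => truncate n (w x) * ⟪∇ w x, V x⟫ := by
  have h1 : Continuous fun x => truncate n (w x) • ⟪∇ w x, V x⟫ :=
    hw.continuous_comp_smul (contDiff_truncate n).continuous
      (truncate_eventually_zero n) fun x hx => (hw.continuousAt_gradient hx).inner hV.continuousAt
  refine h1.integrable_of_hasCompactSupport (hc.mono fun x hx => ?_)
  rw [Function.mem_support] at hx ⊢
  contrapose! hx
  simp [hx]

theorem gradient_mul_truncate (n : ℕ) {ζ : Euc d → ℝ} (hζ : ContDiff ℝ ∞ ζ) (x : Euc d) :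
    ∇ (fun y => ζ y * truncate n (w y)) x =
      ζ x • deriv (truncate n) (w x) • ∇ w x + truncate n (w x) • ∇ ζ x := by
  rw [← hw.gradient_comp (contDiff_truncate n) (truncate_eventually_zero n)]
  exact (hζ.contDiffAt.hasGradientAt_grad.mul_grad (hw.contDiff_comp (contDiff_truncate n)
    (truncate_eventually_zero n)).contDiffAt.hasGradientAt_grad).gradient

theorem integral_mul_deriv_truncate (n : ℕ) {ζ : Euc d → ℝ} (hζ : ContDiff ℝ ∞ ζ)
    (hc : HasCompactSupport ζ) :
    ∫ x, ζ x * (deriv (truncate n) (w x) * ‖∇ w x‖ ^ 2) =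
      -∫ x, truncate n (w x) * ⟪∇ w x, ∇ ζ x⟫ := by
  have h := hw.weak (fun x => ζ x * truncate n (w x))
    (hζ.mul (hw.contDiff_comp (contDiff_truncate n) (truncate_eventually_zero n)))
    hc.mul_right (hw.tsupport_mul_comp_subset (truncate_eventually_zero n) ζ)
  have h2 : ∀ x, ⟪∇ w x, ∇ (fun y => ζ y * truncate n (w y)) x⟫ =
      ζ x * (deriv (truncate n) (w x) * ‖∇ w x‖ ^ 2) + truncate n (w x) * ⟪∇ w x, ∇ ζ x⟫ := by
    intro x
    rw [hw.gradient_mul_truncate n hζ, inner_add_right, inner_smul_right, inner_smul_right,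
      inner_smul_right, real_inner_self_eq_norm_sq]
  simp_rw [h2] at h
  rw [integral_add (hw.integrable_mul_deriv_truncate n hζ.continuous hc)
    (hw.integrable_truncate_mul_inner n hζ.continuous_gradient hc.gradient)] at h
  linarith

/-- The Caccioppoli inequality for truncations of `w`. -/
theorem caccioppoli_truncate (n : ℕ) {η : Euc d → ℝ} (hη : ContDiff ℝ ∞ η)
    (hc : HasCompactSupport η) :
    ∫ x, η x ^ 2 * (deriv (truncate n) (w x) * ‖∇ w x‖ ^ 2) ≤
      4 * ∫ x, w x ^ 2 * ‖∇ η x‖ ^ 2 := by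
  have hsq : ∀ x, ∇ (fun y => η y ^ 2) x = (2 * η x) • ∇ η x := fun x => by
    have := (hη.contDiffAt (x := x)).hasGradientAt_grad
    have h2 := (this.mul_grad this).gradient
    simp_rw [← sq] at h2
    rw [h2, ← add_smul]; congr 1; ring
  have hc2 : HasCompactSupport fun x => η x ^ 2 :=
    hc.mono fun x hx => by
      rw [Function.mem_support] at hx ⊢
      contrapose! hx
      simp [hx]
  have h1 := hw.integral_mul_deriv_truncate n (hη.pow 2) hc2
  have i1 := hw.integrable_mul_deriv_truncate n (hη.pow 2).continuous hc2
  have i2 : Integrable fun x => w x ^ 2 * ‖∇ η x‖ ^ 2 := by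
    refine ((hw.continuous.pow 2).mul
      (hη.continuous_gradient.norm.pow 2)).integrable_of_hasCompactSupport
      (hc.gradient.mono fun x hx => ?_)
    rw [Function.mem_support] at hx ⊢
    contrapose! hx
    simp [hx]
  have h3 : -∫ x, truncate n (w x) * ⟪∇ w x, ∇ (fun y => η y ^ 2) x⟫ ≤
      ∫ x, (1 / 2 * (η x ^ 2 * (deriv (truncate n) (w x) * ‖∇ w x‖ ^ 2)) +
        2 * (w x ^ 2 * ‖∇ η x‖ ^ 2)) := by
    rw [← integral_neg]
    refine integral_mono (hw.integrable_truncate_mul_inner n (hη.pow 2).continuous_gradient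
      hc2.gradient).neg ((i1.const_mul _).add (i2.const_mul _)) fun x => ?_
    simp only [hsq, inner_smul_right]
    have a1 := truncate_sq_le n (w x)
    have a2 := deriv_truncate_nonneg n (w x)
    set t := truncate n (w x)
    set D := deriv (truncate n) (w x)
    have a3 : |⟪∇ w x, ∇ η x⟫| ≤ ‖∇ w x‖ * ‖∇ η x‖ := abs_real_inner_le_norm _ _
    have a4 : |t| ≤ |w x| * √D := by
      apply abs_le_of_sq_le_sq' _ (by positivity) |> abs_le.2
      rw [mul_pow, sq_abs, Real.sq_sqrt a2]
      exact a1
    have a5 : -(t * (2 * η x * ⟪∇ w x, ∇ η x⟫)) ≤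
        2 * (|η x| * √D * ‖∇ w x‖) * (|w x| * ‖∇ η x‖) :=
      calc _ ≤ |t * (2 * η x * ⟪∇ w x, ∇ η x⟫)| := neg_le_abs _
        _ = |t| * (2 * |η x| * |⟪∇ w x, ∇ η x⟫|) := by
          rw [abs_mul, abs_mul, abs_mul, abs_two]
        _ ≤ (|w x| * √D) * (2 * |η x| * (‖∇ w x‖ * ‖∇ η x‖)) := by gcongr
        _ = _ := by ring
    refine a5.trans ?_
    have a6 : η x ^ 2 * (D * ‖∇ w x‖ ^ 2) = (|η x| * √D * ‖∇ w x‖) ^ 2 := by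
      rw [mul_pow, mul_pow, sq_abs, Real.sq_sqrt a2]; ring
    have a7 : w x ^ 2 * ‖∇ η x‖ ^ 2 = (|w x| * ‖∇ η x‖) ^ 2 := by
      rw [mul_pow, sq_abs]
    rw [a6, a7]
    nlinarith [sq_nonneg (|η x| * √D * ‖∇ w x‖ - 2 * (|w x| * ‖∇ η x‖))]
  rw [integral_add (i1.const_mul _) (i2.const_mul _), integral_const_mul,
    integral_const_mul] at h3
  linarith

theorem locallyIntegrable_indicator_gradient :
    LocallyIntegrable ({x | w x ≠ 0}.indicator fun x => ‖∇ w x‖ ^ 2) := by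
  set h : Euc d → ℝ := {x | w x ≠ 0}.indicator fun x => ‖∇ w x‖ ^ 2 with hh
  have hmeas : Measurable h :=
    ((measurable_gradient_s9 w).norm.pow_const 2).indicator
      (hw.continuous.measurable (measurableSet_singleton (0 : ℝ)).compl)
  intro x₀
  let η : ContDiffBump x₀ := ⟨1, 2, one_pos, one_lt_two⟩
  refine ⟨closedBall x₀ 1, closedBall_mem_nhds _ one_pos, ?_⟩
  have hη : ContDiff ℝ ∞ η := η.contDiff
  have hηc : HasCompactSupport η := η.hasCompactSupport
  have hint : Integrable fun x => η x ^ 2 * h x := by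
    refine ⟨((hη.continuous.measurable.pow_const 2).mul hmeas).aestronglyMeasurable, ?_⟩
    have h0 : ∀ x, 0 ≤ h x := fun x => indicator_nonneg (fun _ _ => by positivity) x
    rw [hasFiniteIntegral_iff_ofReal (Eventually.of_forall fun x => mul_nonneg (sq_nonneg _)
      (h0 x))]
    have hfatou : ∀ x, ENNReal.ofReal (η x ^ 2 * h x) = liminf (fun n : ℕ =>
        ENNReal.ofReal (η x ^ 2 * (deriv (truncate n) (w x) * ‖∇ w x‖ ^ 2))) atTop := by
      intro x
      refine (Tendsto.liminf_eq (tendsto_const_nhds.congr' ?_)).symm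
      by_cases hx : w x = 0
      · refine Eventually.of_forall fun n => ?_
        have : deriv (truncate n) (w x) = 0 := by
          rw [hx]; exact (deriv_truncate_eventually_zero n).self_of_nhds
        simp only [this]
        simp [hh, hx]
      · filter_upwards [eventually_deriv_truncate_eq_one hx] with n hn
        simp [hh, hx, hn]
    simp_rw [hfatou]
    refine lt_of_le_of_lt (lintegral_liminf_le fun n => ?_) ?_
    · have := (contDiff_truncate n).continuous_deriv (by simp)
      have h1 := (this.comp hw.continuous).measurable
      exact ((hη.continuous.measurable.pow_const 2).mul
        (h1.mul ((measurable_gradient_s9 w).norm.pow_const 2))).ennreal_ofReal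
    · refine lt_of_le_of_lt (liminf_le_of_le (by isBoundedDefault)
        (a := ENNReal.ofReal (4 * ∫ x, w x ^ 2 * ‖∇ η x‖ ^ 2)) fun b hb => ?_)
        ENNReal.ofReal_lt_top
      obtain ⟨n, hn⟩ := hb.exists
      refine hn.trans ?_
      have hc2 : HasCompactSupport fun x => η x ^ 2 :=
        hηc.mono fun x hx => by
          rw [Function.mem_support] at hx ⊢
          contrapose! hx
          simp [hx]
      rw [← ofReal_integral_eq_lintegral_ofReal
        (hw.integrable_mul_deriv_truncate n (hη.pow 2).continuous hc2)
        (Eventually.of_forall fun x => mul_nonneg (sq_nonneg _)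
          (mul_nonneg (deriv_truncate_nonneg n _) (sq_nonneg _)))]
      exact ENNReal.ofReal_le_ofReal (hw.caccioppoli_truncate n hη hηc)
  refine (hint.integrableOn (s := closedBall x₀ 1)).congr_fun (fun x hx => ?_)
    measurableSet_closedBall
  have : η x = 1 := η.one_of_mem_closedBall hx
  simp [this]

end IsWeaklyHarmonicOff

end Energy

section MeanValue

variable {d : ℕ}

theorem exists_deriv_smoothTransition_pos :
    ∃ s ∈ Ioo (0 : ℝ) 1, 0 < deriv Real.smoothTransition s := by
  obtain ⟨s, hs, h⟩ := exists_deriv_eq_slope Real.smoothTransition zero_lt_one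
    Real.smoothTransition.continuous.continuousOn
    ((Real.smoothTransition.contDiff (n := 1)).differentiable (by simp)).differentiableOn
  refine ⟨s, hs, ?_⟩
  rw [h, Real.smoothTransition.zero, Real.smoothTransition.one]
  norm_num

/-- A nonnegative radial kernel, supported in the unit ball when `s ≤ 1`. -/
def meanKernel (s : ℝ) (y : Euc d) : ℝ := deriv Real.smoothTransition (s - ‖y‖ ^ 2)

theorem continuous_deriv_smoothTransition : Continuous (deriv Real.smoothTransition) :=
  (Real.smoothTransition.contDiff (n := 1)).continuous_deriv (by simp)

theorem continuous_meanKernel (s : ℝ) : Continuous (meanKernel s : Euc d → ℝ) :=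
  continuous_deriv_smoothTransition.comp (by fun_prop)

theorem meanKernel_nonneg (s : ℝ) (y : Euc d) : 0 ≤ meanKernel s y :=
  smoothTransition_deriv_nonneg _

theorem meanKernel_eq_zero {s : ℝ} (hs : s ≤ 1) {y : Euc d} (hy : 1 < ‖y‖) :
    meanKernel s y = 0 := by
  have h : s - ‖y‖ ^ 2 < 0 := by nlinarith
  have : Real.smoothTransition =ᶠ[𝓝 (s - ‖y‖ ^ 2)] fun _ => 0 := by
    filter_upwards [Iio_mem_nhds h] with t ht
    exact Real.smoothTransition.zero_of_nonpos (le_of_lt ht)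
  rw [meanKernel, this.deriv_eq]
  simp

theorem hasCompactSupport_meanKernel {s : ℝ} (hs : s ≤ 1) :
    HasCompactSupport (meanKernel s : Euc d → ℝ) :=
  HasCompactSupport.intro (isCompact_closedBall 0 1) fun y hy =>
    meanKernel_eq_zero hs (by simpa using hy)

theorem integral_meanKernel_pos {s : ℝ} (hs : s ≤ 1) (h : 0 < deriv Real.smoothTransition s) :
    0 < ∫ y : Euc d, meanKernel s y :=
  (continuous_meanKernel s).integral_pos_of_hasCompactSupport_nonneg_nonzero
    (hasCompactSupport_meanKernel hs) (meanKernel_nonneg s) (x := 0)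
    (by simpa [meanKernel] using h.ne')

theorem exists_meanKernel_le {s : ℝ} (hs : s ≤ 1) :
    ∃ M, 0 < M ∧ ∀ y : Euc d, meanKernel s y ≤ M := by
  obtain ⟨C, hC⟩ := (hasCompactSupport_meanKernel (d := d) hs).exists_bound_of_continuous
    (continuous_meanKernel s)
  exact ⟨max C 1, by positivity,
    fun y => (le_abs_self _).trans ((hC y).trans (le_max_left _ _))⟩

theorem hasGradientAt_radial (s t : ℝ) (x z : Euc d) :
    HasGradientAt (fun z : Euc d => Real.smoothTransition (s - ‖t • (z - x)‖ ^ 2))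
      ((-(2 * t) * meanKernel s (t • (z - x))) • (t • (z - x))) z := by
  have h1 : HasGradientAt (fun z : Euc d => s - ‖t • (z - x)‖ ^ 2)
      ((-(2 * t)) • (t • (z - x))) z := by
    rw [hasGradientAt_iff_hasFDerivAt]
    have h2 : HasFDerivAt (fun z : Euc d => t • (z - x)) (t • ContinuousLinearMap.id ℝ (Euc d)) z :=
      ((hasFDerivAt_id z).sub_const x).const_smul t
    refine (h2.norm_sq.const_sub s).congr_fderiv ?_
    ext v
    simp
    ring
  have h3 : HasDerivAt Real.smoothTransition (meanKernel s (t • (z - x)))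
      (s - ‖t • (z - x)‖ ^ 2) :=
    ((Real.smoothTransition.contDiff (n := 1)).differentiable (by simp) _).hasDerivAt
  have h4 := h3.comp_hasGradientAt h1
  rwa [smul_smul, mul_comm (meanKernel s _)] at h4

theorem integral_comp_add_smul (G : Euc d → ℝ) (x : Euc d) {r : ℝ} (hr : 0 < r) :
    ∫ y, G (x + r • y) = (r ^ d)⁻¹ * ∫ z, G z := by
  rw [Measure.integral_comp_smul volume (fun z => G (x + z)) r, integral_add_left_eq_self]
  simp [abs_of_pos hr]

theorem sub_eq_integral_gradient {f : Euc d → ℝ} (hf : ContDiff ℝ ∞ f) (x y : Euc d) (r : ℝ) :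
    f (x + r • y) - f x = ∫ s in (0 : ℝ)..r, ⟪∇ f (x + s • y), y⟫ := by
  have hd : ∀ s : ℝ, HasDerivAt (fun s : ℝ => f (x + s • y)) ⟪∇ f (x + s • y), y⟫ s := fun s => by
    have h1 : HasDerivAt (fun s : ℝ => x + s • y) y s := by
      simpa using ((hasDerivAt_id s).smul_const y).const_add x
    have h2 := (hf.contDiffAt (x := x + s • y)).hasGradientAt_grad.hasFDerivAt
    exact h2.comp_hasDerivAt s h1
  have hc : Continuous fun s : ℝ => ⟪∇ f (x + s • y), y⟫ :=
    (hf.continuous_gradient.comp (by fun_prop)).inner continuous_const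
  have h := intervalIntegral.integral_eq_sub_of_hasDerivAt (fun s _ => hd s)
    (hc.intervalIntegrable 0 r)
  rw [h, zero_smul, add_zero]

/-- Mean value inequality for smooth weakly subharmonic functions. -/
theorem mul_integral_meanKernel_le {f : Euc d → ℝ} (hf : ContDiff ℝ ∞ f)
    (hsub : ∀ ζ : Euc d → ℝ, ContDiff ℝ ∞ ζ → HasCompactSupport ζ → (∀ x, 0 ≤ ζ x) →
      ∫ x, ⟪∇ f x, ∇ ζ x⟫ ≤ 0) {s : ℝ} (hs : s ≤ 1) (x : Euc d) {r : ℝ} (hr : 0 ≤ r) :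
    f x * ∫ y : Euc d, meanKernel s y ≤ ∫ y, f (x + r • y) * meanKernel s y := by
  have hρ := continuous_meanKernel (d := d) s
  have hρc := hasCompactSupport_meanKernel (d := d) hs
  have i1 : Integrable fun y => f (x + r • y) * meanKernel s y :=
    ((hf.continuous.comp (by fun_prop)).mul hρ).integrable_of_hasCompactSupport hρc.mul_left
  have i2 : Integrable fun y : Euc d => f x * meanKernel s y :=
    (hρ.integrable_of_hasCompactSupport hρc).const_mul _
  rw [← sub_nonneg, ← integral_const_mul, ← integral_sub i1 i2]
  have h1 : ∀ y, f (x + r • y) * meanKernel s y - f x * meanKernel s y =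
      ∫ t in Ioc 0 r, ⟪∇ f (x + t • y), y⟫ * meanKernel s y := fun y => by
    rw [← sub_mul, sub_eq_integral_gradient hf, intervalIntegral.integral_of_le hr,
      integral_mul_const]
  simp_rw [h1]
  have hcont : Continuous fun p : Euc d × ℝ =>
      ⟪∇ f (x + p.2 • p.1), p.1⟫ * meanKernel s p.1 :=
    ((hf.continuous_gradient.comp (by fun_prop)).inner continuous_fst).mul
      (hρ.comp continuous_fst)
  rw [integral_integral_swap]
  · refine setIntegral_nonneg measurableSet_Ioc fun t ht => ?_
    have ht0 : 0 < t := ht.1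
    set ζ : Euc d → ℝ := fun z => Real.smoothTransition (s - ‖t⁻¹ • (z - x)‖ ^ 2) with hζ
    have hζs : ContDiff ℝ ∞ ζ := Real.smoothTransition.contDiff.comp
      (contDiff_const.sub ((contDiff_norm_sq ℝ).comp
        ((contDiff_id.sub contDiff_const).const_smul t⁻¹)))
    have hζc : HasCompactSupport ζ := by
      refine HasCompactSupport.intro (isCompact_closedBall x t) fun z hz => ?_
      refine Real.smoothTransition.zero_of_nonpos ?_
      have : t < ‖z - x‖ := by simpa [dist_eq_norm] using hz
      have h3 : 1 ≤ ‖t⁻¹ • (z - x)‖ := by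
        rw [norm_smul, norm_inv, Real.norm_of_nonneg ht0.le, ← div_eq_inv_mul, le_div_iff₀ ht0]
        linarith
      nlinarith
    have h4 := hsub ζ hζs hζc fun z => Real.smoothTransition.nonneg _
    have h5 : ∀ y, ⟪∇ f (x + t • y), y⟫ * meanKernel s y =
        (fun z => -(t / 2) * ⟪∇ f z, ∇ ζ z⟫) (x + t • y) := fun y => by
      simp only [hζ]
      rw [(hasGradientAt_radial s t⁻¹ x (x + t • y)).gradient, add_sub_cancel_left,
        inv_smul_smul₀ ht0.ne', inner_smul_right]
      field_simp
    simp_rw [h5]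
    rw [integral_comp_add_smul (fun z => -(t / 2) * ⟪∇ f z, ∇ ζ z⟫) x ht0, integral_const_mul]
    exact mul_nonneg (by positivity) (by nlinarith)
  · have h6 : IntegrableOn (fun p : Euc d × ℝ => ⟪∇ f (x + p.2 • p.1), p.1⟫ * meanKernel s p.1)
        (closedBall 0 1 ×ˢ Icc 0 r) (volume.prod volume) :=
      hcont.continuousOn.integrableOn_compact ((isCompact_closedBall 0 1).prod isCompact_Icc)
    have h7 : Integrable (fun p : Euc d × ℝ => ⟪∇ f (x + p.2 • p.1), p.1⟫ * meanKernel s p.1)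
        ((volume.prod volume).restrict (univ ×ˢ Ioc 0 r)) := by
      refine IntegrableOn.of_forall_sdiff_eq_zero (h6.mono_set
        (prod_mono_right Ioc_subset_Icc_self)) (MeasurableSet.univ.prod measurableSet_Ioc)
        fun p hp => ?_
      have : 1 < ‖p.1‖ := by
        by_contra h
        exact hp.2 ⟨by simpa using not_lt.1 h, hp.1.2⟩
      rw [meanKernel_eq_zero hs this, mul_zero]
    rwa [← Measure.prod_restrict, Measure.restrict_univ] at h7

namespace IsWeaklyHarmonicOff

variable {Z : Set (Euc d)} {w : Euc d → ℝ} (hw : IsWeaklyHarmonicOff Z w)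
include hw

theorem sq_mul_integral_meanKernel_le {s : ℝ} (hs : s ≤ 1) (x : Euc d) {r : ℝ} (hr : 0 ≤ r) :
    w x ^ 2 * ∫ y : Euc d, meanKernel s y ≤ ∫ y, w (x + r • y) ^ 2 * meanKernel s y := by
  have hρ := continuous_meanKernel (d := d) s
  have hρc := hasCompactSupport_meanKernel (d := d) hs
  have hwr : Continuous fun y => w (x + r • y) := hw.continuous.comp (by fun_prop)
  have i1 : Integrable fun y => w (x + r • y) ^ 2 * meanKernel s y :=
    ((hwr.pow 2).mul hρ).integrable_of_hasCompactSupport hρc.mul_left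
  have i2 : Integrable fun y => |w (x + r • y)| * meanKernel s y :=
    (hwr.abs.mul hρ).integrable_of_hasCompactSupport hρc.mul_left
  have key : ∀ n : ℕ, (w x ^ 2 / 2 - 2 * ((n : ℝ) + 1)⁻¹ * |w x|) *
      (∫ y : Euc d, meanKernel s y) ≤ 1 / 2 * (∫ y, w (x + r • y) ^ 2 * meanKernel s y) +
        2 * ((n : ℝ) + 1)⁻¹ * ∫ y, |w (x + r • y)| * meanKernel s y := by
    intro n
    have hf := hw.contDiff_comp (contDiff_truncatePrimitive n)
      (truncatePrimitive_eventually_zero n)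
    have h1 := mul_integral_meanKernel_le hf (fun ζ hζ hζc hζ0 => ?_) hs x hr
    · calc _ ≤ truncatePrimitive n (w x) * ∫ y : Euc d, meanKernel s y := by
            refine mul_le_mul_of_nonneg_right ?_ (integral_nonneg (meanKernel_nonneg s))
            have := abs_le.1 (abs_truncatePrimitive_sub_le n (w x))
            linarith
        _ ≤ _ := h1
        _ ≤ ∫ y, (1 / 2 * (w (x + r • y) ^ 2 * meanKernel s y) +
            2 * ((n : ℝ) + 1)⁻¹ * (|w (x + r • y)| * meanKernel s y)) := by
          refine integral_mono (((hf.continuous.comp (by fun_prop)).mul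
            hρ).integrable_of_hasCompactSupport hρc.mul_left)
            ((i1.const_mul _).add (i2.const_mul _)) fun y => ?_
          have := abs_le.1 (abs_truncatePrimitive_sub_le n (w (x + r • y)))
          have h0 := meanKernel_nonneg s y
          calc _ ≤ (w (x + r • y) ^ 2 / 2 + 2 * ((n : ℝ) + 1)⁻¹ * |w (x + r • y)|) *
                meanKernel s y := mul_le_mul_of_nonneg_right (by linarith) h0
            _ = _ := by ring
        _ = _ := by
          rw [integral_add (i1.const_mul _) (i2.const_mul _), integral_const_mul,
            integral_const_mul]
    · have h2 := hw.integral_mul_deriv_truncate n hζ hζc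
      have h3 : 0 ≤ ∫ x, ζ x * (deriv (truncate n) (w x) * ‖∇ w x‖ ^ 2) :=
        integral_nonneg fun x => mul_nonneg (hζ0 x)
          (mul_nonneg (deriv_truncate_nonneg n _) (sq_nonneg _))
      simp_rw [hw.gradient_comp (contDiff_truncatePrimitive n)
        (truncatePrimitive_eventually_zero n), deriv_truncatePrimitive, inner_smul_left]
      simp only [conj_trivial]
      linarith
  have hlim : Tendsto (fun n : ℕ => ((n : ℝ) + 1)⁻¹) atTop (𝓝 0) := by
    simpa using tendsto_one_div_add_atTop_nhds_zero_nat (𝕜 := ℝ)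
  have hl := (((hlim.const_mul 2).mul_const |w x|).const_sub (w x ^ 2 / 2)).mul_const
    (∫ y : Euc d, meanKernel s y)
  have hr' := (((hlim.const_mul 2).mul_const
    (∫ y, |w (x + r • y)| * meanKernel s y)).const_add
      (1 / 2 * (∫ y, w (x + r • y) ^ 2 * meanKernel s y)))
  have := le_of_tendsto_of_tendsto' hl hr' key
  simp only [mul_zero, zero_mul, sub_zero, add_zero] at this
  linarith

end IsWeaklyHarmonicOff

end MeanValue

section Differentiability

variable {d : ℕ}

theorem setIntegral_comp_add_smul (g : Euc d → ℝ) (x : Euc d) {t : ℝ} (ht : 0 < t) (r : ℝ) :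
    ∫ y in closedBall 0 r, g (x + t • y) = (t ^ d)⁻¹ * ∫ z in closedBall x (t * r), g z := by
  rw [← integral_indicator measurableSet_closedBall, ← integral_indicator measurableSet_closedBall,
    ← integral_comp_add_smul _ x ht]
  congr 1 with y
  have : y ∈ closedBall (0 : Euc d) r ↔ x + t • y ∈ closedBall x (t * r) := by
    simp [norm_smul, abs_of_pos ht, ht]
  by_cases hy : y ∈ closedBall (0 : Euc d) r
  · rw [indicator_of_mem hy, indicator_of_mem (this.1 hy)]
  · rw [indicator_of_notMem hy, indicator_of_notMem (this.not.1 hy)]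

theorem volume_real_closedBall_eq (x : Euc d) {t : ℝ} (ht : 0 < t) (r : ℝ) :
    volume.real (closedBall (0 : Euc d) r) =
      (t ^ d)⁻¹ * volume.real (closedBall x (t * r)) := by
  simpa using setIntegral_comp_add_smul (fun _ => (1 : ℝ)) x ht r

theorem sq_integral_Ioc_le {g : ℝ → ℝ} (hg : Continuous g) :
    (∫ t in (0 : ℝ)..1, g t) ^ 2 ≤ ∫ t in (0 : ℝ)..1, g t ^ 2 := by
  set m := ∫ t in (0 : ℝ)..1, g t with hm
  have h1 : 0 ≤ ∫ t in (0 : ℝ)..1, (g t - m) ^ 2 :=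
    intervalIntegral.integral_nonneg zero_le_one fun t _ => sq_nonneg _
  have h2 : ∫ t in (0 : ℝ)..1, (g t - m) ^ 2 = (∫ t in (0 : ℝ)..1, g t ^ 2) - m ^ 2 := by
    have h3 : ∀ t, (g t - m) ^ 2 = g t ^ 2 - (2 * m) * g t + m ^ 2 := fun t => by ring
    simp_rw [h3]
    have i1 : IntervalIntegrable (fun t => g t ^ 2) volume 0 1 :=
      (hg.pow 2).intervalIntegrable _ _
    have i2 : IntervalIntegrable (fun t => 2 * m * g t) volume 0 1 :=
      (continuous_const.mul hg).intervalIntegrable _ _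
    have i3 : IntervalIntegrable (fun t => g t ^ 2 - 2 * m * g t) volume 0 1 := i1.sub i2
    rw [intervalIntegral.integral_add i3 intervalIntegrable_const,
      intervalIntegral.integral_sub i1 i2,
      intervalIntegral.integral_const_mul, ← hm]
    simp
    ring
  linarith

/-- A centred Poincaré inequality for smooth functions vanishing at the centre. -/
theorem setIntegral_sq_le_of_gradient {f : Euc d → ℝ} (hf : ContDiff ℝ ∞ f) {x : Euc d}
    (hx : f x = 0) {r δ : ℝ} (hr : 0 < r)
    (h : ∀ ρ, 0 < ρ → ρ ≤ r →
      ∫ y in closedBall x ρ, ‖∇ f y‖ ^ 2 ≤ δ * volume.real (closedBall x ρ)) :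
    ∫ y in closedBall 0 r, f (x + y) ^ 2 ≤
      r ^ 2 * (δ * volume.real (closedBall (0 : Euc d) r)) := by
  have hG := hf.continuous_gradient
  have hcont : Continuous fun p : Euc d × ℝ => r ^ 2 * ‖∇ f (x + p.2 • p.1)‖ ^ 2 :=
    continuous_const.mul ((hG.comp (by fun_prop)).norm.pow 2)
  have hint : Integrable (fun p : Euc d × ℝ => r ^ 2 * ‖∇ f (x + p.2 • p.1)‖ ^ 2)
      ((volume.restrict (closedBall 0 r)).prod (volume.restrict (Ioc 0 1))) := by
    rw [Measure.prod_restrict]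
    exact (hcont.continuousOn.integrableOn_compact
      ((isCompact_closedBall 0 r).prod isCompact_Icc)).mono_set
        (prod_mono_right Ioc_subset_Icc_self)
  have hpt : ∀ y ∈ closedBall (0 : Euc d) r,
      f (x + y) ^ 2 ≤ ∫ t in Ioc (0 : ℝ) 1, r ^ 2 * ‖∇ f (x + t • y)‖ ^ 2 := by
    intro y hy
    have hy' : ‖y‖ ≤ r := by simpa using hy
    have h1 := sub_eq_integral_gradient hf x y 1
    rw [hx, one_smul, sub_zero] at h1
    have hc : Continuous fun t : ℝ => ⟪∇ f (x + t • y), y⟫ :=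
      (hG.comp (by fun_prop)).inner continuous_const
    rw [h1, ← intervalIntegral.integral_of_le zero_le_one]
    refine (sq_integral_Ioc_le hc).trans ?_
    refine intervalIntegral.integral_mono_on zero_le_one ((hc.pow 2).intervalIntegrable _ _)
      ((hcont.comp (continuous_const.prodMk continuous_id)).intervalIntegrable _ _) fun t _ => ?_
    rw [← sq_abs, mul_comm, ← mul_pow]
    refine pow_le_pow_left₀ (abs_nonneg _) ((abs_real_inner_le_norm _ _).trans ?_) 2
    gcongr
  calc _ ≤ ∫ y in closedBall 0 r, ∫ t in Ioc (0 : ℝ) 1, r ^ 2 * ‖∇ f (x + t • y)‖ ^ 2 := by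
        refine setIntegral_mono_on ?_ hint.integral_prod_left measurableSet_closedBall hpt
        exact ((hf.continuous.comp (by fun_prop)).pow 2).continuousOn.integrableOn_compact
          (isCompact_closedBall 0 r)
    _ = ∫ t in Ioc (0 : ℝ) 1, ∫ y in closedBall 0 r, r ^ 2 * ‖∇ f (x + t • y)‖ ^ 2 :=
        integral_integral_swap hint
    _ ≤ ∫ t in Ioc (0 : ℝ) 1, r ^ 2 * (δ * volume.real (closedBall (0 : Euc d) r)) := by
        refine setIntegral_mono_on hint.integral_prod_right (integrable_const _) measurableSet_Ioc
          fun t ht => ?_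
        rw [integral_const_mul, setIntegral_comp_add_smul (fun z => ‖∇ f z‖ ^ 2) x ht.1 r,
          volume_real_closedBall_eq x ht.1 r, mul_left_comm δ]
        have htp : 0 < t := ht.1
        gcongr
        exact h (t * r) (mul_pos ht.1 hr) (mul_le_of_le_one_left hr.le ht.2)
    _ = _ := by simp

namespace IsWeaklyHarmonicOff

variable {Z : Set (Euc d)} {w : Euc d → ℝ} (hw : IsWeaklyHarmonicOff Z w)
include hw

theorem setIntegral_sq_le {C : ℝ} (hC : ∀ n s, deriv (truncate n) s ≤ C) {x : Euc d}
    (hx : w x = 0) {r δ : ℝ} (hr : 0 < r)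
    (h : ∀ ρ, 0 < ρ → ρ ≤ r → ∫ y in closedBall x ρ,
      {x | w x ≠ 0}.indicator (fun x => ‖∇ w x‖ ^ 2) y ≤ δ * volume.real (closedBall x ρ)) :
    ∫ y in closedBall 0 r, w (x + y) ^ 2 ≤
      r ^ 2 * ((C ^ 2 * δ) * volume.real (closedBall (0 : Euc d) r)) := by
  have hwx : Continuous fun y => w (x + y) := hw.continuous.comp (by fun_prop)
  have hlim : Tendsto (fun n : ℕ => ∫ y in closedBall 0 r, truncate n (w (x + y)) ^ 2) atTop
      (𝓝 (∫ y in closedBall 0 r, w (x + y) ^ 2)) := by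
    refine tendsto_integral_of_dominated_convergence (fun y => w (x + y) ^ 2) (fun n => ?_)
      ((hwx.pow 2).continuousOn.integrableOn_compact (isCompact_closedBall 0 r))
      (fun n => Eventually.of_forall fun y => ?_) (Eventually.of_forall fun y => ?_)
    · exact (((contDiff_truncate n).continuous.comp hwx).pow 2).aestronglyMeasurable
    · rw [Real.norm_of_nonneg (sq_nonneg _), sq_le_sq]
      exact abs_truncate_le n _
    · refine tendsto_const_nhds.congr' ?_
      filter_upwards [eventually_truncate_eq_self (w (x + y))] with n hn
      rw [hn]
  refine le_of_tendsto' hlim fun n => ?_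
  refine setIntegral_sq_le_of_gradient (f := fun y => truncate n (w y))
    (hw.contDiff_comp (contDiff_truncate n) (truncate_eventually_zero n)) ?_ hr
    fun ρ hρ hρr => ?_
  · simp only [hx]
    exact (truncate_eventually_zero n).self_of_nhds
  · calc _ ≤ ∫ y in closedBall x ρ,
          C ^ 2 * {x | w x ≠ 0}.indicator (fun x => ‖∇ w x‖ ^ 2) y := by
          refine setIntegral_mono ?_ ?_ fun y => ?_
          · exact ((hw.contDiff_comp (contDiff_truncate n)
              (truncate_eventually_zero n)).continuous_gradient.norm.pow
              2).continuousOn.integrableOn_compact (isCompact_closedBall x ρ)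
          · exact (hw.locallyIntegrable_indicator_gradient.integrableOn_isCompact
              (isCompact_closedBall x ρ)).const_mul _
          · simp only [hw.gradient_comp (contDiff_truncate n) (truncate_eventually_zero n)]
            have h0 := deriv_truncate_nonneg n (w y)
            have h1 := hC n (w y)
            rw [norm_smul, mul_pow, Real.norm_of_nonneg h0]
            by_cases hy : w y = 0
            · have : deriv (truncate n) (w y) = 0 := by
                rw [hy]; exact (deriv_truncate_eventually_zero n).self_of_nhds
              simp only [this]
              simp [hy]
            · rw [indicator_of_mem (show y ∈ {x | w x ≠ 0} from hy)]
              gcongr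
      _ ≤ C ^ 2 * (δ * volume.real (closedBall x ρ)) := by
          rw [integral_const_mul]
          gcongr
          exact h ρ hρ hρr
      _ = _ := by ring

theorem exists_sq_le : ∃ K, 0 < K ∧ ∀ x, w x = 0 → ∀ r δ : ℝ, 0 < r →
    (∀ ρ, 0 < ρ → ρ ≤ 2 * r → ∫ y in closedBall x ρ,
      {x | w x ≠ 0}.indicator (fun x => ‖∇ w x‖ ^ 2) y ≤ δ * volume.real (closedBall x ρ)) →
    ∀ x', ‖x' - x‖ = r → w x' ^ 2 ≤ K * δ * r ^ 2 := by
  obtain ⟨C, hC0, hC⟩ := exists_deriv_truncate_le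
  obtain ⟨s, hs, hsd⟩ := exists_deriv_smoothTransition_pos
  obtain ⟨M, hM0, hM⟩ := exists_meanKernel_le (d := d) hs.2.le
  have hc := integral_meanKernel_pos (d := d) hs.2.le hsd
  set c := ∫ y : Euc d, meanKernel s y
  set V := volume.real (closedBall (0 : Euc d) 2)
  have hV : 0 < V := ENNReal.toReal_pos (measure_closedBall_pos volume 0 two_pos).ne'
    measure_closedBall_lt_top.ne
  refine ⟨M * 4 * C ^ 2 * V / c, by positivity, fun x hx r δ hr h x' hx' => ?_⟩
  have h1 := hw.setIntegral_sq_le hC hx (r := 2 * r) (by positivity) h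
  have h2 := hw.sq_mul_integral_meanKernel_le hs.2.le x' hr.le
  have hwc2 := hw.continuous.pow 2
  have hwr : Continuous fun y => w (x' + r • y) ^ 2 := (hw.continuous.comp (by fun_prop)).pow 2
  have h3 : ∫ y, w (x' + r • y) ^ 2 * meanKernel s y ≤
      M * ((r ^ d)⁻¹ * ∫ z in closedBall x' (r * 1), w z ^ 2) := by
    rw [← setIntegral_comp_add_smul (fun z => w z ^ 2) x' hr, ← integral_const_mul,
      ← setIntegral_eq_integral_of_forall_compl_eq_zero (s := closedBall 0 1)]
    · refine setIntegral_mono ?_ ?_ fun y => ?_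
      · exact (hwr.mul (continuous_meanKernel s)).continuousOn.integrableOn_compact
          (isCompact_closedBall 0 1)
      · exact (continuous_const.mul hwr).continuousOn.integrableOn_compact
          (isCompact_closedBall 0 1)
      · simp only
        rw [mul_comm]
        gcongr
        exact hM y
    · intro y hy
      rw [meanKernel_eq_zero hs.2.le (by simpa using hy), mul_zero]
  have h4 : ∫ z in closedBall x' (r * 1), w z ^ 2 ≤ ∫ z in closedBall x (1 * (2 * r)), w z ^ 2 := by
    refine setIntegral_mono_set (hwc2.continuousOn.integrableOn_compact
      (isCompact_closedBall _ _)) (Eventually.of_forall fun z => sq_nonneg _)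
      (LE.le.eventuallyLE (closedBall_subset_closedBall' ?_))
    rw [dist_eq_norm, hx']
    linarith
  have h5 := setIntegral_comp_add_smul (fun z => w z ^ 2) x one_pos (2 * r)
  simp only [one_smul, one_pow, inv_one, one_mul] at h5
  rw [one_mul, ← h5] at h4
  have h6 := volume_real_closedBall_eq (0 : Euc d) hr 2
  have hrd : 0 < (r ^ d)⁻¹ := by positivity
  rw [mul_comm r 2] at h6
  have h7 : w x' ^ 2 * c ≤ M * 4 * C ^ 2 * V * δ * r ^ 2 :=
    calc _ ≤ _ := h2
      _ ≤ _ := h3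
      _ ≤ M * ((r ^ d)⁻¹ * ((2 * r) ^ 2 * ((C ^ 2 * δ) *
          volume.real (closedBall (0 : Euc d) (2 * r))))) := by
        gcongr
        exact h4.trans h1
      _ = M * 4 * C ^ 2 * ((r ^ d)⁻¹ * volume.real (closedBall (0 : Euc d) (2 * r))) *
          δ * r ^ 2 := by ring
      _ = _ := by rw [← h6]
  rw [← le_div_iff₀ hc] at h7
  refine h7.trans_eq ?_
  ring

theorem ae_hasGradientAt : ∀ᵐ x, HasGradientAt w (∇ w x) x ∧ (w x = 0 → ∇ w x = 0) := by
  obtain ⟨K, hK, hKw⟩ := hw.exists_sq_le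
  filter_upwards [(Besicovitch.vitaliFamily (volume : Measure (Euc d))).ae_tendsto_average
    hw.locallyIntegrable_indicator_gradient] with x hx
  by_cases hwx : w x = 0
  · suffices hg : HasGradientAt w 0 x by
      rw [hg.gradient]
      exact ⟨hg, fun _ => rfl⟩
    have hx' := hx.comp (Besicovitch.tendsto_filterAt volume x)
    rw [indicator_of_notMem (by simp [hwx])] at hx'
    rw [hasGradientAt_iff_isLittleO, Asymptotics.isLittleO_iff]
    intro ε hε
    have hδ : 0 < ε ^ 2 / K := by positivity
    have he := hx'.eventually (Iio_mem_nhds hδ)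
    obtain ⟨r₀, hr₀, hr⟩ := mem_nhdsGT_iff_exists_Ioo_subset.1 he
    have hr₀' : 0 < r₀ := hr₀
    filter_upwards [ball_mem_nhds x (half_pos hr₀')] with x' hx'
    rw [hwx, inner_zero_left, sub_zero, sub_zero]
    rcases eq_or_ne x' x with rfl | hne
    · simp [hwx]
    have hpos : 0 < ‖x' - x‖ := norm_pos_iff.2 (sub_ne_zero.2 hne)
    have hlt : ‖x' - x‖ < r₀ / 2 := by rwa [mem_ball, dist_eq_norm] at hx'
    have h1 := hKw x hwx ‖x' - x‖ (ε ^ 2 / K) hpos (fun ρ hρ hρr => ?_) x' rfl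
    · rw [mul_div_cancel₀ _ hK.ne', ← mul_pow] at h1
      exact abs_le_of_sq_le_sq h1 (by positivity)
    · have h2 : ρ ∈ Ioo 0 r₀ := ⟨hρ, by linarith⟩
      have h3 := hr h2
      simp only [mem_ofPred_eq, Function.comp_apply, setAverage_eq, smul_eq_mul] at h3
      have hvol : 0 < volume.real (closedBall x ρ) :=
        ENNReal.toReal_pos
        (measure_closedBall_pos volume x hρ).ne' measure_closedBall_lt_top.ne
      rw [inv_mul_lt_iff₀ hvol] at h3
      rw [mul_comm]
      exact h3.le
  · exact ⟨(hw.contDiffAt x (hw.notMem hwx)).hasGradientAt_grad, fun h => absurd h hwx⟩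

/-- `∇ w` is locally square integrable. -/
theorem locallyIntegrable_sq_norm_gradient : LocallyIntegrable fun x => ‖∇ w x‖ ^ 2 := by
  intro x
  obtain ⟨U, hU, h⟩ := hw.locallyIntegrable_indicator_gradient x
  refine ⟨U, hU, Integrable.congr h (ae_restrict_of_ae ?_)⟩
  filter_upwards [hw.ae_hasGradientAt] with y hy
  by_cases h0 : w y = 0
  · simp [h0, hy.2 h0]
  · rw [indicator_of_mem (show y ∈ {x | w x ≠ 0} from h0)]

end IsWeaklyHarmonicOff

end Differentiability

section Correctors

variable {d : ℕ}

theorem HasGradientAt.comp_const_smul {f : Euc d → ℝ} {f' x : Euc d} {c : ℝ}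
    (hf : HasGradientAt f f' (c • x)) : HasGradientAt (fun y => f (c • y)) (c • f') x := by
  rw [hasGradientAt_iff_hasFDerivAt]
  have h : HasFDerivAt (fun y => f (c • y)) _ x :=
    hf.hasFDerivAt.comp x ((hasFDerivAt_id x).const_smul c)
  refine h.congr_fderiv (ContinuousLinearMap.ext fun y => ?_)
  simp

namespace IsWeaklyHarmonicOff

variable {Z : Set (Euc d)} {w : Euc d → ℝ} (hw : IsWeaklyHarmonicOff Z w)
include hw

theorem locallyIntegrable_norm_gradient : LocallyIntegrable fun x => ‖∇ w x‖ := by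
  refine (hw.locallyIntegrable_sq_norm_gradient.add (locallyIntegrable_const (1 : ℝ))).mono
    (measurable_gradient_s9 w).norm.aestronglyMeasurable (Eventually.of_forall fun x => ?_)
  rw [Pi.add_apply, norm_norm, Real.norm_of_nonneg (by positivity)]
  nlinarith [sq_nonneg (‖∇ w x‖ - 1), norm_nonneg (∇ w x)]

theorem integrable_inner_gradient {V : Euc d → Euc d} (hV : Continuous V)
    (hc : HasCompactSupport V) : Integrable fun x => ⟪∇ w x, V x⟫ := by
  refine (hw.locallyIntegrable_norm_gradient.integrable_smul_left_of_hasCompactSupport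
    hV.norm hc.norm).mono' ((measurable_gradient_s9 w).inner hV.measurable).aestronglyMeasurable
    (Eventually.of_forall fun x => ?_)
  rw [smul_eq_mul, mul_comm]
  exact norm_inner_le_norm _ _

end IsWeaklyHarmonicOff

theorem integrable_inner_gradient_const {φ : Euc d → ℝ} (hφ : ContDiff ℝ ∞ φ)
    (hc : HasCompactSupport φ) (q : Euc d) : Integrable fun x => ⟪q, ∇ φ x⟫ :=
  (continuous_const.inner hφ.continuous_gradient).integrable_of_hasCompactSupport
    (hc.gradient.mono fun x hx => by
      rw [Function.mem_support] at hx ⊢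
      contrapose! hx
      simp [hx])

/-- The pairs `(q, w)` such that `w` vanishes on `closure Ω`, is smooth off it and satisfies
`Δ w = - div (q χ_Ω)` weakly. -/
def correctors (Ω : Set (Euc d)) : Submodule ℝ (Euc d × (Euc d → ℝ)) where
  carrier := {P | IsWeaklyHarmonicOff (closure Ω) P.2 ∧
    ∀ φ : Euc d → ℝ, ContDiff ℝ ∞ φ → HasCompactSupport φ →
      ∫ x, ⟪∇ P.2 x, ∇ φ x⟫ = -∫ x in Ω, ⟪P.1, ∇ φ x⟫}
  zero_mem' := by
    have h : ∀ x, ∇ (0 : Euc d → ℝ) x = 0 := fun x => gradient_const x 0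
    exact ⟨⟨continuous_const, fun _ _ => rfl, fun _ _ => contDiffAt_const,
      fun φ _ _ _ => by simp [h]⟩, fun φ _ _ => by simp [h]⟩
  add_mem' := by
    rintro ⟨q₁, w₁⟩ ⟨q₂, w₂⟩ ⟨h₁, f₁⟩ ⟨h₂, f₂⟩
    have hf : ∀ φ : Euc d → ℝ, ContDiff ℝ ∞ φ → HasCompactSupport φ →
        ∫ x, ⟪∇ (w₁ + w₂) x, ∇ φ x⟫ =
          (∫ x, ⟪∇ w₁ x, ∇ φ x⟫) + ∫ x, ⟪∇ w₂ x, ∇ φ x⟫ := by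
      intro φ hφ hc
      rw [← integral_add (h₁.integrable_inner_gradient hφ.continuous_gradient hc.gradient)
        (h₂.integrable_inner_gradient hφ.continuous_gradient hc.gradient)]
      refine integral_congr_ae ?_
      filter_upwards [h₁.ae_hasGradientAt, h₂.ae_hasGradientAt] with x g₁ g₂
      have : ∇ (w₁ + w₂) x = ∇ w₁ x + ∇ w₂ x := (g₁.1.add_grad g₂.1).gradient
      rw [this, inner_add_left]
    refine ⟨⟨h₁.continuous.add h₂.continuous, fun x hx => ?_,
      fun x hx => (h₁.contDiffAt x hx).add (h₂.contDiffAt x hx), fun φ hφ hc hs => ?_⟩,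
      fun φ hφ hc => ?_⟩
    · have e₁ := h₁.eq_zero x hx
      have e₂ := h₂.eq_zero x hx
      simp only at e₁ e₂
      simp [e₁, e₂]
    · exact (hf φ hφ hc).trans (by rw [h₁.weak φ hφ hc hs, h₂.weak φ hφ hc hs, add_zero])
    · refine (hf φ hφ hc).trans ?_
      have e₁ := f₁ φ hφ hc
      have e₂ := f₂ φ hφ hc
      simp only at e₁ e₂
      simp only [Prod.mk_add_mk, inner_add_left]
      rw [integral_add (integrable_inner_gradient_const hφ hc q₁).integrableOn
        (integrable_inner_gradient_const hφ hc q₂).integrableOn, e₁, e₂]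
      ring
  smul_mem' := by
    rintro c ⟨q, w⟩ ⟨h, f⟩
    have hf : ∀ φ : Euc d → ℝ,
        ∫ x, ⟪∇ (c • w) x, ∇ φ x⟫ = c * ∫ x, ⟪∇ w x, ∇ φ x⟫ := by
      intro φ
      rw [← integral_const_mul]
      refine integral_congr_ae ?_
      filter_upwards [h.ae_hasGradientAt] with x g
      have : ∇ (c • w) x = c • ∇ w x := (g.1.const_mul_grad c).gradient
      rw [this, real_inner_smul_left]
    refine ⟨⟨h.continuous.const_smul c, fun x hx => ?_,
      fun x hx => (h.contDiffAt x hx).const_smul c, fun φ hφ hc hs => ?_⟩,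
      fun φ hφ hc => ?_⟩
    · have e := h.eq_zero x hx
      simp only at e
      simp [e]
    · exact (hf φ).trans (by rw [h.weak φ hφ hc hs, mul_zero])
    · refine (hf φ).trans ?_
      have e := f φ hφ hc
      simp only at e
      simp only [Prod.smul_mk, real_inner_smul_left]
      rw [integral_const_mul, e]
      ring

variable {Ω : Set (Euc d)} {w : Euc d → ℝ}

namespace IsWeaklyHarmonicOff

variable (hw : IsWeaklyHarmonicOff (closure Ω) w)
include hw

theorem ae_gradient_add_affine (p : Euc d) (c : ℝ) : ∀ᵐ x,
    ∇ (fun y => ⟪p, y⟫ + c + w y) x = p + ∇ w x ∧ (w x = 0 → ∇ w x = 0) := by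
  filter_upwards [hw.ae_hasGradientAt] with x hx
  exact ⟨((hasGradientAt_inner_add_const p c x).add_grad hx.1).gradient, hx.2⟩

theorem integral_conductivity_add_affine (ho : IsOpen Ω) (k : ℝ) (p : Euc d) (c : ℝ)
    {φ : Euc d → ℝ} (hφ : ContDiff ℝ ∞ φ) (hc : HasCompactSupport φ) :
    ∫ x, (1 + (k - 1) * Ω.indicator (fun _ => (1 : ℝ)) x) *
      ⟪∇ (fun y => ⟪p, y⟫ + c + w y) x, ∇ φ x⟫ =
    (∫ x, ⟪∇ w x, ∇ φ x⟫) + ∫ x in Ω, ⟪(k - 1) • p, ∇ φ x⟫ := by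
  have i1 := integrable_inner_gradient_const hφ hc p
  have i2 := hw.integrable_inner_gradient hφ.continuous_gradient hc.gradient
  have i3 := (integrable_inner_gradient_const hφ hc ((k - 1) • p)).indicator ho.measurableSet
  rw [← integral_indicator ho.measurableSet, ← integral_add i2 i3,
    ← zero_add (∫ x, _ + _), ← integral_inner_gradient_eq_zero_s9 hφ hc p,
    ← integral_add (g := fun x => _ + _) i1 (i2.add i3)]
  refine integral_congr_ae ?_
  filter_upwards [hw.ae_gradient_add_affine p c] with x hx
  rw [hx.1]
  by_cases hΩ : x ∈ Ω
  · simp only [indicator_of_mem hΩ, hx.2 (hw.eq_zero x (subset_closure hΩ)), inner_add_left,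
      inner_zero_left, real_inner_smul_left]
    ring
  · simp only [indicator_of_notMem hΩ, inner_add_left]
    ring

end IsWeaklyHarmonicOff

theorem IsCondSol.isWeaklyHarmonicOff {k : ℝ} {a b : Euc d} {c : ℝ}
    (h : IsCondSol d Ω k a (fun y => ⟪b, y⟫ + c + w y)) (h0 : ∀ x ∈ Ω, w x = 0) :
    IsWeaklyHarmonicOff (closure Ω) w := by
  have haff : ContDiff ℝ ∞ fun y : Euc d => ⟪b, y⟫ + c :=
    contDiff_const.inner ℝ contDiff_id |>.add contDiff_const
  have hcont : Continuous w := by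
    refine (h.1.sub haff.continuous).congr fun x => ?_
    simp
  have hsm : ∀ x ∉ closure Ω, ContDiffAt ℝ ∞ w x := fun x hx => by
    have := (h.2.2.1.contDiffAt (isClosed_closure.isOpen_compl.mem_nhds hx)).sub
      haff.contDiffAt
    simpa using this
  refine ⟨hcont, fun x hx => ?_, hsm, fun φ hφ hc hs => ?_⟩
  · exact closure_minimal (fun y hy => h0 y hy) (isClosed_singleton.preimage hcont) hx
  · by_cases hi : Integrable fun x => ⟪∇ w x, ∇ φ x⟫
    · have h1 := h.2.2.2.1 φ hφ hc
      rw [← h1, ← zero_add (∫ x, ⟪∇ w x, _⟫), ← integral_inner_gradient_eq_zero_s9 hφ hc b,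
        ← integral_add (integrable_inner_gradient_const hφ hc b) hi]
      refine integral_congr_ae (Eventually.of_forall fun x => ?_)
      by_cases hx : x ∈ tsupport φ
      · have hxΩ := hs hx
        have hg : ∇ (fun y => ⟪b, y⟫ + c + w y) x = b + ∇ w x :=
          ((hasGradientAt_inner_add_const b c x).add_grad
            (hsm x hxΩ).hasGradientAt_grad).gradient
        simp only [hg, indicator_of_notMem fun h' => hxΩ (subset_closure h'), inner_add_left]
        ring
      · simp [gradient_eq_zero_of_notMem_tsupport_s9 hx]
    · exact integral_undef hi

theorem IsCondSol.mem_correctors (ho : IsOpen Ω) {k : ℝ} {a b : Euc d} {c : ℝ}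
    (h : IsCondSol d Ω k a (fun y => ⟪b, y⟫ + c + w y)) (h0 : ∀ x ∈ Ω, w x = 0) :
    ((k - 1) • b, w) ∈ correctors Ω := by
  have hw := h.isWeaklyHarmonicOff h0
  refine ⟨hw, fun φ hφ hc => ?_⟩
  have h1 := h.2.2.2.1 φ hφ hc
  have h2 := hw.integral_conductivity_add_affine ho k b c hφ hc
  exact eq_neg_of_add_eq_zero_left (h2.symm.trans h1)

theorem isCondSol_of_mem_correctors (ho : IsOpen Ω) {k : ℝ} {a p : Euc d} {c : ℝ}
    (h : ((k - 1) • p, w) ∈ correctors Ω)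
    (hdec : ∃ C R : ℝ, 0 < C ∧ 0 < R ∧ ∀ x : Euc d, R ≤ ‖x‖ →
      |⟪p, x⟫ + c + w x - ⟪a, x⟫| ≤ C * ‖x‖ ^ (1 - (d : ℤ))) :
    IsCondSol d Ω k a (fun y => ⟪p, y⟫ + c + w y) := by
  obtain ⟨hw, hf⟩ := h
  have haff : ContDiff ℝ ∞ fun y : Euc d => ⟪p, y⟫ + c :=
    contDiff_const.inner ℝ contDiff_id |>.add contDiff_const
  refine ⟨haff.continuous.add hw.continuous, haff.contDiffOn.congr fun x hx => ?_,
    fun x hx => (haff.contDiffAt.add (hw.contDiffAt x hx)).contDiffWithinAt,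
    fun φ hφ hc => ?_, hdec⟩
  · have e := hw.eq_zero x (subset_closure hx)
    simp only at e
    simp [e]
  · have h2 := hw.integral_conductivity_add_affine ho k p c hφ hc
    exact h2.trans (by rw [hf φ hφ hc, neg_add_cancel])

end Correctors

section Uniqueness

variable {d : ℕ} {Ω : Set (Euc d)} {w : Euc d → ℝ}

theorem HasCompactSupport.of_forall_eq_zero {E F : Type*} [TopologicalSpace E] [Zero F]
    {η : E → ℝ} (hc : HasCompactSupport η) {f : E → F}
    (h : ∀ x, η x = 0 → f x = 0) : HasCompactSupport f :=
  hc.mono fun x hx => by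
    rw [Function.mem_support] at hx ⊢
    exact fun h0 => hx (h x h0)

/-- The limit of testing the equation for `v = ⟪p, ·⟫ + c + w` against `η ^ 2 * v`. -/
theorem IsCondSol.integral_energy {k : ℝ} {a p : Euc d} {c : ℝ} (ho : IsOpen Ω)
    (h : IsCondSol d Ω k a (fun y => ⟪p, y⟫ + c + w y))
    (hw : IsWeaklyHarmonicOff (closure Ω) w) {η : Euc d → ℝ} (hη : ContDiff ℝ ∞ η)
    (hc : HasCompactSupport η) :
    Integrable (fun x => (1 + (k - 1) * Ω.indicator (fun _ => (1 : ℝ)) x) *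
      ⟪p + ∇ w x, η x ^ 2 • (p + ∇ w x) + (⟪p, x⟫ + c + w x) • (2 * η x) • ∇ η x⟫) ∧
    ∫ x, (1 + (k - 1) * Ω.indicator (fun _ => (1 : ℝ)) x) *
      ⟪p + ∇ w x, η x ^ 2 • (p + ∇ w x) + (⟪p, x⟫ + c + w x) • (2 * η x) • ∇ η x⟫ = 0 := by
  obtain ⟨C, hC0, hC⟩ := exists_deriv_truncate_le
  set A : Euc d → ℝ := fun x => 1 + (k - 1) * Ω.indicator (fun _ => (1 : ℝ)) x with hA
  have hAm : Measurable A :=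
    measurable_const.add (measurable_const.mul (measurable_const.indicator ho.measurableSet))
  have hAb : ∀ x, |A x| ≤ 1 + |k - 1| := fun x => by
    refine (abs_add_le _ _).trans ?_
    rw [abs_one, abs_mul]
    gcongr
    refine mul_le_of_le_one_right (abs_nonneg _) ?_
    by_cases hx : x ∈ Ω <;> simp [hx]
  set ℓ : Euc d → ℝ := fun y => ⟪p, y⟫ + c with hℓ
  have hℓc : ContDiff ℝ ∞ ℓ := contDiff_const.inner ℝ contDiff_id |>.add contDiff_const
  have hG : Measurable fun x => p + ∇ w x := measurable_const.add (measurable_gradient_s9 w)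
  let F : ℕ → Euc d → ℝ := fun n x => A x * ⟪p + ∇ w x,
    η x ^ 2 • (p + deriv (truncate n) (w x) • ∇ w x) +
      (ℓ x + truncate n (w x)) • (2 * η x) • ∇ η x⟫
  let b : Euc d → ℝ := fun x => (1 + |k - 1|) *
    (((‖p‖ + ‖∇ w x‖) * (‖p‖ + C * ‖∇ w x‖)) * η x ^ 2 +
      (‖p‖ + ‖∇ w x‖) * ((|ℓ x| + |w x|) * |2 * η x| * ‖∇ η x‖))
  have hb : Integrable b := by
    have l1 := hw.locallyIntegrable_norm_gradient
    have l2 := hw.locallyIntegrable_sq_norm_gradient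
    have m1 : LocallyIntegrable fun x => ‖p‖ + ‖∇ w x‖ := (locallyIntegrable_const _).add l1
    have m2 : LocallyIntegrable fun x => (‖p‖ + ‖∇ w x‖) * (‖p‖ + C * ‖∇ w x‖) := by
      have e : (fun x => (‖p‖ + ‖∇ w x‖) * (‖p‖ + C * ‖∇ w x‖)) =
          (fun _ => ‖p‖ ^ 2) + (((‖p‖ * (1 + C)) • fun x => ‖∇ w x‖) +
            C • fun x => ‖∇ w x‖ ^ 2) := by
        ext x
        simp only [Pi.add_apply, Pi.smul_apply, smul_eq_mul]
        ring
      rw [e]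
      exact (locallyIntegrable_const _).add ((l1.smul _).add (l2.smul _))
    refine Integrable.const_mul (Integrable.add ?_ ?_) _
    · exact m2.integrable_smul_right_of_hasCompactSupport (hη.continuous.pow 2)
        (hc.of_forall_eq_zero fun x hx => by simp [hx])
    · refine m1.integrable_smul_right_of_hasCompactSupport (g := fun x =>
        (|ℓ x| + |w x|) * |2 * η x| * ‖∇ η x‖) ?_
        (hc.of_forall_eq_zero fun x hx => by simp [hx])
      exact ((hℓc.continuous.abs.add hw.continuous.abs).mul
        (continuous_const.mul hη.continuous).abs).mul hη.continuous_gradient.norm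
  have hFm : ∀ n, AEStronglyMeasurable (F n) := fun n => by
    have t1 := ((contDiff_truncate n).continuous_deriv (by simp)).comp hw.continuous
    have t2 := (contDiff_truncate n).continuous.comp hw.continuous
    refine (hAm.mul (hG.inner (((hη.continuous.pow 2).measurable.smul
      (measurable_const.add (t1.measurable.smul (measurable_gradient_s9 w)))).add
      ((hℓc.continuous.add t2).measurable.smul ((continuous_const.mul
      hη.continuous).measurable.smul
        hη.continuous_gradient.measurable))))).aestronglyMeasurable
  have hFb : ∀ n x, ‖F n x‖ ≤ b x := fun n x => by
    have hd0 := deriv_truncate_nonneg n (w x)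
    have hdC := hC n (w x)
    have ht := abs_truncate_le n (w x)
    have hn : ‖η x ^ 2 • (p + deriv (truncate n) (w x) • ∇ w x) +
        (ℓ x + truncate n (w x)) • (2 * η x) • ∇ η x‖ ≤
        (‖p‖ + C * ‖∇ w x‖) * η x ^ 2 + (|ℓ x| + |w x|) * |2 * η x| * ‖∇ η x‖ := by
      refine (norm_add_le _ _).trans (add_le_add ?_ ?_)
      · rw [norm_smul, Real.norm_of_nonneg (sq_nonneg _), mul_comm]
        gcongr
        refine (norm_add_le _ _).trans ?_
        rw [norm_smul, Real.norm_of_nonneg hd0]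
        gcongr
      · rw [norm_smul, norm_smul, ← mul_assoc, Real.norm_eq_abs, Real.norm_eq_abs]
        gcongr
        exact (abs_add_le _ _).trans (by gcongr)
    calc ‖F n x‖ ≤ (1 + |k - 1|) * ((‖p‖ + ‖∇ w x‖) *
          ((‖p‖ + C * ‖∇ w x‖) * η x ^ 2 + (|ℓ x| + |w x|) * |2 * η x| * ‖∇ η x‖)) := by
          rw [norm_mul]
          refine mul_le_mul (hAb x) ?_ (norm_nonneg _) (by positivity)
          refine (norm_inner_le_norm _ _).trans ?_
          gcongr
          exact norm_add_le _ _
      _ = b x := by ring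
  have hFlim : ∀ᵐ x, Tendsto (fun n => F n x) atTop (𝓝 (A x *
      ⟪p + ∇ w x, η x ^ 2 • (p + ∇ w x) + (⟪p, x⟫ + c + w x) • (2 * η x) • ∇ η x⟫)) := by
    filter_upwards [hw.ae_hasGradientAt] with x hx
    refine tendsto_const_nhds.congr' ?_
    have hd : ∀ᶠ n : ℕ in atTop, deriv (truncate n) (w x) • ∇ w x = ∇ w x := by
      by_cases h0 : w x = 0
      · simp [hx.2 h0]
      · filter_upwards [eventually_deriv_truncate_eq_one h0] with n hn
        rw [hn, one_smul]
    filter_upwards [hd, eventually_truncate_eq_self (w x)] with n h1 h2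
    simp only [F, h1, h2, hℓ]
  have hF0 : ∀ n, ∫ x, F n x = 0 := fun n => by
    have t := hw.contDiff_comp (contDiff_truncate n) (truncate_eventually_zero n)
    have hφ : ContDiff ℝ ∞ fun x => η x ^ 2 * (ℓ x + truncate n (w x)) :=
      (hη.pow 2).mul (hℓc.add t)
    rw [← h.2.2.2.1 _ hφ (hc.of_forall_eq_zero fun x hx => by simp [hx])]
    refine integral_congr_ae ?_
    filter_upwards [hw.ae_gradient_add_affine p c] with x hx
    have g1 := (hη.contDiffAt (x := x)).hasGradientAt_grad
    have g2 := (hasGradientAt_inner_add_const p c x).add_grad t.contDiffAt.hasGradientAt_grad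
    rw [hw.gradient_comp (contDiff_truncate n) (truncate_eventually_zero n)] at g2
    have g3 := ((g1.mul_grad g1).mul_grad g2).gradient
    simp_rw [← sq] at g3
    rw [hx.1, g3, ← add_smul, ← two_mul]
  refine ⟨hb.mono' (aestronglyMeasurable_of_tendsto_ae _ hFm hFlim) ?_,
    tendsto_nhds_unique (tendsto_integral_of_dominated_convergence b hFm hb
      (fun n => Eventually.of_forall (hFb n)) hFlim) (by simp [hF0])⟩
  filter_upwards [hFlim] with x hx
  exact le_of_tendsto' hx.norm fun n => hFb n x

/-- A Caccioppoli-type estimate for `v = ⟪p, ·⟫ + c + w`, with a cutoff equal to one on `Ω`. -/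
theorem IsCondSol.sq_norm_mul_volume_le {k : ℝ} {a p : Euc d} {c : ℝ} (ho : IsOpen Ω)
    (hb : Bornology.IsBounded Ω)
    (h : IsCondSol d Ω k a (fun y => ⟪p, y⟫ + c + w y))
    (hw : IsWeaklyHarmonicOff (closure Ω) w) {η : Euc d → ℝ} (hη : ContDiff ℝ ∞ η)
    (hc : HasCompactSupport η) (h1 : ∀ x ∈ Ω, η x = 1) :
    k * ‖p‖ ^ 2 * volume.real Ω ≤ ∫ x, (⟪p, x⟫ + c + w x) ^ 2 * ‖∇ η x‖ ^ 2 := by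
  obtain ⟨hi, h0⟩ := h.integral_energy ho hw hη hc
  have hv : Continuous fun x => (⟪p, x⟫ + c + w x) ^ 2 * ‖∇ η x‖ ^ 2 :=
    (h.1.pow 2).mul (hη.continuous_gradient.norm.pow 2)
  have i1 : Integrable fun x => (⟪p, x⟫ + c + w x) ^ 2 * ‖∇ η x‖ ^ 2 :=
    hv.integrable_of_hasCompactSupport (hc.gradient.mono fun x hx => by
      rw [Function.mem_support] at hx ⊢
      contrapose! hx
      simp [hx])
  have i2 : Integrable (Ω.indicator fun _ => k * ‖p‖ ^ 2) :=
    (integrable_indicator_iff ho.measurableSet).2 (integrableOn_const hb.measure_lt_top.ne)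
  have h2 := integral_mono_ae (i2.sub i1) hi (by
    filter_upwards [hw.ae_hasGradientAt] with x hx
    simp only [Pi.sub_apply]
    by_cases hΩ : x ∈ Ω
    · have hg : ∇ η x = 0 := by
        have : η =ᶠ[𝓝 x] fun _ => 1 := by
          filter_upwards [ho.mem_nhds hΩ] with y hy using h1 y hy
        rw [this.gradient_eq]
        exact gradient_const x 1
      rw [hx.2 (hw.eq_zero x (subset_closure hΩ))]
      simp [hΩ, hg, h1 x hΩ]
    · have e : ∀ g : Euc d, -((⟪p, x⟫ + c + w x) ^ 2 * ‖∇ η x‖ ^ 2) ≤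
          ⟪g, η x ^ 2 • g + (⟪p, x⟫ + c + w x) • (2 * η x) • ∇ η x⟫ := fun g => by
        have := real_inner_self_nonneg (x := η x • g + (⟪p, x⟫ + c + w x) • ∇ η x)
        simp only [inner_add_left, inner_add_right, real_inner_smul_left,
          real_inner_smul_right, real_inner_self_eq_norm_sq, real_inner_comm g, norm_smul,
          mul_pow, Real.norm_eq_abs, sq_abs] at this ⊢
        linarith
      simpa [hΩ] using e (p + ∇ w x))
  rw [h0, integral_sub' i2 i1, integral_indicator ho.measurableSet] at h2
  simp at h2
  linarith

/-- A decaying solution which is affine in `Ω` is constant in `Ω`. -/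
theorem IsCondSol.eq_zero_of_decay {k : ℝ} (hk : 0 < k) (hd : 1 ≤ d) {p : Euc d} {c : ℝ}
    (ho : IsOpen Ω) (hb : Bornology.IsBounded Ω) (hne : Ω.Nonempty)
    (h : IsCondSol d Ω k 0 (fun y => ⟪p, y⟫ + c + w y))
    (hw : IsWeaklyHarmonicOff (closure Ω) w) : p = 0 := by
  obtain ⟨m, rfl⟩ := Nat.exists_eq_add_of_le' hd
  obtain ⟨C, R₀, hC, hR₀, hdec⟩ := h.2.2.2.2
  obtain ⟨R₁, hR₁⟩ := hb.subset_closedBall 0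
  let η : ContDiffBump (0 : Euc (m + 1)) := ⟨1, 2, one_pos, one_lt_two⟩
  have hη : ContDiff ℝ ∞ η := η.contDiff
  set I := ∫ x, ‖∇ η x‖ ^ 2
  have key : ∀ᶠ R : ℝ in atTop,
      k * ‖p‖ ^ 2 * volume.real Ω ≤ C ^ 2 * I * (R ^ (m + 1))⁻¹ := by
    filter_upwards [eventually_ge_atTop R₀, eventually_ge_atTop R₁, eventually_gt_atTop 0]
      with R hR0 hR1 hR
    have hηR : ContDiff ℝ ∞ fun x => η (R⁻¹ • x) := hη.comp (contDiff_const_smul _)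
    have hball : ∀ x, ‖x‖ ≤ R → η (R⁻¹ • x) = 1 := fun x hx =>
      η.one_of_mem_closedBall (by
        simp only [mem_closedBall, dist_zero_right, norm_smul, norm_inv, Real.norm_eq_abs,
          abs_of_pos hR, η]
        rwa [inv_mul_le_iff₀ hR, mul_one])
    have hgrad : ∀ x, ∇ (fun x => η (R⁻¹ • x)) x = R⁻¹ • ∇ η (R⁻¹ • x) := fun x =>
      (hη.contDiffAt.hasGradientAt_grad.comp_const_smul).gradient
    have hI : ∫ x, ‖∇ η (R⁻¹ • x)‖ ^ 2 = R ^ (m + 1) * I := by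
      rw [Measure.integral_comp_inv_smul_of_nonneg volume (fun x => ‖∇ η x‖ ^ 2) hR.le]
      simp [I]
    have hint : Integrable fun x => ‖∇ η (R⁻¹ • x)‖ ^ 2 := by
      refine Integrable.comp_smul (f := fun x => ‖∇ η x‖ ^ 2) ?_ (inv_ne_zero hR.ne')
      exact (hη.continuous_gradient.norm.pow
        2).integrable_of_hasCompactSupport (η.hasCompactSupport.gradient.mono fun x hx => by
          rw [Function.mem_support] at hx ⊢
          contrapose! hx
          simp [hx])
    refine (h.sq_norm_mul_volume_le ho hb hw hηR
      (η.hasCompactSupport.comp_smul (inv_ne_zero hR.ne')) fun x hx => hball x ?_).trans ?_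
    · simpa using closedBall_subset_closedBall hR1 (hR₁ hx)
    calc _ ≤ ∫ x, (C * (R ^ m)⁻¹ * R⁻¹) ^ 2 * ‖∇ η (R⁻¹ • x)‖ ^ 2 := by
          refine integral_mono_of_nonneg (Eventually.of_forall fun x => by positivity)
            (hint.const_mul _) (Eventually.of_forall fun x => ?_)
          simp only
          by_cases hx : ‖x‖ < R
          · have : (fun x => η (R⁻¹ • x)) =ᶠ[𝓝 x] fun _ => 1 := by
              filter_upwards [continuous_norm.continuousAt.eventually_lt_const hx] with y hy
              exact hball y hy.le
            have h0 : ∇ (fun _ : Euc (m + 1) => (1 : ℝ)) x = 0 := gradient_const x 1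
            rw [this.gradient_eq, h0, norm_zero]
            simp only [ne_eq, OfNat.ofNat_ne_zero, not_false_eq_true, zero_pow, mul_zero]
            positivity
          · rw [not_lt] at hx
            have h3 := hdec x (hR0.trans hx)
            have h4 : ‖x‖ ^ (1 - ((m + 1 : ℕ) : ℤ)) = (‖x‖ ^ m)⁻¹ := by
              rw [← zpow_natCast, ← zpow_neg]
              congr 1
              push_cast
              ring
            rw [h4, inner_zero_left, sub_zero] at h3
            have h5 : |⟪p, x⟫ + c + w x| ≤ C * (R ^ m)⁻¹ := h3.trans (by gcongr)
            rw [hgrad, norm_smul, Real.norm_of_nonneg (by positivity), ← sq_abs,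
              mul_pow _ R⁻¹, mul_pow R⁻¹, ← mul_assoc]
            gcongr
      _ = C ^ 2 * I * (R ^ (m + 1))⁻¹ := by
          rw [integral_const_mul, hI]
          field_simp
          ring
  have hlim : Tendsto (fun R : ℝ => C ^ 2 * I * (R ^ (m + 1))⁻¹) atTop (𝓝 (C ^ 2 * I * 0)) :=
    (tendsto_inv_atTop_zero.comp (tendsto_pow_atTop m.succ_ne_zero)).const_mul _
  have h6 := ge_of_tendsto hlim key
  have hvol : 0 < volume.real Ω :=
    ENNReal.toReal_pos (ho.measure_pos volume hne).ne' hb.measure_lt_top.ne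
  rw [mul_zero] at h6
  by_contra hp
  have : 0 < ‖p‖ := norm_pos_iff.2 hp
  exact absurd h6 (not_le.2 (by positivity))

end Uniqueness

/-- If the interior field is uniform for the three coordinate background fields at one
contrast `k₀`, then it is uniform for every background field at every contrast `k`. -/
theorem uniformity_independent_of_contrast (Ω : Set (Euc 3))
    (hne : Ω.Nonempty) (hbd : Bornology.IsBounded Ω) (hop : IsOpen Ω)
    (k₀ : ℝ) (hk₀ : 0 < k₀) (hk₀1 : k₀ ≠ 1)
    (h : ∀ j : Fin 3, ∃ u : Euc 3 → ℝ,
      IsCondSol 3 Ω k₀ (EuclideanSpace.single j (1 : ℝ)) u ∧ IsLinIn 3 Ω u) :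
    ∀ (k : ℝ), 0 < k → k ≠ 1 → ∀ a : Euc 3,
      ∃ u : Euc 3 → ℝ, IsCondSol 3 Ω k a u ∧ IsLinIn 3 Ω u := by
  intro k hk hk1
  choose u hu b c hbc using h
  have hk1' : k - 1 ≠ 0 := sub_ne_zero.2 hk1
  have hk₀1' : k₀ - 1 ≠ 0 := sub_ne_zero.2 hk₀1
  let w : Fin 3 → Euc 3 → ℝ := fun j x => u j x - (⟪b j, x⟫ + c j)
  have hw : ∀ j, ((k₀ - 1) • b j, w j) ∈ correctors Ω := fun j => by
    have e : u j = fun y => ⟪b j, y⟫ + c j + w j y := funext fun y => by simp [w]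
    refine IsCondSol.mem_correctors hop (c := c j) (e ▸ hu j) fun x hx => ?_
    simp [w, hbc j x hx]
  let β : Euc 3 →ₗ[ℝ] Euc 3 :=
    ∑ j, (EuclideanSpace.proj j : Euc 3 →L[ℝ] ℝ).toLinearMap.smulRight (b j)
  have hβ : ∀ s, β s = ∑ j, s j • b j := fun s => by simp [β]
  let W : Euc 3 → Euc 3 → ℝ := fun s => ∑ j, s j • w j
  let L : Euc 3 →ₗ[ℝ] Euc 3 := ((k₀ - 1) / (k - 1)) • β - β + LinearMap.id
  have hL : ∀ s, L s = ((k₀ - 1) / (k - 1)) • β s - β s + s := fun s => rfl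
  have hmem : ∀ s, ((k - 1) • ((k₀ - 1) / (k - 1)) • β s, W s) ∈ correctors Ω := fun s => by
    have e : ((k - 1) • ((k₀ - 1) / (k - 1)) • β s, W s) =
        ∑ j, s j • ((k₀ - 1) • b j, w j) := by
      refine Prod.ext ?_ ?_ <;> simp only
      · rw [smul_smul, mul_div_cancel₀ _ hk1', hβ, Finset.smul_sum, Prod.fst_sum]
        exact Finset.sum_congr rfl fun j _ => smul_comm (k₀ - 1) (s j) (b j)
      · rw [Prod.snd_sum]
        rfl
    rw [e]
    exact Submodule.sum_mem _ fun j _ => Submodule.smul_mem _ _ (hw j)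
  have hsol : ∀ s, IsCondSol 3 Ω k (L s) fun y =>
      ⟪((k₀ - 1) / (k - 1)) • β s, y⟫ + (∑ j, s j * c j) + W s y := fun s => by
    refine isCondSol_of_mem_correctors hop (hmem s) ?_
    choose C R hC hR hdec using fun j => (hu j).2.2.2.2
    refine ⟨∑ j, |s j| * C j + 1, ∑ j, R j,
      add_pos_of_nonneg_of_pos (Finset.sum_nonneg fun j _ =>
        mul_nonneg (abs_nonneg _) (hC j).le) one_pos,
      Finset.sum_pos (fun j _ => hR j) Finset.univ_nonempty, fun x hx => ?_⟩
    have e : ⟪((k₀ - 1) / (k - 1)) • β s, x⟫ + (∑ j, s j * c j) + W s x - ⟪L s, x⟫ =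
        ∑ j, s j * (u j x - ⟪EuclideanSpace.single j (1 : ℝ), x⟫) := by
      have e1 : ⟪s, x⟫ = ∑ j, s j * x j := by
        simp [PiLp.inner_apply, mul_comm]
      have e2 : ⟪β s, x⟫ = ∑ j, s j * ⟪b j, x⟫ := by
        simp_rw [hβ, sum_inner, real_inner_smul_left]
      have e3 : W s x = ∑ j, s j * (u j x - (⟪b j, x⟫ + c j)) := by
        simp [W, w]
      rw [hL, inner_add_left, inner_sub_left, e1, e2, e3]
      simp only [EuclideanSpace.inner_single_left, mul_sub, mul_add, Finset.sum_sub_distrib,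
        Finset.sum_add_distrib, map_one, one_mul]
      ring
    have hz : 0 ≤ ‖x‖ ^ (1 - ((3 : ℕ) : ℤ)) := by positivity
    rw [e]
    calc _ ≤ ∑ j, |s j * (u j x - ⟪EuclideanSpace.single j (1 : ℝ), x⟫)| :=
          Finset.abs_sum_le_sum_abs _ _
      _ ≤ ∑ j, |s j| * C j * ‖x‖ ^ (1 - ((3 : ℕ) : ℤ)) := by
          refine Finset.sum_le_sum fun j _ => ?_
          rw [abs_mul, mul_assoc]
          gcongr
          exact hdec j x ((Finset.single_le_sum (fun i _ => (hR i).le)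
            (Finset.mem_univ j)).trans hx)
      _ ≤ _ := by
          rw [← Finset.sum_mul]
          gcongr
          exact le_add_of_nonneg_right zero_le_one
  have hinj : Function.Injective L := by
    refine (injective_iff_map_eq_zero L).2 fun s hs => ?_
    have h0 := (hs ▸ hsol s).eq_zero_of_decay hk (by norm_num) hop hbd hne (hmem s).1
    have hβ0 : β s = 0 := (smul_eq_zero.1 h0).resolve_left (div_ne_zero hk₀1' hk1')
    rwa [hL, hβ0, smul_zero, sub_zero, zero_add] at hs
  intro a
  obtain ⟨s, rfl⟩ := (LinearMap.injective_iff_surjective.1 hinj) a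
  refine ⟨_, hsol s, ((k₀ - 1) / (k - 1)) • β s, ∑ j, s j * c j, fun x hx => ?_⟩
  have h0 : W s x = 0 := (hmem s).1.eq_zero x (subset_closure hx)
  simp [h0]
end
end
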